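/- Caccioppoli inequality with time cutoff (Lemma 2.5, inequality (2.2)). Let v be a local weak subsolution of the homogeneous equation ∂_t v − div(𝒜(t,x,Dv)) + ℒv = 0 in Ω_T, let l ∈ ℝ, and set w₊ = max{v − l, 0}, w₋ = −min{v − l, 0}. Then for every R ∈ (0,1] and (t₀,x₀) with I_{2R}^⊖(t₀) × B_{2R}(x₀) compactly contained in I × Ω, and all 0 < ρ₁ ≤ r with r + ρ₁ ≤ R and 0 < ρ₂ ≤ r with r + ρ₂ ≤ R such that I_{r+ρ₁}^⊖(t₀) × B_{r+ρ₂}(x₀) ⊂ Q_{2R}(t₀,x₀), there exists C > 0 depending only on d, s, Λ such that: ess sup_{t ∈ I_r^⊖(t₀)} ∫_{B_r(x₀)} w₊²(t,x) dx + ∫_{I_r^⊖(t₀)}∫_{B_r(x₀)} |Dw₊|² dx dt + ∫_{I_r^⊖(t₀)}∫_{B_r(x₀)}∫_{B_r(x₀)} |w₊(t,x) − w₊(t,y)|² |x−y|^{−d−2s} dx dy dt + r^{−d−2s} ∫_{I_r^⊖(t₀)}∫_{B_r(x₀)}∫_{B_r(x₀)} w₊(t,x) w₋(t,y) dx dy dt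 ≤ C max{ρ₁^{−2}, ρ₂^{−2}} ∫_{I_{r+ρ₁}^⊖(t₀)}∫_{B_{r+ρ₂}(x₀)} w₊² dx dt + C ((r+ρ₂)/ρ₂)^d ρ₂^{−2} ∫_{I_{r+ρ₁}^⊖(t₀)} (∫_{B_{r+ρ₂}(x₀)} w₊(t,x) dx) Tail(w₊(t); x₀, r+ρ₂) dt. The same inequality holds with w₊ and w₋ interchanged when v is a local weak supersolution. -/

import Mathlib

open MeasureTheory Set Filter Metric
open scoped ENNReal NNReal Topology RealInnerProductSpace

noncomputable section

/-- Euclidean space `ℝ^d`. -/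
abbrev Ed (d : ℕ) : Type := EuclideanSpace ℝ (Fin d)

variable {d : ℕ}

/-- Backward time interval `I_r^⊖(t₀) = (t₀ - r², t₀)`. -/
def Iminus (t₀ r : ℝ) : Set ℝ := Set.Ioo (t₀ - r ^ 2) t₀

/-- Parabolic cylinder `Q_r(t₀,x₀) = I_r^⊖(t₀) × B_r(x₀)`. -/
def pCyl (t₀ : ℝ) (x₀ : Ed d) (r : ℝ) : Set (ℝ × Ed d) :=
  (Iminus t₀ r) ×ˢ (Metric.ball x₀ r)

/-- Nonlocal tail `Tail(v; x₀, R) = R² ∫_{ℝ^d ∖ B_R(x₀)} |v(y)| |x₀ - y|^{-d-2s} dy`. -/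
def Tail (s : ℝ) (v : Ed d → ℝ) (x₀ : Ed d) (R : ℝ) : ℝ :=
  R ^ 2 * ∫ y in (Metric.ball x₀ R)ᶜ, |v y| / ‖x₀ - y‖ ^ ((d : ℝ) + 2 * s)

/-- Caloric Riesz potential `ℐ^ν_α(t₀,x₀;R) = ∫₀^R ν(Q_ρ(t₀,x₀)) ρ^{-(d+2-α)} dρ/ρ`
for a nonnegative measure `ν`. -/
def RieszPot (ν : Measure (ℝ × Ed d)) (α : ℝ) (t₀ : ℝ) (x₀ : Ed d) (R : ℝ) : ℝ :=
  ∫ ρ in Set.Ioo (0 : ℝ) R, (ν (pCyl t₀ x₀ ρ)).toReal / ρ ^ ((d : ℝ) + 2 - α) / ρ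

/-- The structure conditions (1.2)-(1.3) on the vector field `𝒜`. -/
structure VectorFieldHyp (d : ℕ) (Λ : ℝ) (A : ℝ → Ed d → Ed d → Ed d) : Prop where
  meas : ∀ ξ : Ed d, Measurable fun p : ℝ × Ed d => A p.1 p.2 ξ
  cont : ∀ t x, Continuous (A t x)
  growth : ∀ t x ξ, ‖A t x ξ‖ ≤ Λ * ‖ξ‖
  monotone : ∀ t x ξ η, Λ⁻¹ * ‖η - ξ‖ ^ 2 ≤ ⟪A t x η - A t x ξ, η - ξ⟫

/-- The ellipticity and symmetry conditions on the jump kernel `K`. -/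
structure KernelHyp (d : ℕ) (s Λ : ℝ) (K : ℝ → Ed d → Ed d → ℝ) : Prop where
  meas : Measurable fun p : ℝ × Ed d × Ed d => K p.1 p.2.1 p.2.2
  symm : ∀ t x y, K t x y = K t y x
  lower : ∀ t x y, x ≠ y → Λ⁻¹ / ‖x - y‖ ^ ((d : ℝ) + 2 * s) ≤ K t x y
  upper : ∀ t x y, x ≠ y → K t x y ≤ Λ / ‖x - y‖ ^ ((d : ℝ) + 2 * s)

/-- Membership of `v` (with weak spatial gradient `Dv`) in the function space
`L²_loc(J; W^{1,2}_loc(Ω)) ∩ L^∞_loc(J; L²_loc(Ω)) ∩ L²_loc(J; 𝓛¹_{2s}(ℝ^d))`. -/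
structure LocalWeakReg (d : ℕ) (s : ℝ) (J : Set ℝ) (Ω : Set (Ed d))
    (v : ℝ → Ed d → ℝ) (Dv : ℝ → Ed d → Ed d) : Prop where
  meas : Measurable (Function.uncurry v)
  measD : Measurable (Function.uncurry Dv)
  grad : ∀ t ∈ J, ∀ φ : Ed d → ℝ, ContDiff ℝ (⊤ : ℕ∞) φ → HasCompactSupport φ →
    tsupport φ ⊆ Ω → ∀ e : Ed d,
      ∫ x, v t x * (fderiv ℝ φ x) e = - ∫ x, φ x * ⟪Dv t x, e⟫
  l2w12 : ∀ t₁ t₂ : ℝ, Set.Icc t₁ t₂ ⊆ J → ∀ Kc : Set (Ed d), IsCompact Kc → Kc ⊆ Ω →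
    MeasureTheory.IntegrableOn
      (fun p : ℝ × Ed d => (v p.1 p.2) ^ 2 + ‖Dv p.1 p.2‖ ^ 2) ((Set.Ioo t₁ t₂) ×ˢ Kc)
  linfl2 : ∀ t₁ t₂ : ℝ, Set.Icc t₁ t₂ ⊆ J → ∀ Kc : Set (Ed d), IsCompact Kc → Kc ⊆ Ω →
    ∃ M : ℝ, ∀ᵐ t ∂(volume.restrict (Set.Ioo t₁ t₂)), (∫ x in Kc, (v t x) ^ 2) ≤ M
  tail_ae : ∀ᵐ t : ℝ, t ∈ J →
    MeasureTheory.Integrable fun y : Ed d => |v t y| / (1 + ‖y‖ ^ ((d : ℝ) + 2 * s))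
  tail_l2 : ∀ t₁ t₂ : ℝ, Set.Icc t₁ t₂ ⊆ J →
    MeasureTheory.IntegrableOn
      (fun t => (∫ y : Ed d, |v t y| / (1 + ‖y‖ ^ ((d : ℝ) + 2 * s))) ^ 2) (Set.Ioo t₁ t₂)

/-- Smooth test functions with compact spatial support contained in `Ω`. -/
def IsTestFunction (Ω : Set (Ed d)) (φ : ℝ → Ed d → ℝ) : Prop :=
  ContDiff ℝ (⊤ : ℕ∞) (Function.uncurry φ) ∧
    ∃ Kc : Set (Ed d), IsCompact Kc ∧ Kc ⊆ Ω ∧ ∀ t, tsupport (φ t) ⊆ Kc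

/-- The left-hand side of the weak formulation of
`∂_t u - div(𝒜(t,x,Du)) + ℒu` tested against `φ` on `(t₁,t₂] × Ω`. -/
def mixedLHS (A : ℝ → Ed d → Ed d → Ed d) (K : ℝ → Ed d → Ed d → ℝ)
    (Ω : Set (Ed d)) (u : ℝ → Ed d → ℝ) (Du : ℝ → Ed d → Ed d)
    (φ : ℝ → Ed d → ℝ) (t₁ t₂ : ℝ) : ℝ :=
  -(∫ t in Set.Ioc t₁ t₂, ∫ x in Ω, u t x * deriv (fun τ => φ τ x) t)
    + (∫ x in Ω, u t₂ x * φ t₂ x) - (∫ x in Ω, u t₁ x * φ t₁ x)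
    + (∫ t in Set.Ioc t₁ t₂, ∫ x in Ω, ⟪A t x (Du t x), gradient (φ t) x⟫)
    + ∫ t in Set.Ioc t₁ t₂, ∫ x : Ed d, ∫ y : Ed d,
        (u t x - u t y) * (φ t x - φ t y) * K t x y

/-- Integral of a function against a finite signed measure. -/
def signedIntegral (μ : MeasureTheory.SignedMeasure (ℝ × Ed d)) (f : ℝ × Ed d → ℝ) : ℝ :=
  (∫ p, f p ∂μ.toJordanDecomposition.posPart)
    - ∫ p, f p ∂μ.toJordanDecomposition.negPart

/-- Local weak solution of `∂_t u - div(𝒜(t,x,Du)) + ℒu = μ` in `J × Ω`. -/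
def IsLocalWeakSolution (A : ℝ → Ed d → Ed d → Ed d) (K : ℝ → Ed d → Ed d → ℝ)
    (J : Set ℝ) (Ω : Set (Ed d)) (μ : MeasureTheory.SignedMeasure (ℝ × Ed d))
    (u : ℝ → Ed d → ℝ) (Du : ℝ → Ed d → Ed d) : Prop :=
  ∀ t₁ t₂ : ℝ, t₁ ≤ t₂ → Set.Icc t₁ t₂ ⊆ J →
    ∀ φ : ℝ → Ed d → ℝ, IsTestFunction Ω φ →
      mixedLHS A K Ω u Du φ t₁ t₂ =
        signedIntegral μ (Set.indicator ((Set.Ioc t₁ t₂) ×ˢ Ω) fun p => φ p.1 p.2)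

/-- Local weak solution of the homogeneous equation
`∂_t v - div(𝒜(t,x,Dv)) + ℒv = 0` in `J × Ω`. -/
def IsLocalWeakSolutionHom (A : ℝ → Ed d → Ed d → Ed d) (K : ℝ → Ed d → Ed d → ℝ)
    (J : Set ℝ) (Ω : Set (Ed d))
    (v : ℝ → Ed d → ℝ) (Dv : ℝ → Ed d → Ed d) : Prop :=
  ∀ t₁ t₂ : ℝ, t₁ ≤ t₂ → Set.Icc t₁ t₂ ⊆ J →
    ∀ φ : ℝ → Ed d → ℝ, IsTestFunction Ω φ → mixedLHS A K Ω v Dv φ t₁ t₂ = 0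

/-- Local weak subsolution of the homogeneous equation in `J × Ω`. -/
def IsLocalWeakSubsolutionHom (A : ℝ → Ed d → Ed d → Ed d) (K : ℝ → Ed d → Ed d → ℝ)
    (J : Set ℝ) (Ω : Set (Ed d))
    (v : ℝ → Ed d → ℝ) (Dv : ℝ → Ed d → Ed d) : Prop :=
  ∀ t₁ t₂ : ℝ, t₁ ≤ t₂ → Set.Icc t₁ t₂ ⊆ J →
    ∀ φ : ℝ → Ed d → ℝ, IsTestFunction Ω φ → (∀ t x, 0 ≤ φ t x) →
      mixedLHS A K Ω v Dv φ t₁ t₂ ≤ 0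

/-- Local weak supersolution of the homogeneous equation in `J × Ω`. -/
def IsLocalWeakSupersolutionHom (A : ℝ → Ed d → Ed d → Ed d) (K : ℝ → Ed d → Ed d → ℝ)
    (J : Set ℝ) (Ω : Set (Ed d))
    (v : ℝ → Ed d → ℝ) (Dv : ℝ → Ed d → Ed d) : Prop :=
  ∀ t₁ t₂ : ℝ, t₁ ≤ t₂ → Set.Icc t₁ t₂ ⊆ J →
    ∀ φ : ℝ → Ed d → ℝ, IsTestFunction Ω φ → (∀ t x, φ t x ≤ 0) →
      mixedLHS A K Ω v Dv φ t₁ t₂ ≤ 0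

/-- The global excess functional `E(u,t₀,x₀,R)`. -/
def Excess (s q : ℝ) (u : ℝ → Ed d → ℝ) (t₀ : ℝ) (x₀ : Ed d) (R : ℝ) : ℝ :=
  (⨍ t in Iminus t₀ R, (⨍ x in Metric.ball x₀ R,
      |u t x - ⨍ p in pCyl t₀ x₀ R, u p.1 p.2|) ^ q) ^ (1 / q)
  + (⨍ t in Iminus t₀ R,
      (Tail s (fun y => u t y - ⨍ p in pCyl t₀ x₀ R, u p.1 p.2) x₀ R) ^ q) ^ (1 / q)

/-- Weak gradient of the truncation `w₊ = (v-l)₊`, namely `Dv · 1_{v>l}`. -/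
def truncGradPos (v : ℝ → Ed d → ℝ) (Dv : ℝ → Ed d → Ed d) (l : ℝ) : ℝ → Ed d → Ed d :=
  fun t x => if l < v t x then Dv t x else 0

/-- Weak gradient of the truncation `w₋ = (v-l)₋`, namely `Dv · 1_{v<l}`. -/
def truncGradNeg (v : ℝ → Ed d → ℝ) (Dv : ℝ → Ed d → Ed d) (l : ℝ) : ℝ → Ed d → Ed d :=
  fun t x => if v t x < l then Dv t x else 0

/-- The space–time energy terms on the left-hand side of the Caccioppoli inequality:
gradient term, fractional seminorm term and mixed positivity term, with time interval
`I_{rt}^⊖(t₀)` and spatial ball `B_r(x₀)`. -/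
def caccLHS (d : ℕ) (s : ℝ) (t₀ : ℝ) (x₀ : Ed d) (rt r : ℝ)
    (wp wm : ℝ → Ed d → ℝ) (Dwp : ℝ → Ed d → Ed d) : ℝ :=
  (∫ τ in Iminus t₀ rt, ∫ x in Metric.ball x₀ r, ‖Dwp τ x‖ ^ 2)
    + (∫ τ in Iminus t₀ rt, ∫ x in Metric.ball x₀ r, ∫ y in Metric.ball x₀ r,
        (wp τ x - wp τ y) ^ 2 / ‖x - y‖ ^ ((d : ℝ) + 2 * s))
    + r ^ (-((d : ℝ) + 2 * s)) *
        ∫ τ in Iminus t₀ rt, ∫ x in Metric.ball x₀ r, ∫ y in Metric.ball x₀ r,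
          wp τ x * wm τ y

/-- The tail term on the right-hand side of the Caccioppoli inequality. -/
def caccTailTerm (d : ℕ) (s : ℝ) (t₀ : ℝ) (x₀ : Ed d) (r ρ₁ ρ₂ : ℝ)
    (wp : ℝ → Ed d → ℝ) : ℝ :=
  ((r + ρ₂) / ρ₂) ^ d / ρ₂ ^ 2 *
    ∫ τ in Iminus t₀ (r + ρ₁),
      (∫ x in Metric.ball x₀ (r + ρ₂), wp τ x) * Tail s (wp τ) x₀ (r + ρ₂)
section L2Tools

variable {V : Type*} [AddCommGroup V] [TopologicalSpace V] [IsTopologicalAddGroup V]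
  [R1Space V] [MeasurableSpace V] [BorelSpace V]
  {E : Type*} [NormedAddCommGroup E]

/-- Translations are continuous in `L²`. -/
theorem tendsto_eLpNorm_translate_sub (μ : Measure V) [IsLocallyFiniteMeasure μ]
    [μ.InnerRegularCompactLTTop] [μ.IsAddRightInvariant] {f : V → E} (hf : MemLp f 2 μ) :
    Tendsto (fun z : V => eLpNorm (fun x => f (x + z) - f x) 2 μ) (𝓝 0) (𝓝 0) := by
  let g : C(V, C(V, V)) := (ContinuousMap.mk (fun a : V × V => a.2 + a.1) (by fun_prop)).curry
  have hg : ∀ z, MeasurePreserving (g z) μ μ := fun z => measurePreserving_add_right μ z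
  have h1 : Tendsto (fun z : V => Lp.compMeasurePreserving (g z) (hg z) (hf.toLp f)) (𝓝 0)
      (𝓝 (Lp.compMeasurePreserving (g 0) (hg 0) (hf.toLp f))) :=
    Filter.Tendsto.compMeasurePreservingLp tendsto_const_nhds (g.continuous.tendsto 0) hg (hg 0)
      (by simp)
  rw [Lp.tendsto_Lp_iff_tendsto_eLpNorm'] at h1
  refine h1.congr fun z => eLpNorm_congr_ae ?_
  have e1 := Lp.coeFn_compMeasurePreserving (hf.toLp f) (hg z)
  have e2 := Lp.coeFn_compMeasurePreserving (hf.toLp f) (hg 0)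
  have e3 := (hg z).quasiMeasurePreserving.ae_eq_comp hf.coeFn_toLp
  have e4 := (hg 0).quasiMeasurePreserving.ae_eq_comp hf.coeFn_toLp
  filter_upwards [e1, e2, e3, e4] with x h1 h2 h3 h4
  simp only [Pi.sub_apply, h1, h2, h3, h4]
  simp [g]

end L2Tools

section Pairing

variable {X : Type*} [MeasurableSpace X] {μ : Measure X}
  {E : Type*} [NormedAddCommGroup E] [InnerProductSpace ℝ E]

theorem MeasureTheory.MemLp.integrable_inner {F Φ : X → E} (hF : MemLp F 2 μ) (hΦ : MemLp Φ 2 μ) :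
    Integrable (fun x => ⟪F x, Φ x⟫) μ := by
  refine Integrable.mono' ((hF.norm.integrable_mul hΦ.norm)) (hF.1.inner hΦ.1) ?_
  exact Eventually.of_forall fun x => by simpa using abs_real_inner_le_norm (F x) (Φ x)

theorem abs_integral_inner_le {F Φ : X → E} (hF : MemLp F 2 μ) (hΦ : MemLp Φ 2 μ) :
    |∫ x, ⟪F x, Φ x⟫ ∂μ| ≤ (eLpNorm F 2 μ).toReal * (eLpNorm Φ 2 μ).toReal := by
  have h : ∫ x, ⟪F x, Φ x⟫ ∂μ = ⟪hF.toLp F, hΦ.toLp Φ⟫ := by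
    rw [L2.inner_def]
    refine integral_congr_ae ?_
    filter_upwards [hF.coeFn_toLp, hΦ.coeFn_toLp] with x h1 h2
    rw [h1, h2]
  rw [h, ← Lp.norm_toLp F hF, ← Lp.norm_toLp Φ hΦ]
  exact abs_real_inner_le_norm _ _

/-- Pairing with a fixed square integrable function is continuous in `L²`. -/
theorem tendsto_integral_inner_of_tendsto_eLpNorm {ι : Type*} {u : Filter ι} {F Φ : X → E}
    {Ψ : ι → X → E} (hF : MemLp F 2 μ) (hΦ : MemLp Φ 2 μ) (hΨ : ∀ i, MemLp (Ψ i) 2 μ)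
    (h : Tendsto (fun i => eLpNorm (Ψ i - Φ) 2 μ) u (𝓝 0)) :
    Tendsto (fun i => ∫ x, ⟪F x, Ψ i x⟫ ∂μ) u (𝓝 (∫ x, ⟪F x, Φ x⟫ ∂μ)) := by
  rw [tendsto_iff_norm_sub_tendsto_zero]
  have h0 : Tendsto (fun i => (eLpNorm F 2 μ).toReal * (eLpNorm (Ψ i - Φ) 2 μ).toReal) u (𝓝 0) := by
    have := (ENNReal.tendsto_toReal ENNReal.zero_ne_top).comp h
    simpa using this.const_mul (eLpNorm F 2 μ).toReal
  refine squeeze_zero (fun _ => norm_nonneg _) (fun i => ?_) h0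
  rw [← integral_sub (hF.integrable_inner (hΨ i)) (hF.integrable_inner hΦ)]
  simp only [← inner_sub_right]
  exact abs_integral_inner_le hF ((hΨ i).sub hΦ)

end Pairing

section TimeShift

variable {Z : Type*} [MeasurableSpace Z] {μ : Measure Z} [SigmaFinite μ]

theorem measurePreserving_time_shift (σ : ℝ) :
    MeasurePreserving (fun p : ℝ × Z => (p.1 - σ, p.2)) (volume.prod μ) (volume.prod μ) :=
  (measurePreserving_sub_right volume σ).prod (MeasurePreserving.id μ)

variable {E : Type*} [NormedAddCommGroup E] [InnerProductSpace ℝ E]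

/-- The correlation in time of two square integrable functions is continuous. -/
theorem continuous_time_correlation [TopologicalSpace Z] [R1Space Z] [SecondCountableTopology Z]
    [BorelSpace Z] [IsLocallyFiniteMeasure μ]
    [(volume.prod μ : Measure (ℝ × Z)).InnerRegularCompactLTTop]
    {F Φ : ℝ × Z → E} (hF : MemLp F 2 (volume.prod μ))
    (hΦ : MemLp Φ 2 (volume.prod μ)) :
    Continuous fun σ : ℝ => ∫ p, ⟪F (p.1 - σ, p.2), Φ p⟫ ∂(volume.prod μ) := by
  let g : C(ℝ, C(ℝ × Z, ℝ × Z)) :=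
    (ContinuousMap.mk (fun a : ℝ × (ℝ × Z) => (a.2.1 - a.1, a.2.2)) (by fun_prop)).curry
  have hg : ∀ σ, MeasurePreserving (g σ) (volume.prod μ) (volume.prod μ) :=
    fun σ => measurePreserving_time_shift σ
  have h1 : Continuous fun σ : ℝ => Lp.compMeasurePreserving (g σ) (hg σ) (hF.toLp F) :=
    Continuous.compMeasurePreservingLp continuous_const g.continuous hg (by simp)
  have h2 : Continuous fun σ : ℝ =>
      ⟪Lp.compMeasurePreserving (g σ) (hg σ) (hF.toLp F), hΦ.toLp Φ⟫ := h1.inner continuous_const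
  refine h2.congr fun σ => ?_
  rw [L2.inner_def]
  refine integral_congr_ae ?_
  filter_upwards [Lp.coeFn_compMeasurePreserving (hF.toLp F) (hg σ), hΦ.coeFn_toLp,
    (hg σ).quasiMeasurePreserving.ae_eq_comp hF.coeFn_toLp] with p h1 h2 h3
  rw [h1, h2, h3]
  rfl

theorem integrable_time_correlation {F Φ : ℝ × Z → E} (hFm : StronglyMeasurable F)
    (hΦm : StronglyMeasurable Φ) (hF : MemLp F 2 (volume.prod μ))
    (hΦ : MemLp Φ 2 (volume.prod μ)) (h : ℝ) :
    Integrable (fun q : ℝ × (ℝ × Z) => ⟪F (q.2.1 - q.1, q.2.2), Φ q.2⟫)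
      ((volume.restrict (Ioc 0 h)).prod (volume.prod μ)) := by
  have hm : Measurable fun q : ℝ × (ℝ × Z) => (q.2.1 - q.1, q.2.2) := by fun_prop
  have hsk : MeasurePreserving (fun q : ℝ × (ℝ × Z) => (q.1, (q.2.1 - q.1, q.2.2)))
      ((volume.restrict (Ioc 0 h)).prod (volume.prod μ))
      ((volume.restrict (Ioc 0 h)).prod (volume.prod μ)) :=
    (MeasurePreserving.id _).skew_product (g := fun σ (p : ℝ × Z) => (p.1 - σ, p.2)) (by fun_prop)
      (Eventually.of_forall fun σ => (measurePreserving_time_shift σ).map_eq)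
  have i1 : Integrable (fun q : ℝ × (ℝ × Z) => ‖F (q.2.1 - q.1, q.2.2)‖ ^ 2)
      ((volume.restrict (Ioc 0 h)).prod (volume.prod μ)) := by
    have := (hF.integrable_norm_pow (by norm_num)).comp_snd (volume.restrict (Ioc (0 : ℝ) h))
    exact hsk.integrable_comp_of_integrable this
  have i2 : Integrable (fun q : ℝ × (ℝ × Z) => ‖Φ q.2‖ ^ 2)
      ((volume.restrict (Ioc 0 h)).prod (volume.prod μ)) :=
    (hΦ.integrable_norm_pow (by norm_num)).comp_snd (volume.restrict (Ioc (0 : ℝ) h))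
  refine (i1.add i2).mono'
    ((hFm.comp_measurable hm).inner (hΦm.comp_measurable measurable_snd)).aestronglyMeasurable ?_
  refine Eventually.of_forall fun q => ?_
  have := abs_real_inner_le_norm (F (q.2.1 - q.1, q.2.2)) (Φ q.2)
  simp only [Pi.add_apply, Real.norm_eq_abs]
  nlinarith [sq_nonneg (‖F (q.2.1 - q.1, q.2.2)‖ - ‖Φ q.2‖),
    sq_nonneg (‖F (q.2.1 - q.1, q.2.2)‖ + ‖Φ q.2‖)]

/-- Backward averages paired against a function of the present time, as averaged correlations. -/
theorem integral_backward_pairing_eq {F Φ : ℝ × Z → E} (hFm : StronglyMeasurable F)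
    (hΦm : StronglyMeasurable Φ) (hF : MemLp F 2 (volume.prod μ))
    (hΦ : MemLp Φ 2 (volume.prod μ)) {h : ℝ} (hh : 0 ≤ h) :
    Integrable (fun t => ∫ τ in Ioc (t - h) t, ∫ z, ⟪F (τ, z), Φ (t, z)⟫ ∂μ) ∧
    ∫ t, ∫ τ in Ioc (t - h) t, ∫ z, ⟪F (τ, z), Φ (t, z)⟫ ∂μ =
      ∫ σ in (0 : ℝ)..h, ∫ p, ⟪F (p.1 - σ, p.2), Φ p⟫ ∂(volume.prod μ) := by
  have hint := integrable_time_correlation hFm hΦm hF hΦ h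
  have hassoc : Integrable (fun q : (ℝ × ℝ) × Z => ⟪F (q.1.2 - q.1.1, q.2), Φ (q.1.2, q.2)⟫)
      (((volume.restrict (Ioc 0 h)).prod (volume : Measure ℝ)).prod μ) := by
    have := (measurePreserving_prodAssoc (volume.restrict (Ioc (0 : ℝ) h)) (volume : Measure ℝ) μ)
    exact this.integrable_comp_of_integrable hint
  have h2 : Integrable (fun q : ℝ × ℝ => ∫ z, ⟪F (q.2 - q.1, z), Φ (q.2, z)⟫ ∂μ)
      ((volume.restrict (Ioc 0 h)).prod volume) := hassoc.integral_prod_left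
  have key : ∀ t, ∫ τ in Ioc (t - h) t, ∫ z, ⟪F (τ, z), Φ (t, z)⟫ ∂μ =
      ∫ σ in Ioc 0 h, ∫ z, ⟪F (t - σ, z), Φ (t, z)⟫ ∂μ := by
    intro t
    rw [← intervalIntegral.integral_of_le (by linarith), ← intervalIntegral.integral_of_le hh,
      intervalIntegral.integral_comp_sub_left (fun τ => ∫ z, ⟪F (τ, z), Φ (t, z)⟫ ∂μ) t]
    simp
  simp only [key]
  refine ⟨h2.swap.integral_prod_left, ?_⟩
  rw [← integral_integral_swap h2, intervalIntegral.integral_of_le hh]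
  refine integral_congr_ae ?_
  filter_upwards [hint.prod_right_ae] with σ hσ
  exact (integral_prod _ hσ).symm

theorem tendsto_average_backward_pairing [TopologicalSpace Z] [R1Space Z] [SecondCountableTopology Z]
    [BorelSpace Z] [IsLocallyFiniteMeasure μ]
    [(volume.prod μ : Measure (ℝ × Z)).InnerRegularCompactLTTop]
    {F Φ : ℝ × Z → E} (hFm : StronglyMeasurable F)
    (hΦm : StronglyMeasurable Φ) (hF : MemLp F 2 (volume.prod μ))
    (hΦ : MemLp Φ 2 (volume.prod μ)) :
    Tendsto (fun h : ℝ => h⁻¹ * ∫ t, ∫ τ in Ioc (t - h) t, ∫ z, ⟪F (τ, z), Φ (t, z)⟫ ∂μ)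
      (𝓝[>] 0) (𝓝 (∫ p, ⟪F p, Φ p⟫ ∂(volume.prod μ))) := by
  have hc := continuous_time_correlation hF hΦ
  have hd := (intervalIntegral.integral_hasDerivAt_right (hc.intervalIntegrable 0 0)
    hc.aestronglyMeasurable.stronglyMeasurableAtFilter hc.continuousAt).tendsto_slope_zero_right
  simp only [zero_add, intervalIntegral.integral_same, sub_zero, smul_eq_mul] at hd
  refine hd.congr' ?_
  filter_upwards [self_mem_nhdsWithin] with h hh
  rw [(integral_backward_pairing_eq hFm hΦm hF hΦ (le_of_lt hh)).2]

end TimeShift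

section SquareIntegrals

variable {X : Type*} [MeasurableSpace X] {μ : Measure X} {E : Type*} [NormedAddCommGroup E]

theorem eLpNorm_two_sq (f : X → E) : eLpNorm f 2 μ ^ 2 = ∫⁻ x, ‖f x‖ₑ ^ 2 ∂μ := by
  have := eLpNorm_nnreal_pow_eq_lintegral (f := f) (μ := μ) (p := 2) (by norm_num)
  simpa using this

theorem lintegral_sq_le_of_isProbabilityMeasure [IsProbabilityMeasure μ] {g : X → ℝ≥0∞}
    (hg : AEMeasurable g μ) : (∫⁻ x, g x ∂μ) ^ 2 ≤ ∫⁻ x, g x ^ 2 ∂μ := by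
  have h := ENNReal.lintegral_mul_le_Lp_mul_Lq μ Real.HolderConjugate.two_two hg
    (aemeasurable_const (b := (1 : ℝ≥0∞)))
  simp only [Pi.mul_apply, mul_one, ENNReal.one_rpow, lintegral_const, measure_univ] at h
  calc (∫⁻ x, g x ∂μ) ^ 2 ≤ ((∫⁻ x, g x ^ (2 : ℝ) ∂μ) ^ (1 / 2 : ℝ)) ^ 2 := by gcongr
    _ = ∫⁻ x, g x ^ 2 ∂μ := by
      rw [← ENNReal.rpow_natCast, ← ENNReal.rpow_mul]
      norm_num

end SquareIntegrals

section Fractional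

/-- The difference quotient whose `L²` norm is the Gagliardo seminorm of order `s`. -/
def fracDiff (s : ℝ) (f : Ed d → ℝ) (p : Ed d × Ed d) : ℝ :=
  (f p.1 - f p.2) * ‖p.1 - p.2‖ ^ (-((d : ℝ) / 2 + s))

theorem fracDiff_sub (s : ℝ) (f g : Ed d → ℝ) :
    fracDiff s (f - g) = fracDiff s f - fracDiff s g := by
  ext p; simp only [fracDiff, Pi.sub_apply]; ring

theorem measurable_fracDiff (s : ℝ) {f : Ed d → ℝ} (hf : Measurable f) :
    Measurable (fracDiff s f) := by
  unfold fracDiff; fun_prop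

theorem sq_norm_rpow_eq (s : ℝ) (z : Ed d) :
    (‖z‖ ^ (-((d : ℝ) / 2 + s))) ^ 2 = (‖z‖ ^ ((d : ℝ) + 2 * s))⁻¹ := by
  rw [← Real.rpow_natCast, ← Real.rpow_mul (norm_nonneg z), ← Real.rpow_neg (norm_nonneg z)]
  congr 1; push_cast; ring

/-- The constant in the comparison of the Gagliardo seminorm with the Sobolev norm. -/
def fracConst (d : ℕ) (s : ℝ) : ℝ :=
  ∫ z : Ed d, min (‖z‖ ^ 2) 1 * (‖z‖ ^ ((d : ℝ) + 2 * s))⁻¹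

theorem integrable_fracKernel (hd : 2 ≤ d) {s : ℝ} (hs : s ∈ Ioo (0 : ℝ) 1) :
    Integrable fun z : Ed d => min (‖z‖ ^ 2) 1 * (‖z‖ ^ ((d : ℝ) + 2 * s))⁻¹ := by
  have : Nonempty (Fin d) := ⟨⟨0, by omega⟩⟩
  have : Nontrivial (Ed d) := inferInstance
  rw [integrable_fun_norm_addHaar volume
    (f := fun y : ℝ => min (y ^ 2) 1 * (y ^ ((d : ℝ) + 2 * s))⁻¹)]
  have hdim : Module.finrank ℝ (Ed d) = d := by simp
  rw [hdim]
  have hd1 : ((d - 1 : ℕ) : ℝ) = (d : ℝ) - 1 := by push_cast [Nat.cast_sub (by omega : 1 ≤ d)]; ring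
  rw [← Ioc_union_Ioi_eq_Ioi (zero_le_one' ℝ)]
  refine IntegrableOn.union ?_ ?_
  · have h : IntegrableOn (fun y : ℝ => y ^ (1 - 2 * s)) (Ioc 0 1) := by
      rw [← intervalIntegrable_iff_integrableOn_Ioc_of_le zero_le_one]
      exact intervalIntegral.intervalIntegrable_rpow' (by linarith [hs.2])
    refine h.congr_fun (fun y hy => ?_) measurableSet_Ioc
    have hy0 : 0 < y := hy.1
    simp only [smul_eq_mul]
    rw [min_eq_left (by have := hy.2; nlinarith), ← Real.rpow_neg hy0.le, ← Real.rpow_natCast,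
      ← Real.rpow_natCast, ← Real.rpow_add hy0, ← Real.rpow_add hy0, hd1]
    congr 1; push_cast; ring
  · have h : IntegrableOn (fun y : ℝ => y ^ (-1 - 2 * s)) (Ioi 1) :=
      integrableOn_Ioi_rpow_of_lt (by linarith [hs.1]) zero_lt_one
    refine h.congr_fun (fun y hy => ?_) measurableSet_Ioi
    have hy1 : (1 : ℝ) < y := hy
    have hy0 : 0 < y := by linarith
    simp only [smul_eq_mul]
    rw [min_eq_right (by nlinarith), one_mul, ← Real.rpow_neg hy0.le, ← Real.rpow_natCast,
      ← Real.rpow_add hy0, hd1]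
    congr 1; ring

theorem fracConst_nonneg (d : ℕ) (s : ℝ) : 0 ≤ fracConst d s :=
  integral_nonneg fun z => by positivity

variable {φ : Ed d → ℝ}

theorem norm_gradient_eq (φ : Ed d → ℝ) (x : Ed d) : ‖gradient φ x‖ = ‖fderiv ℝ φ x‖ := by
  simp [gradient]

theorem inner_gradient_eq (φ : Ed d → ℝ) (x e : Ed d) : ⟪gradient φ x, e⟫ = fderiv ℝ φ x e := by
  simp [gradient]

theorem continuous_gradient (hφ : ContDiff ℝ 1 φ) : Continuous (gradient φ) := by
  unfold gradient
  exact (LinearIsometryEquiv.continuous _).comp (hφ.continuous_fderiv one_ne_zero)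

theorem eLpNorm_translate_sub_le_gradient (hφ : ContDiff ℝ 1 φ) (z : Ed d) :
    eLpNorm (fun x => φ (x + z) - φ x) 2 volume ≤ ‖z‖ₑ * eLpNorm (gradient φ) 2 volume := by
  have hc := continuous_gradient hφ
  have hm : Measurable fun p : Ed d × ℝ => ‖gradient φ (p.1 + p.2 • z)‖ₑ := by
    have : Continuous fun p : Ed d × ℝ => gradient φ (p.1 + p.2 • z) := by fun_prop
    exact this.measurable.enorm
  have hpt : ∀ x, ‖φ (x + z) - φ x‖ₑ ≤ ∫⁻ θ in Ioc (0 : ℝ) 1, ‖gradient φ (x + θ • z)‖ₑ * ‖z‖ₑ := by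
    intro x
    have hder : ∀ θ ∈ uIcc (0 : ℝ) 1, HasDerivAt (fun θ : ℝ => φ (x + θ • z))
        (⟪gradient φ (x + θ • z), z⟫) θ := by
      intro θ _
      rw [inner_gradient_eq]
      have h1 := (hφ.differentiable one_ne_zero (x + θ • z)).hasFDerivAt
      have h2 : HasDerivAt (fun θ : ℝ => x + θ • z) z θ := by
        simpa using ((hasDerivAt_id θ).smul_const z).const_add x
      exact h1.comp_hasDerivAt θ h2
    have hcont : Continuous fun θ : ℝ => ⟪gradient φ (x + θ • z), z⟫ := by fun_prop
    have := intervalIntegral.integral_eq_sub_of_hasDerivAt hder (hcont.intervalIntegrable 0 1)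
    simp only [one_smul, zero_smul, add_zero] at this
    rw [← this, intervalIntegral.integral_of_le zero_le_one]
    refine (enorm_integral_le_lintegral_enorm _).trans (lintegral_mono fun θ => ?_)
    rw [← ofReal_norm, ← ofReal_norm, ← ofReal_norm, ← ENNReal.ofReal_mul (norm_nonneg _)]
    exact ENNReal.ofReal_le_ofReal (abs_real_inner_le_norm _ _)
  have hsq : eLpNorm (fun x => φ (x + z) - φ x) 2 volume ^ 2 ≤
      (‖z‖ₑ * eLpNorm (gradient φ) 2 volume) ^ 2 := by
    rw [eLpNorm_two_sq, mul_pow, eLpNorm_two_sq]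
    have : IsProbabilityMeasure (volume.restrict (Ioc (0 : ℝ) 1)) := ⟨by simp⟩
    calc ∫⁻ x, ‖φ (x + z) - φ x‖ₑ ^ 2
        ≤ ∫⁻ x, ∫⁻ θ in Ioc (0 : ℝ) 1, (‖gradient φ (x + θ • z)‖ₑ * ‖z‖ₑ) ^ 2 := by
          refine lintegral_mono fun x => ?_
          refine (pow_le_pow_left' (hpt x) 2).trans
            (lintegral_sq_le_of_isProbabilityMeasure ?_)
          exact ((hm.comp measurable_prodMk_left).mul_const _).aemeasurable
      _ = ∫⁻ θ in Ioc (0 : ℝ) 1, ∫⁻ x, (‖gradient φ (x + θ • z)‖ₑ * ‖z‖ₑ) ^ 2 :=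
          lintegral_lintegral_swap ((hm.mul_const _).pow_const 2).aemeasurable
      _ = ∫⁻ θ in Ioc (0 : ℝ) 1, ‖z‖ₑ ^ 2 * ∫⁻ x, ‖gradient φ x‖ₑ ^ 2 := by
          refine lintegral_congr fun θ => ?_
          simp only [mul_pow]
          have hmθ : Measurable fun x => ‖gradient φ (x + θ • z)‖ₑ ^ 2 :=
            (hm.comp measurable_prodMk_right).pow_const 2
          rw [lintegral_mul_const _ hmθ, mul_comm,
            lintegral_add_right_eq_self (fun x => ‖gradient φ x‖ₑ ^ 2)]
      _ = ‖z‖ₑ ^ 2 * ∫⁻ x, ‖gradient φ x‖ₑ ^ 2 := by simp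
  exact (ENNReal.pow_le_pow_left_iff two_ne_zero).1 hsq

theorem eLpNorm_translate_sub_le (hφ : ContDiff ℝ 1 φ) (z : Ed d) :
    eLpNorm (fun x => φ (x + z) - φ x) 2 volume ≤
      ENNReal.ofReal (min ‖z‖ 1) *
        (2 * eLpNorm φ 2 volume + eLpNorm (gradient φ) 2 volume) := by
  rcases le_total ‖z‖ 1 with h | h
  · rw [min_eq_left h]
    refine (eLpNorm_translate_sub_le_gradient hφ z).trans ?_
    rw [ofReal_norm]
    gcongr
    exact le_add_self
  · rw [min_eq_right h, ENNReal.ofReal_one, one_mul]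
    refine le_trans ?_ le_self_add
    have hc := hφ.continuous
    refine (eLpNorm_sub_le (f := fun x => φ (x + z)) (g := φ) (by fun_prop) (by fun_prop)
      (by norm_num)).trans ?_
    have := eLpNorm_comp_measurePreserving (p := 2) (hc.aestronglyMeasurable (μ := volume))
      (measurePreserving_add_right (volume : Measure (Ed d)) z)
    have h2 : eLpNorm (fun x => φ (x + z)) 2 volume = eLpNorm φ 2 volume := this
    rw [h2, two_mul]

/-- The Gagliardo seminorm of a `C¹` function is controlled by its Sobolev norm. -/
theorem eLpNorm_fracDiff_le (hd : 2 ≤ d) {s : ℝ} (hs : s ∈ Ioo (0 : ℝ) 1) (hφ : ContDiff ℝ 1 φ) :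
    eLpNorm (fracDiff s φ) 2 volume ≤ ENNReal.ofReal (√(fracConst d s)) *
      (2 * eLpNorm φ 2 volume + eLpNorm (gradient φ) 2 volume) := by
  have hc := hφ.continuous.measurable
  set N := 2 * eLpNorm φ 2 volume + eLpNorm (gradient φ) 2 volume
  have hm : Measurable fun p : Ed d × Ed d => ‖fracDiff s φ p‖ₑ ^ 2 :=
    (measurable_fracDiff s hc).enorm.pow_const 2
  have hm2 : Measurable fun p : Ed d × Ed d => ‖fracDiff s φ (p.1 + p.2, p.1)‖ₑ ^ 2 :=
    hm.comp (by fun_prop)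
  have hsq : eLpNorm (fracDiff s φ) 2 volume ^ 2 ≤ (ENNReal.ofReal (√(fracConst d s)) * N) ^ 2 := by
    rw [eLpNorm_two_sq, mul_pow, ← ENNReal.ofReal_pow (Real.sqrt_nonneg _),
      Real.sq_sqrt (fracConst_nonneg d s), fracConst,
      ofReal_integral_eq_lintegral_ofReal (integrable_fracKernel hd hs)
        (Eventually.of_forall fun z => by positivity)]
    calc ∫⁻ p, ‖fracDiff s φ p‖ₑ ^ 2
        = ∫⁻ y, ∫⁻ x, ‖fracDiff s φ (x, y)‖ₑ ^ 2 := lintegral_prod_symm _ hm.aemeasurable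
      _ = ∫⁻ y, ∫⁻ z, ‖fracDiff s φ (y + z, y)‖ₑ ^ 2 := by
          refine lintegral_congr fun y => ?_
          exact (lintegral_add_left_eq_self (fun x => ‖fracDiff s φ (x, y)‖ₑ ^ 2) y).symm
      _ = ∫⁻ z, ∫⁻ y, ‖fracDiff s φ (y + z, y)‖ₑ ^ 2 := lintegral_lintegral_swap hm2.aemeasurable
      _ ≤ ∫⁻ z, ENNReal.ofReal (min (‖z‖ ^ 2) 1 * (‖z‖ ^ ((d : ℝ) + 2 * s))⁻¹) * N ^ 2 := by
          refine lintegral_mono fun z => ?_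
          have e1 : ∀ y, ‖fracDiff s φ (y + z, y)‖ₑ ^ 2 =
              ‖φ (y + z) - φ y‖ₑ ^ 2 * ENNReal.ofReal ((‖z‖ ^ ((d : ℝ) + 2 * s))⁻¹) := by
            intro y
            rw [fracDiff, enorm_mul, mul_pow, ← sq_norm_rpow_eq s z,
              ENNReal.ofReal_pow (by positivity), Real.enorm_of_nonneg (r := ‖_‖ ^ _) (by positivity)]
            simp
          simp only [e1]
          have hcz : Measurable fun y => ‖φ (y + z) - φ y‖ₑ ^ 2 := by fun_prop
          rw [lintegral_mul_const _ hcz, ← eLpNorm_two_sq (fun y => φ (y + z) - φ y)]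
          have hmin : min (‖z‖ ^ 2) 1 = (min ‖z‖ 1) ^ 2 := by
            rcases le_total ‖z‖ 1 with h | h
            · rw [min_eq_left h, min_eq_left (by nlinarith [norm_nonneg z])]
            · rw [min_eq_right h, min_eq_right (by nlinarith)]; norm_num
          rw [hmin, ENNReal.ofReal_mul (by positivity), ENNReal.ofReal_pow (by positivity)]
          calc _ ≤ (ENNReal.ofReal (min ‖z‖ 1) * N) ^ 2 *
                ENNReal.ofReal ((‖z‖ ^ ((d : ℝ) + 2 * s))⁻¹) := by
                gcongr; exact eLpNorm_translate_sub_le hφ z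
            _ = _ := by ring
      _ = _ := lintegral_mul_const _ (by fun_prop)
  exact (ENNReal.pow_le_pow_left_iff two_ne_zero).1 hsq

end Fractional

section Dominated

variable {X : Type*} [MeasurableSpace X] {μ : Measure X} {E : Type*} [NormedAddCommGroup E]

theorem tendsto_eLpNorm_two_zero_of_dominated {u : ℕ → X → E} {b : X → ℝ}
    (hu : ∀ n, AEStronglyMeasurable (u n) μ) (hb : MemLp b 2 μ)
    (hle : ∀ n, ∀ᵐ x ∂μ, ‖u n x‖ ≤ b x)
    (hlim : ∀ᵐ x ∂μ, Tendsto (fun n => u n x) atTop (𝓝 0)) :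
    Tendsto (fun n => eLpNorm (u n) 2 μ) atTop (𝓝 0) := by
  have h2 : Tendsto (fun n => eLpNorm (u n) 2 μ ^ 2) atTop (𝓝 0) := by
    simp only [eLpNorm_two_sq]
    have := tendsto_lintegral_of_dominated_convergence' (μ := μ) (f := fun _ : X => (0 : ℝ≥0∞))
      (F := fun n x => ‖u n x‖ₑ ^ 2) (fun x => ‖b x‖ₑ ^ 2) (fun n => (hu n).enorm.pow_const 2)
      (fun n => by
        filter_upwards [hle n] with x hx
        gcongr
        rw [← ofReal_norm, ← ofReal_norm]
        exact ENNReal.ofReal_le_ofReal (hx.trans (le_abs_self _)))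
      (by rw [← eLpNorm_two_sq]; exact ENNReal.pow_ne_top hb.2.ne)
      (by
        filter_upwards [hlim] with x hx
        have : Tendsto (fun n => ‖u n x‖ₑ ^ 2) atTop (𝓝 (‖(0 : E)‖ₑ ^ 2)) :=
          (ENNReal.continuous_pow 2).continuousAt.tendsto.comp
            ((continuous_enorm.tendsto _).comp hx)
        simpa using this)
    simpa using this
  have h3 := (ENNReal.continuous_rpow_const (y := (1 / 2 : ℝ))).tendsto 0 |>.comp h2
  simp only [one_div, inv_pos, Nat.ofNat_pos, ENNReal.zero_rpow_of_pos] at h3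
  refine h3.congr fun n => ?_
  simp only [Function.comp]
  rw [← ENNReal.rpow_natCast, ← ENNReal.rpow_mul]
  norm_num

end Dominated

/-- Simultaneous `L²` approximation of a function and a vector field by functions of a class
and their gradients. -/
def SobApprox (𝒯 : Set (Ed d → ℝ)) (f : Ed d → ℝ) (G : Ed d → Ed d) : Prop :=
  ∃ φ : ℕ → Ed d → ℝ, (∀ n, φ n ∈ 𝒯) ∧
    Tendsto (fun n => eLpNorm (φ n - f) 2 volume) atTop (𝓝 0) ∧
    Tendsto (fun n => eLpNorm (gradient (φ n) - G) 2 volume) atTop (𝓝 0)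

theorem SobApprox.mono {𝒯 𝒯' : Set (Ed d → ℝ)} {f : Ed d → ℝ} {G : Ed d → Ed d}
    (h : SobApprox 𝒯 f G) (h𝒯 : 𝒯 ⊆ 𝒯') : SobApprox 𝒯' f G := by
  obtain ⟨φ, h1, h2⟩ := h
  exact ⟨φ, fun n => h𝒯 (h1 n), h2⟩

theorem exists_seq_tendsto_zero {a b : ℕ → ℝ≥0∞} (ha : Tendsto a atTop (𝓝 0))
    (hb : Tendsto b atTop (𝓝 0)) (n : ℕ) :
    ∃ k, a k ≤ ((n : ℝ≥0∞) + 1)⁻¹ ∧ b k ≤ ((n : ℝ≥0∞) + 1)⁻¹ := by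
  have hpos : (0 : ℝ≥0∞) < ((n : ℝ≥0∞) + 1)⁻¹ := by simp
  exact ((ha.eventually_le_const hpos).and (hb.eventually_le_const hpos)).exists

theorem tendsto_inv_natCast_add_one :
    Tendsto (fun n : ℕ => ((n : ℝ≥0∞) + 1)⁻¹) atTop (𝓝 0) := by
  have := (ENNReal.tendsto_inv_nat_nhds_zero).comp (tendsto_add_atTop_nat 1)
  refine this.congr fun n => ?_
  simp

/-- The approximable pairs are closed in `L²`. -/
theorem SobApprox.of_tendsto {𝒯 : Set (Ed d → ℝ)} (h𝒯 : ∀ φ ∈ 𝒯, ContDiff ℝ 1 φ)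
    {f : Ed d → ℝ} {G : Ed d → Ed d}
    {fn : ℕ → Ed d → ℝ} {Gn : ℕ → Ed d → Ed d} (h : ∀ n, SobApprox 𝒯 (fn n) (Gn n))
    (hfn : ∀ n, AEStronglyMeasurable (fn n) volume) (hGn : ∀ n, AEStronglyMeasurable (Gn n) volume)
    (hfm : AEStronglyMeasurable f volume) (hGm : AEStronglyMeasurable G volume)
    (hf : Tendsto (fun n => eLpNorm (fn n - f) 2 volume) atTop (𝓝 0))
    (hG : Tendsto (fun n => eLpNorm (Gn n - G) 2 volume) atTop (𝓝 0)) : SobApprox 𝒯 f G := by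
  choose φ hφ h1 h2 using h
  choose k hk1 hk2 using fun n => exists_seq_tendsto_zero (h1 n) (h2 n) n
  refine ⟨fun n => φ n (k n), fun n => hφ _ _, ?_, ?_⟩
  · have hlim := tendsto_inv_natCast_add_one.add hf
    rw [add_zero] at hlim
    refine tendsto_of_tendsto_of_tendsto_of_le_of_le tendsto_const_nhds hlim
      (fun _ => zero_le) fun n => ?_
    have : φ n (k n) - f = (φ n (k n) - fn n) + (fn n - f) := by abel
    simp only [this]
    refine (eLpNorm_add_le ?_ ((hfn n).sub hfm) one_le_two).trans (by gcongr; exact hk1 n)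
    exact (h𝒯 _ (hφ _ _)).continuous.aestronglyMeasurable.sub (hfn n)
  · have hlim := tendsto_inv_natCast_add_one.add hG
    rw [add_zero] at hlim
    refine tendsto_of_tendsto_of_tendsto_of_le_of_le tendsto_const_nhds hlim
      (fun _ => zero_le) fun n => ?_
    have : gradient (φ n (k n)) - G = (gradient (φ n (k n)) - Gn n) + (Gn n - G) := by abel
    simp only [this]
    refine (eLpNorm_add_le ?_ ((hGn n).sub hGm) one_le_two).trans (by gcongr; exact hk2 n)
    exact (continuous_gradient (h𝒯 _ (hφ _ _))).aestronglyMeasurable.sub (hGn n)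

theorem gradient_sub_of_contDiff {φ ψ : Ed d → ℝ} (hφ : ContDiff ℝ 1 φ) (hψ : ContDiff ℝ 1 ψ) :
    gradient (φ - ψ) = gradient φ - gradient ψ := by
  ext1 x
  have h := fderiv_sub (hφ.differentiable one_ne_zero x) (hψ.differentiable one_ne_zero x)
  simp only [gradient, h, map_sub, Pi.sub_apply]

theorem SobApprox.sub_contDiff {f : Ed d → ℝ} {G : Ed d → Ed d}
    (h : SobApprox {φ | ContDiff ℝ 1 φ} f G) {ψ : Ed d → ℝ} (hψ : ContDiff ℝ 1 ψ) :
    SobApprox {φ | ContDiff ℝ 1 φ} (f - ψ) (G - gradient ψ) := by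
  obtain ⟨φ, h1, h2, h3⟩ := h
  replace h1 : ∀ n, ContDiff ℝ 1 (φ n) := h1
  refine ⟨fun n => φ n - ψ, fun n => (h1 n).sub hψ, ?_, ?_⟩
  · simpa only [sub_sub_sub_cancel_right] using h2
  · simpa only [gradient_sub_of_contDiff (h1 _) hψ, sub_sub_sub_cancel_right] using h3

theorem SobApprox.eLpNorm_fracDiff_le (hd : 2 ≤ d) {s : ℝ} (hs : s ∈ Ioo (0 : ℝ) 1)
    {f : Ed d → ℝ} {G : Ed d → Ed d} (hfm : Measurable f) (hGm : Measurable G)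
    (h : SobApprox {φ | ContDiff ℝ 1 φ} f G) :
    eLpNorm (fracDiff s f) 2 volume ≤ ENNReal.ofReal (√(fracConst d s)) *
      (2 * eLpNorm f 2 volume + eLpNorm G 2 volume) := by
  obtain ⟨φ, h1, h2, h3⟩ := h
  replace h1 : ∀ n, ContDiff ℝ 1 (φ n) := h1
  have hφc : ∀ n, Continuous (φ n) := fun n => (h1 n).continuous
  have hφm : ∀ n, AEStronglyMeasurable (φ n) volume := fun n => (hφc n).aestronglyMeasurable
  obtain ⟨ns, hns, hae⟩ := (tendstoInMeasure_of_tendsto_eLpNorm two_ne_zero hφm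
    hfm.aestronglyMeasurable h2).exists_seq_tendsto_ae
  have hae2 : ∀ᵐ p : Ed d × Ed d,
      Tendsto (fun i => fracDiff s (φ (ns i)) p) atTop (𝓝 (fracDiff s f p)) := by
    have e1 : ∀ᵐ p : Ed d × Ed d, Tendsto (fun i => φ (ns i) p.1) atTop (𝓝 (f p.1)) :=
      (Measure.quasiMeasurePreserving_fst (μ := volume) (ν := volume)).ae hae
    have e2 : ∀ᵐ p : Ed d × Ed d, Tendsto (fun i => φ (ns i) p.2) atTop (𝓝 (f p.2)) :=
      (Measure.quasiMeasurePreserving_snd (μ := volume) (ν := volume)).ae hae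
    filter_upwards [e1, e2] with p hp1 hp2
    exact (hp1.sub hp2).mul_const _
  refine (Lp.eLpNorm_lim_le_liminf_eLpNorm
    (fun i => (measurable_fracDiff s (hφc (ns i)).measurable).aestronglyMeasurable) _ hae2).trans ?_
  set C := ENNReal.ofReal (√(fracConst d s))
  have hb : ∀ i, eLpNorm (fracDiff s (φ (ns i))) 2 volume ≤
      C * (2 * (eLpNorm f 2 volume + eLpNorm (φ (ns i) - f) 2 volume) +
        (eLpNorm G 2 volume + eLpNorm (gradient (φ (ns i)) - G) 2 volume)) := by
    intro i
    refine (_root_.eLpNorm_fracDiff_le hd hs (h1 _)).trans ?_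
    have i1 : eLpNorm (φ (ns i)) 2 volume ≤ eLpNorm f 2 volume + eLpNorm (φ (ns i) - f) 2 volume := by
      have := eLpNorm_add_le hfm.aestronglyMeasurable
        ((hφm (ns i)).sub hfm.aestronglyMeasurable) (p := 2) one_le_two
      simpa using this
    have i2 : eLpNorm (gradient (φ (ns i))) 2 volume ≤
        eLpNorm G 2 volume + eLpNorm (gradient (φ (ns i)) - G) 2 volume := by
      have := eLpNorm_add_le hGm.aestronglyMeasurable
        ((continuous_gradient (h1 (ns i))).aestronglyMeasurable.sub hGm.aestronglyMeasurable)
        (p := 2) (μ := volume) one_le_two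
      simpa using this
    gcongr
  have hlim : Tendsto (fun i => C * (2 * (eLpNorm f 2 volume + eLpNorm (φ (ns i) - f) 2 volume) +
        (eLpNorm G 2 volume + eLpNorm (gradient (φ (ns i)) - G) 2 volume))) atTop
      (𝓝 (C * (2 * (eLpNorm f 2 volume + 0) + (eLpNorm G 2 volume + 0)))) := by
    have t2 := h2.comp hns.tendsto_atTop
    have t3 := h3.comp hns.tendsto_atTop
    refine ENNReal.Tendsto.const_mul (Tendsto.add (ENNReal.Tendsto.const_mul
      (tendsto_const_nhds.add t2) (Or.inr (by simp))) (tendsto_const_nhds.add t3))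
      (Or.inr ENNReal.ofReal_ne_top)
  simp only [add_zero] at hlim
  rw [← hlim.liminf_eq]
  exact liminf_le_liminf (Eventually.of_forall hb)

theorem tendsto_eLpNorm_fracDiff_sub (hd : 2 ≤ d) {s : ℝ} (hs : s ∈ Ioo (0 : ℝ) 1)
    {f : Ed d → ℝ} {G : Ed d → Ed d} (hfm : Measurable f) (hGm : Measurable G)
    {φ : ℕ → Ed d → ℝ} (h1 : ∀ n, ContDiff ℝ 1 (φ n))
    (h2 : Tendsto (fun n => eLpNorm (φ n - f) 2 volume) atTop (𝓝 0))
    (h3 : Tendsto (fun n => eLpNorm (gradient (φ n) - G) 2 volume) atTop (𝓝 0)) :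
    Tendsto (fun n => eLpNorm (fracDiff s (φ n) - fracDiff s f) 2 volume) atTop (𝓝 0) := by
  have happ : SobApprox {φ | ContDiff ℝ 1 φ} f G := ⟨φ, h1, h2, h3⟩
  have hlim : Tendsto (fun n => ENNReal.ofReal (√(fracConst d s)) *
      (2 * eLpNorm (φ n - f) 2 volume + eLpNorm (gradient (φ n) - G) 2 volume)) atTop
      (𝓝 (ENNReal.ofReal (√(fracConst d s)) * (2 * 0 + 0))) :=
    ENNReal.Tendsto.const_mul (Tendsto.add (ENNReal.Tendsto.const_mul h2 (Or.inr (by simp))) h3)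
      (Or.inr ENNReal.ofReal_ne_top)
  simp only [mul_zero, add_zero] at hlim
  refine tendsto_of_tendsto_of_tendsto_of_le_of_le tendsto_const_nhds hlim
      (fun _ => zero_le) fun n => ?_
  have := (happ.sub_contDiff (h1 n)).eLpNorm_fracDiff_le hd hs
    (hfm.sub (h1 n).continuous.measurable) (hGm.sub (continuous_gradient (h1 n)).measurable)
  simpa only [fracDiff_sub, eLpNorm_sub_comm f, eLpNorm_sub_comm G,
    eLpNorm_sub_comm (fracDiff s f)] using this

section Mollification

variable {E : Type*} [NormedAddCommGroup E] [NormedSpace ℝ E] [CompleteSpace E]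
  [MeasurableSpace E] [BorelSpace E] [SecondCountableTopology E]

/-- Averaging translates against a probability measure moves a function in `L²` by at most the
modulus of continuity. -/
theorem eLpNorm_integral_translate_sub_le {ν : Measure (Ed d)} [IsProbabilityMeasure ν]
    {H : Ed d → E} (hH : Measurable H) (hint : ∀ x, Integrable (fun t => H (x - t)) ν)
    {ε : ℝ≥0∞} (hε : ∀ᵐ t ∂ν, eLpNorm (fun x => H (x - t) - H x) 2 volume ≤ ε) :
    eLpNorm (fun x => (∫ t, H (x - t) ∂ν) - H x) 2 volume ≤ ε := by
  have hm : Measurable fun p : Ed d × Ed d => ‖H (p.1 - p.2) - H p.1‖ₑ := by fun_prop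
  have hpt : ∀ x, ‖(∫ t, H (x - t) ∂ν) - H x‖ₑ ≤ ∫⁻ t, ‖H (x - t) - H x‖ₑ ∂ν := by
    intro x
    have : (∫ t, H (x - t) ∂ν) - H x = ∫ t, (H (x - t) - H x) ∂ν := by
      rw [integral_sub (hint x) (integrable_const _)]; simp
    rw [this]
    exact enorm_integral_le_lintegral_enorm _
  refine (ENNReal.pow_le_pow_left_iff two_ne_zero).1 ?_
  rw [eLpNorm_two_sq]
  calc ∫⁻ x, ‖(∫ t, H (x - t) ∂ν) - H x‖ₑ ^ 2
      ≤ ∫⁻ x, ∫⁻ t, (‖H (x - t) - H x‖ₑ ^ 2) ∂ν := by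
        refine lintegral_mono fun x => (pow_le_pow_left' (hpt x) 2).trans
          (lintegral_sq_le_of_isProbabilityMeasure ?_)
        exact (hm.comp measurable_prodMk_left).aemeasurable
    _ = ∫⁻ t, (∫⁻ x, ‖H (x - t) - H x‖ₑ ^ 2) ∂ν :=
        lintegral_lintegral_swap (hm.pow_const 2).aemeasurable
    _ ≤ ∫⁻ _, ε ^ 2 ∂ν := by
        refine lintegral_mono_ae ?_
        filter_upwards [hε] with t ht
        rw [← eLpNorm_two_sq]
        gcongr
    _ = ε ^ 2 := by simp

/-- Mollification with shrinking bumps converges in `L²`. -/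
theorem tendsto_eLpNorm_mollify_sub {H : Ed d → E} (hHm : Measurable H)
    (hH : MemLp H 2 volume) (ψ : ℕ → ContDiffBump (0 : Ed d))
    (hψ : Tendsto (fun n => (ψ n).rOut) atTop (𝓝 0)) :
    Tendsto (fun n => eLpNorm (fun x => (∫ y, (ψ n).normed volume (x - y) • H y) - H x) 2 volume)
      atTop (𝓝 0) := by
  have key := tendsto_eLpNorm_translate_sub volume hH
  rw [ENNReal.tendsto_nhds_zero] at key ⊢
  intro ε hε
  obtain ⟨δ, hδ, hδε⟩ := Metric.eventually_nhds_iff.1 (key ε hε)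
  filter_upwards [hψ.eventually_lt_const hδ] with n hn
  set ν : Measure (Ed d) := volume.withDensity fun t => ENNReal.ofReal ((ψ n).normed volume t)
  have hmeas : Measurable fun t => ((ψ n).normed volume t).toNNReal :=
    (ψ n).continuous_normed.measurable.real_toNNReal
  have hν : IsProbabilityMeasure ν := by
    refine ⟨?_⟩
    rw [withDensity_apply _ MeasurableSet.univ, Measure.restrict_univ,
      ← ofReal_integral_eq_lintegral_ofReal (ψ n).integrable_normed
        (Eventually.of_forall (ψ n).nonneg_normed), (ψ n).integral_normed, ENNReal.ofReal_one]
  have hint : ∀ x, Integrable (fun t => H (x - t)) ν := by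
    intro x
    refine (integrable_withDensity_iff_integrable_smul hmeas).2 ?_
    have hloc : LocallyIntegrable (fun t => H (x - t)) volume :=
      (hH.comp_measurePreserving
        (Measure.measurePreserving_sub_left volume x)).locallyIntegrable one_le_two
    refine (hloc.integrable_smul_left_of_hasCompactSupport ((ψ n).continuous_normed (μ := volume))
      (ψ n).hasCompactSupport_normed).congr (Eventually.of_forall fun t => ?_)
    simp [NNReal.smul_def, Real.coe_toNNReal _ ((ψ n).nonneg_normed t)]
  have heq : ∀ x, ∫ y, (ψ n).normed volume (x - y) • H y = ∫ t, H (x - t) ∂ν := by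
    intro x
    rw [← integral_sub_left_eq_self _ volume x]
    simp only [sub_sub_cancel]
    exact (integral_withDensity_eq_integral_smul hmeas (fun t => H (x - t))).symm ▸
      integral_congr_ae (Eventually.of_forall fun t => by
        simp [NNReal.smul_def, Real.coe_toNNReal _ ((ψ n).nonneg_normed t)])
  simp only [heq]
  refine eLpNorm_integral_translate_sub_le hHm hint ?_
  refine (ae_withDensity_iff hmeas.coe_nnreal_ennreal).2 (Eventually.of_forall fun t ht => ?_)
  have htn : t ∈ Function.support ((ψ n).normed volume) := fun h0 => ht (by simp [h0])
  rw [(ψ n).support_normed_eq, mem_ball, dist_zero_right] at htn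
  have := hδε (y := -t) (by simpa using htn.trans hn)
  simpa [sub_eq_add_neg] using this

end Mollification

theorem MeasureTheory.MemLp.of_le_mul_of_restrict {X : Type*} [MeasurableSpace X] {μ : Measure X}
    {E F : Type*} [NormedAddCommGroup E] [NormedAddCommGroup F] {g : X → E} {h : X → F} {S : Set X}
    (hS : MeasurableSet S) {p : ℝ≥0∞}
    (hg : MemLp g p (μ.restrict S)) (hh : AEStronglyMeasurable h μ) {M : ℝ}
    (hle : ∀ x ∈ S, ‖h x‖ ≤ M * ‖g x‖) (h0 : ∀ x ∉ S, h x = 0) : MemLp h p μ := by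
  have hi : MemLp (S.indicator g) p μ := (memLp_indicator_iff_restrict hS).2 hg
  refine hi.of_le_mul hh (c := M) (Eventually.of_forall fun x => ?_)
  by_cases hx : x ∈ S
  · simpa [hx] using hle x hx
  · simp [hx, h0 x hx]

theorem gradient_eq_zero_of_notMem_tsupport {χ : Ed d → ℝ} {x : Ed d} (hx : x ∉ tsupport χ) :
    gradient χ x = 0 := by
  have : fderiv ℝ χ x = 0 := by
    by_contra h
    exact hx (support_fderiv_subset ℝ h)
  simp [gradient, this]

theorem exists_bound_gradient {χ : Ed d → ℝ} (hχ : ContDiff ℝ 1 χ) (hχc : HasCompactSupport χ) :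
    ∃ M : ℝ, ∀ x, ‖gradient χ x‖ ≤ M := by
  obtain ⟨M, hM⟩ := (hχc.fderiv ℝ).exists_bound_of_continuous (hχ.continuous_fderiv one_ne_zero)
  exact ⟨M, fun x => (norm_gradient_eq χ x).le.trans (hM x)⟩

section Localization

variable {f χ : Ed d → ℝ} {G : Ed d → Ed d}

theorem memLp_cutoff_mul (hf : Measurable f) (hχ : ContDiff ℝ 1 χ) (hχc : HasCompactSupport χ)
    (hf2 : MemLp f 2 (volume.restrict (tsupport χ))) : MemLp (fun x => χ x * f x) 2 volume := by
  obtain ⟨M, hM⟩ := hχc.exists_bound_of_continuous hχ.continuous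
  refine hf2.of_le_mul_of_restrict (isClosed_tsupport χ).measurableSet
    (hχ.continuous.measurable.mul hf).aestronglyMeasurable (M := M) (fun x _ => ?_) fun x hx => ?_
  · rw [norm_mul]; gcongr; exact hM x
  · rw [image_eq_zero_of_notMem_tsupport hx, zero_mul]

theorem memLp_gradient_cutoff_mul (hf : Measurable f) (hG : Measurable G)
    (hχ : ContDiff ℝ 1 χ) (hχc : HasCompactSupport χ)
    (hf2 : MemLp f 2 (volume.restrict (tsupport χ)))
    (hG2 : MemLp G 2 (volume.restrict (tsupport χ))) :
    MemLp (fun x => χ x • G x + f x • gradient χ x) 2 volume := by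
  obtain ⟨M, hM⟩ := hχc.exists_bound_of_continuous hχ.continuous
  obtain ⟨N, hN⟩ := exists_bound_gradient hχ hχc
  have hgχ := (continuous_gradient hχ).measurable
  refine (hG2.of_le_mul_of_restrict (isClosed_tsupport χ).measurableSet
    (hχ.continuous.measurable.smul hG).aestronglyMeasurable (M := M) (fun x _ => ?_)
    fun x hx => ?_).add (hf2.of_le_mul_of_restrict (isClosed_tsupport χ).measurableSet
    (hf.smul hgχ).aestronglyMeasurable (M := N) (fun x _ => ?_) fun x hx => ?_)
  · rw [Pi.smul_apply', norm_smul]; gcongr; exact hM x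
  · rw [Pi.smul_apply', image_eq_zero_of_notMem_tsupport hx, zero_smul]
  · rw [norm_smul, mul_comm]; gcongr; exact hN x
  · rw [gradient_eq_zero_of_notMem_tsupport hx, smul_zero]

/-- `G` is the weak gradient of `f` in `Ω`. -/
def IsWeakGradient (Ω : Set (Ed d)) (f : Ed d → ℝ) (G : Ed d → Ed d) : Prop :=
  ∀ φ : Ed d → ℝ, ContDiff ℝ (⊤ : ℕ∞) φ → HasCompactSupport φ → tsupport φ ⊆ Ω → ∀ e : Ed d,
    ∫ x, f x * (fderiv ℝ φ x) e = - ∫ x, φ x * ⟪G x, e⟫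

/-- A localized Sobolev function is approximated by smooth functions. -/
theorem IsWeakGradient.sobApprox_mul {Ω : Set (Ed d)}
    (h : IsWeakGradient Ω f G) (hf : Measurable f) (hG : Measurable G)
    (hχ : ContDiff ℝ (⊤ : ℕ∞) χ) (hχc : HasCompactSupport χ) (hχΩ : tsupport χ ⊆ Ω)
    (hf2 : MemLp f 2 (volume.restrict (tsupport χ)))
    (hG2 : MemLp G 2 (volume.restrict (tsupport χ))) :
    SobApprox {φ | ContDiff ℝ (⊤ : ℕ∞) φ} (fun x => χ x * f x)
      (fun x => χ x • G x + f x • gradient χ x) := by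
  have hχ1 : ContDiff ℝ 1 χ := hχ.of_le (by exact_mod_cast le_top)
  have hgχ := continuous_gradient hχ1
  have hF := memLp_cutoff_mul hf hχ1 hχc hf2
  have hH := memLp_gradient_cutoff_mul hf hG hχ1 hχc hf2 hG2
  set F := fun x => χ x * f x
  set H := fun x => χ x • G x + f x • gradient χ x
  have hFm : Measurable F := hχ.continuous.measurable.mul hf
  have hHm : Measurable H :=
    (hχ.continuous.measurable.smul hG).add (hf.smul hgχ.measurable)
  let ψ : ℕ → ContDiffBump (0 : Ed d) := fun n =>
    ⟨1 / ((n : ℝ) + 1) / 2, 1 / ((n : ℝ) + 1), by positivity, half_lt_self (by positivity)⟩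
  have hψ : Tendsto (fun n => (ψ n).rOut) atTop (𝓝 0) := tendsto_one_div_add_atTop_nhds_zero_nat
  have hFl := hF.locallyIntegrable one_le_two
  have hHl := hH.locallyIntegrable one_le_two
  refine ⟨fun n x => ∫ y, (ψ n).normed volume (x - y) • F y, fun n => ?_,
    tendsto_eLpNorm_mollify_sub hFm hF ψ hψ, ?_⟩
  all_goals
    have hconv : ∀ n : ℕ, (fun x : Ed d => ∫ y : Ed d, (ψ n).normed volume (x - y) • F y) =
        convolution F ((ψ n).normed volume) (ContinuousLinearMap.mul ℝ ℝ) volume := by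
      intro n; ext x
      simp only [convolution_def, ContinuousLinearMap.mul_apply', smul_eq_mul]
      exact integral_congr_ae (Eventually.of_forall fun y => mul_comm _ _)
  · change ContDiff ℝ (⊤ : ℕ∞) fun x => ∫ y, (ψ n).normed volume (x - y) • F y
    rw [hconv]
    exact (ψ n).hasCompactSupport_normed.contDiff_convolution_right _ hFl (ψ n).contDiff_normed
  · refine (tendsto_eLpNorm_mollify_sub hHm hH ψ hψ).congr fun n => ?_
    congr 1
    ext1 x
    rw [Pi.sub_apply]
    congr 1
    simp only [hconv]
    set k := (ψ n).normed volume with hk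
    have hks : ContDiff ℝ (⊤ : ℕ∞) k := (ψ n).contDiff_normed
    have hkc : HasCompactSupport k := (ψ n).hasCompactSupport_normed
    have hk1 : ContDiff ℝ 1 k := hks.of_le (by exact_mod_cast le_top)
    have hdk : Continuous (fderiv ℝ k) := hk1.continuous_fderiv one_ne_zero
    have hder := (hkc.hasFDerivAt_convolution_right (ContinuousLinearMap.mul ℝ ℝ) hFl hk1 x).fderiv
    have hkx : Continuous fun y => k (x - y) := hk1.continuous.comp (continuous_const.sub continuous_id)
    have hkxc : HasCompactSupport fun y => k (x - y) :=
      hkc.comp_homeomorph (Homeomorph.subLeft x)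
    have hHi : Integrable (fun y => k (x - y) • H y) :=
      hHl.integrable_smul_left_of_hasCompactSupport hkx hkxc
    have hk' : ∀ y e, fderiv ℝ (fun y => χ y * k (x - y)) y e =
        χ y * -(fderiv ℝ k (x - y) e) + k (x - y) * fderiv ℝ χ y e := by
      intro y e
      have h1 := (hχ1.differentiable one_ne_zero y).hasFDerivAt
      have h2 : HasFDerivAt (fun y => k (x - y)) (-(fderiv ℝ k (x - y))) y := by
        have h3 := (hk1.differentiable one_ne_zero (x - y)).hasFDerivAt.comp y
          (f := fun y => x - y) ((hasFDerivAt_id y).const_sub x)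
        exact h3.congr_fderiv (by ext; simp)
      have h3 : fderiv ℝ (fun y => χ y * k (x - y)) y = _ := (h1.mul h2).fderiv
      rw [h3]
      simp
    refine ext_inner_right ℝ fun e => ?_
    have htest := h (fun y => χ y * k (x - y)) (hχ.mul (hks.comp (contDiff_const.sub contDiff_id)))
      hχc.mul_right ((closure_mono (Function.support_mul_subset_left _ _)).trans hχΩ) e
    simp only [hk'] at htest
    have hA : Integrable fun y => F y * fderiv ℝ k (x - y) e := by
      have hc : Continuous fun y => fderiv ℝ k (x - y) e := by fun_prop
      refine hFl.integrable_smul_right_of_hasCompactSupport hc ?_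
      exact ((hkc.fderiv_apply ℝ e).comp_homeomorph (Homeomorph.subLeft x))
    have hC : Integrable fun y => f y * (k (x - y) * fderiv ℝ χ y e) := by
      obtain ⟨N, hN⟩ := exists_bound_gradient hχ1 hχc
      have hm : Measurable fun y => f y * fderiv ℝ χ y e :=
        hf.mul ((hχ1.continuous_fderiv one_ne_zero).clm_apply continuous_const).measurable
      have h2 : MemLp (fun y => f y * fderiv ℝ χ y e) 2 volume := by
        refine hf2.of_le_mul_of_restrict (isClosed_tsupport χ).measurableSet
          hm.aestronglyMeasurable (M := N * ‖e‖) (fun y _ => ?_) fun y hy => ?_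
        · rw [norm_mul, mul_comm]
          gcongr
          exact ((fderiv ℝ χ y).le_opNorm e).trans (by rw [← norm_gradient_eq]; gcongr; exact hN y)
        · rw [← inner_gradient_eq, gradient_eq_zero_of_notMem_tsupport hy, inner_zero_left, mul_zero]
      refine ((h2.locallyIntegrable one_le_two).integrable_smul_left_of_hasCompactSupport
        hkx hkxc).congr (Eventually.of_forall fun y => ?_)
      simp only [smul_eq_mul]; ring
    rw [inner_gradient_eq, hder, convolution_precompR_apply _ hFl (hkc.fderiv ℝ) hdk,
      real_inner_comm, ← integral_inner hHi, convolution_def]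
    have hB : ∫ y, f y * (χ y * -(fderiv ℝ k (x - y) e) + k (x - y) * fderiv ℝ χ y e) =
        (∫ y, f y * (k (x - y) * fderiv ℝ χ y e)) - ∫ y, F y * fderiv ℝ k (x - y) e := by
      rw [← integral_sub hC hA]
      refine integral_congr_ae (Eventually.of_forall fun y => ?_)
      simp only [F]; ring
    have hD : ∫ y, ⟪e, k (x - y) • H y⟫ =
        (∫ y, f y * (k (x - y) * fderiv ℝ χ y e)) + ∫ y, χ y * k (x - y) * ⟪G y, e⟫ := by
      have hE : ∀ y, χ y * k (x - y) * ⟪G y, e⟫ =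
          ⟪e, k (x - y) • H y⟫ - f y * (k (x - y) * fderiv ℝ χ y e) := by
        intro y
        simp only [H, ← inner_gradient_eq, inner_smul_right, inner_add_right,
          real_inner_comm e]
        ring
      simp only [hE]
      rw [integral_sub (hHi.const_inner e) hC]
      ring
    rw [hD]
    simp only [ContinuousLinearMap.mul_apply']
    linarith

end Localization

/-- A smooth approximation of the positive part. -/
def softPos (n : ℕ) (u : ℝ) : ℝ := ∫ σ in (0 : ℝ)..u, Real.smoothTransition ((n + 1) * σ)

theorem continuous_softPos_integrand (n : ℕ) :
    Continuous fun σ : ℝ => Real.smoothTransition ((n + 1) * σ) :=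
  Real.smoothTransition.continuous.comp (by fun_prop)

theorem hasDerivAt_softPos (n : ℕ) (u : ℝ) :
    HasDerivAt (softPos n) (Real.smoothTransition ((n + 1) * u)) u :=
  ((continuous_softPos_integrand n).integral_hasStrictDerivAt 0 u).hasDerivAt

theorem contDiff_softPos (n : ℕ) : ContDiff ℝ (⊤ : ℕ∞) (softPos n) := by
  refine contDiff_infty_iff_deriv.2 ⟨fun u => (hasDerivAt_softPos n u).differentiableAt, ?_⟩
  have : deriv (softPos n) = fun u : ℝ => Real.smoothTransition ((n + 1) * u) :=
    funext fun u => (hasDerivAt_softPos n u).deriv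
  rw [this]
  exact Real.smoothTransition.contDiff.comp (by fun_prop)

theorem softPos_of_nonpos (n : ℕ) {u : ℝ} (hu : u ≤ 0) : softPos n u = 0 := by
  rw [softPos, intervalIntegral.integral_symm, neg_eq_zero]
  refine intervalIntegral.integral_zero_ae (Eventually.of_forall fun σ hσ => ?_)
  rw [uIoc_of_le hu] at hσ
  exact Real.smoothTransition.zero_of_nonpos (mul_nonpos_of_nonneg_of_nonpos (by positivity) hσ.2)

theorem softPos_nonneg (n : ℕ) (u : ℝ) : 0 ≤ softPos n u := by
  rcases le_total u 0 with hu | hu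
  · rw [softPos_of_nonpos n hu]
  · exact intervalIntegral.integral_nonneg hu fun σ _ => Real.smoothTransition.nonneg _

theorem softPos_le (n : ℕ) (u : ℝ) : softPos n u ≤ max u 0 := by
  rcases le_total u 0 with hu | hu
  · rw [softPos_of_nonpos n hu]; exact le_max_right _ _
  · calc softPos n u ≤ ∫ _ in (0 : ℝ)..u, (1 : ℝ) :=
          intervalIntegral.integral_mono_on hu
            ((continuous_softPos_integrand n).intervalIntegrable _ _)
            (continuous_const.intervalIntegrable _ _) fun σ _ => Real.smoothTransition.le_one _
      _ = u := by simp
      _ ≤ max u 0 := le_max_left _ _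

theorem abs_softPos_sub_le (n : ℕ) (a b : ℝ) : |softPos n a - softPos n b| ≤ |a - b| := by
  have := Convex.norm_image_sub_le_of_norm_hasDerivWithin_le (f := softPos n) (s := univ) (C := 1)
    (fun x _ => (hasDerivAt_softPos n x).hasDerivWithinAt)
    (fun x _ => by
      rw [Real.norm_of_nonneg (Real.smoothTransition.nonneg _)]
      exact Real.smoothTransition.le_one _) convex_univ (mem_univ b) (mem_univ a)
  simpa using this

theorem tendsto_smoothTransition_mul (u : ℝ) :
    Tendsto (fun n : ℕ => Real.smoothTransition ((n + 1) * u)) atTop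
      (𝓝 (if 0 < u then 1 else 0)) := by
  split_ifs with hu
  · refine tendsto_const_nhds.congr' ?_
    have : Tendsto (fun n : ℕ => ((n : ℝ) + 1) * u) atTop atTop :=
      (tendsto_natCast_atTop_atTop.atTop_add tendsto_const_nhds).atTop_mul_const hu
    filter_upwards [this.eventually_ge_atTop 1] with n hn
    exact (Real.smoothTransition.one_of_one_le hn).symm
  · refine tendsto_const_nhds.congr fun n => ?_
    exact (Real.smoothTransition.zero_of_nonpos
      (mul_nonpos_of_nonneg_of_nonpos (by positivity) (not_lt.1 hu))).symm

theorem tendsto_softPos (u : ℝ) : Tendsto (fun n => softPos n u) atTop (𝓝 (max u 0)) := by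
  rcases le_total u 0 with hu | hu
  · simp [softPos_of_nonpos _ hu, hu]
  · have h := intervalIntegral.tendsto_integral_filter_of_dominated_convergence
      (μ := volume) (a := 0) (b := u) (l := atTop) (f := fun _ : ℝ => (1 : ℝ))
      (F := fun (n : ℕ) σ => Real.smoothTransition ((n + 1) * σ)) (fun _ => 1)
      (Eventually.of_forall fun n => (continuous_softPos_integrand n).aestronglyMeasurable)
      (Eventually.of_forall fun n => Eventually.of_forall fun σ _ => by
        rw [Real.norm_of_nonneg (Real.smoothTransition.nonneg _)]
        exact Real.smoothTransition.le_one _)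
      (continuous_const.intervalIntegrable _ _)
      (Eventually.of_forall fun σ hσ => by
        rw [uIoc_of_le hu] at hσ
        simpa [hσ.1] using tendsto_smoothTransition_mul σ)
    simpa [softPos, hu] using h

/-- Nonnegative smooth functions supported in `S`. -/
def nonnegTests (S : Set (Ed d)) : Set (Ed d → ℝ) :=
  {φ | ContDiff ℝ (⊤ : ℕ∞) φ ∧ (∀ x, 0 ≤ φ x) ∧ tsupport φ ⊆ S}

theorem gradient_sq_mul_comp {η φ : Ed d → ℝ} (hη : ContDiff ℝ 1 η) (hφ : ContDiff ℝ 1 φ)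
    {g g' : ℝ → ℝ} (hg : ∀ u, HasDerivAt g (g' u) u) (l : ℝ) (x : Ed d) :
    gradient (fun x => η x ^ 2 * g (φ x - l)) x =
      η x ^ 2 • g' (φ x - l) • gradient φ x + (2 * η x * g (φ x - l)) • gradient η x := by
  have h1 := (hη.differentiable one_ne_zero x).hasFDerivAt
  have h2 := (hφ.differentiable one_ne_zero x).hasFDerivAt
  have h3 : fderiv ℝ (fun x => η x ^ 2 * g (φ x - l)) x = _ :=
    ((h1.pow 2).mul ((hg _).comp_hasFDerivAt x (h2.sub_const l))).fderiv
  refine ext_inner_right ℝ fun e => ?_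
  rw [inner_gradient_eq, h3]
  simp only [inner_add_left, inner_smul_left, inner_gradient_eq]
  simp
  ring

section Cutoff

variable {η : Ed d → ℝ}

theorem tendsto_eLpNorm_cutoff_sq (hη : ContDiff ℝ 1 η) (hηc : HasCompactSupport η)
    (hη1 : ∀ x, |η x| ≤ 1) {un : ℕ → Ed d → ℝ} {u : Ed d → ℝ} {Vn : ℕ → Ed d → Ed d}
    {V : Ed d → Ed d} (hun : ∀ n, Measurable (un n)) (hu : Measurable u)
    (hVn : ∀ n, Measurable (Vn n)) (hV : Measurable V)
    (h1 : Tendsto (fun n => eLpNorm (fun x => η x * (un n x - u x)) 2 volume) atTop (𝓝 0))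
    (h2 : Tendsto (fun n => eLpNorm (fun x => η x • (Vn n x - V x)) 2 volume) atTop (𝓝 0)) :
    Tendsto (fun n => eLpNorm ((fun x => η x ^ 2 * un n x) - fun x => η x ^ 2 * u x) 2 volume)
      atTop (𝓝 0) ∧
    Tendsto (fun n => eLpNorm ((fun x => η x ^ 2 • Vn n x + (2 * η x * un n x) • gradient η x) -
      fun x => η x ^ 2 • V x + (2 * η x * u x) • gradient η x) 2 volume) atTop (𝓝 0) := by
  obtain ⟨M, hM⟩ := exists_bound_gradient hη hηc
  have hηm := hη.continuous.measurable
  have hgm := (continuous_gradient hη).measurable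
  constructor
  · refine tendsto_of_tendsto_of_tendsto_of_le_of_le tendsto_const_nhds h1
      (fun _ => zero_le) fun n => eLpNorm_mono fun x => ?_
    simp only [Pi.sub_apply, Real.norm_eq_abs]
    have : η x ^ 2 * un n x - η x ^ 2 * u x = η x * (η x * (un n x - u x)) := by ring
    rw [this, abs_mul]
    exact mul_le_of_le_one_left (abs_nonneg _) (hη1 x)
  · have hlim := h2.add (ENNReal.Tendsto.const_mul h1
      (Or.inr (ENNReal.ofReal_ne_top (r := 2 * M))))
    rw [mul_zero, add_zero] at hlim
    refine tendsto_of_tendsto_of_tendsto_of_le_of_le tendsto_const_nhds hlim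
      (fun _ => zero_le) fun n => ?_
    have hsplit : ((fun x => η x ^ 2 • Vn n x + (2 * η x * un n x) • gradient η x) -
        fun x => η x ^ 2 • V x + (2 * η x * u x) • gradient η x) =
        (fun x => η x ^ 2 • (Vn n x - V x)) +
          fun x => (η x * (un n x - u x)) • (2 : ℝ) • gradient η x := by
      ext1 x; simp only [Pi.sub_apply, Pi.add_apply]
      rw [smul_sub, smul_smul, mul_comm _ (2 : ℝ), ← sub_add_sub_comm, ← sub_smul]
      congr 2; ring
    have m1 : Measurable fun x => η x ^ 2 • (Vn n x - V x) :=
      (hηm.pow_const 2).smul ((hVn n).sub hV)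
    have m2 : Measurable fun x => (η x * (un n x - u x)) • (2 : ℝ) • gradient η x :=
      (hηm.mul ((hun n).sub hu)).smul (hgm.const_smul (2 : ℝ))
    rw [hsplit]
    refine (eLpNorm_add_le m1.aestronglyMeasurable m2.aestronglyMeasurable
      one_le_two).trans (add_le_add ?_ ?_)
    · refine eLpNorm_mono fun x => ?_
      rw [sq, mul_smul, norm_smul]
      exact mul_le_of_le_one_left (norm_nonneg _) (hη1 x)
    · refine eLpNorm_le_mul_eLpNorm_of_ae_le_mul (Eventually.of_forall fun x => ?_) 2
      rw [norm_smul, norm_smul, mul_comm]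
      gcongr
      · simp
      · exact hM x

/-- Truncations of a Sobolev function, multiplied by the square of a cutoff function, are limits
of nonnegative test functions. -/
theorem SobApprox.truncation {F : Ed d → ℝ} {H : Ed d → Ed d}
    (h : SobApprox {φ | ContDiff ℝ (⊤ : ℕ∞) φ} F H) (hF : Measurable F) (hH : Measurable H)
    (hF2 : MemLp F 2 volume) (hH2 : MemLp H 2 volume) (hη : ContDiff ℝ (⊤ : ℕ∞) η)
    (hηc : HasCompactSupport η) (hη1 : ∀ x, |η x| ≤ 1) (l : ℝ) :
    SobApprox (nonnegTests (tsupport η)) (fun x => η x ^ 2 * max (F x - l) 0)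
      (fun x => η x ^ 2 • (if l < F x then H x else 0) +
        (2 * η x * max (F x - l) 0) • gradient η x) := by
  have hη' : ContDiff ℝ 1 η := hη.of_le (by exact_mod_cast le_top)
  have hηm := hη.continuous.measurable
  have hgm := (continuous_gradient hη').measurable
  have hsT : ∀ n : ℕ, Measurable fun u : ℝ => Real.smoothTransition ((n + 1) * u) :=
    fun n => (continuous_softPos_integrand n).measurable
  have hsP : ∀ n : ℕ, Measurable (softPos n) := fun n => (contDiff_softPos n).continuous.measurable
  have hbd : ∀ a : ℝ, |Real.smoothTransition a| ≤ 1 := fun a => by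
    rw [abs_of_nonneg (Real.smoothTransition.nonneg _)]; exact Real.smoothTransition.le_one _
  have hbd2 : ∀ a b : ℝ, |Real.smoothTransition a - Real.smoothTransition b| ≤ 1 := fun a b => by
    have := Real.smoothTransition.nonneg a
    have := Real.smoothTransition.nonneg b
    have := Real.smoothTransition.le_one a
    have := Real.smoothTransition.le_one b
    rw [abs_le]; constructor <;> linarith
  have hite : Measurable fun x => if l < F x then H x else 0 :=
    Measurable.ite (measurableSet_lt measurable_const hF) hH measurable_const
  have hlm : Measurable fun x => max (F x - l) 0 := (hF.sub_const l).max measurable_const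
  have hstep : ∀ n : ℕ, SobApprox (nonnegTests (tsupport η))
      (fun x => η x ^ 2 * softPos n (F x - l))
      (fun x => η x ^ 2 • (Real.smoothTransition ((n + 1) * (F x - l)) • H x) +
        (2 * η x * softPos n (F x - l)) • gradient η x) := by
    intro n
    obtain ⟨φ, h1, h2, h3⟩ := h
    replace h1 : ∀ n, ContDiff ℝ (⊤ : ℕ∞) (φ n) := h1
    have h1' : ∀ n, ContDiff ℝ 1 (φ n) := fun n => (h1 n).of_le (by exact_mod_cast le_top)
    obtain ⟨ns, hns, hae⟩ := (tendstoInMeasure_of_tendsto_eLpNorm two_ne_zero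
      (fun n => (h1 n).continuous.aestronglyMeasurable) hF.aestronglyMeasurable h2).exists_seq_tendsto_ae
    have hφm : ∀ k, Measurable (φ (ns k)) := fun k => (h1 _).continuous.measurable
    have hgφ : ∀ k, Measurable (gradient (φ (ns k))) := fun k => (continuous_gradient (h1' _)).measurable
    refine ⟨fun k x => η x ^ 2 * softPos n (φ (ns k) x - l), fun k => ⟨?_, ?_, ?_⟩, ?_⟩
    · exact (hη.pow 2).mul ((contDiff_softPos n).comp ((h1 _).sub contDiff_const))
    · exact fun x => mul_nonneg (sq_nonneg _) (softPos_nonneg _ _)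
    · refine closure_mono fun x hx => ?_
      intro h0
      exact hx (by simp [h0])
    · have hgr : ∀ k, gradient (fun x => η x ^ 2 * softPos n (φ (ns k) x - l)) = fun x =>
          η x ^ 2 • (Real.smoothTransition ((n + 1) * (φ (ns k) x - l)) • gradient (φ (ns k)) x) +
            (2 * η x * softPos n (φ (ns k) x - l)) • gradient η x := fun k => funext fun x =>
        gradient_sq_mul_comp hη' (h1' _) (hasDerivAt_softPos n) l x
      simp only [hgr]
      refine tendsto_eLpNorm_cutoff_sq hη' hηc hη1
        (fun k => (hsP n).comp ((hφm k).sub_const l)) ((hsP n).comp (hF.sub_const l))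
        (fun k => ((hsT n).comp ((hφm k).sub_const l)).smul (hgφ k))
        (((hsT n).comp (hF.sub_const l)).smul hH) ?_ ?_
      · refine tendsto_of_tendsto_of_tendsto_of_le_of_le tendsto_const_nhds
          (h2.comp hns.tendsto_atTop) (fun _ => zero_le) fun k => eLpNorm_mono fun x => ?_
        rw [norm_mul]
        refine (mul_le_of_le_one_left (norm_nonneg _) (hη1 x)).trans ?_
        refine (abs_softPos_sub_le n _ _).trans ?_
        simp
      · have hlim : Tendsto (fun k => eLpNorm (gradient (φ (ns k)) - H) 2 volume +
            eLpNorm (fun x => (Real.smoothTransition ((n + 1) * (φ (ns k) x - l)) -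
              Real.smoothTransition ((n + 1) * (F x - l))) • H x) 2 volume) atTop (𝓝 (0 + 0)) := by
          refine (h3.comp hns.tendsto_atTop).add ?_
          refine tendsto_eLpNorm_two_zero_of_dominated (fun k => ?_) hH2.norm (fun k => ?_) ?_
          · exact ((((hsT n).comp ((hφm k).sub_const l)).sub
              ((hsT n).comp (hF.sub_const l))).smul hH).aestronglyMeasurable
          · refine Eventually.of_forall fun x => ?_
            rw [norm_smul]
            exact mul_le_of_le_one_left (norm_nonneg _) (hbd2 _ _)
          · filter_upwards [hae] with x hx
            have := ((continuous_softPos_integrand n).tendsto (F x - l)).comp (hx.sub_const l)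
            simpa using (this.sub_const (Real.smoothTransition ((n + 1) * (F x - l)))).smul_const (H x)
        rw [add_zero] at hlim
        refine tendsto_of_tendsto_of_tendsto_of_le_of_le tendsto_const_nhds hlim
          (fun _ => zero_le) fun k => ?_
        have hsplit : (fun x => η x • (Real.smoothTransition ((n + 1) * (φ (ns k) x - l)) •
            gradient (φ (ns k)) x - Real.smoothTransition ((n + 1) * (F x - l)) • H x)) =
            (fun x => η x • Real.smoothTransition ((n + 1) * (φ (ns k) x - l)) •
              (gradient (φ (ns k)) x - H x)) +
            fun x => η x • (Real.smoothTransition ((n + 1) * (φ (ns k) x - l)) -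
              Real.smoothTransition ((n + 1) * (F x - l))) • H x := by
          ext1 x; simp only [Pi.add_apply]; module
        rw [hsplit]
        refine (eLpNorm_add_le ?_ ?_ one_le_two).trans (add_le_add ?_ ?_)
        · exact (hηm.smul (((hsT n).comp ((hφm k).sub_const l)).smul
            ((hgφ k).sub hH))).aestronglyMeasurable
        · exact (hηm.smul ((((hsT n).comp ((hφm k).sub_const l)).sub
              ((hsT n).comp (hF.sub_const l))).smul hH)).aestronglyMeasurable
        · refine eLpNorm_mono fun x => ?_
          rw [norm_smul, norm_smul, Pi.sub_apply]
          exact (mul_le_of_le_one_left (by positivity) (hη1 x)).trans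
            (mul_le_of_le_one_left (norm_nonneg _) (hbd _))
        · refine eLpNorm_mono fun x => ?_
          rw [norm_smul]
          exact mul_le_of_le_one_left (norm_nonneg _) (hη1 x)
  have hw : MemLp (fun x => ‖F x‖ + |l| * ‖η x‖) 2 volume :=
    hF2.norm.add ((hη.continuous.memLp_of_hasCompactSupport hηc).norm.const_mul _)
  obtain ⟨ha, hb⟩ := tendsto_eLpNorm_cutoff_sq hη' hηc hη1
    (un := fun n x => softPos n (F x - l)) (u := fun x => max (F x - l) 0)
    (Vn := fun n x => Real.smoothTransition ((n + 1) * (F x - l)) • H x)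
    (V := fun x => if l < F x then H x else 0)
    (fun n => (hsP n).comp (hF.sub_const l)) hlm
    (fun n => ((hsT n).comp (hF.sub_const l)).smul hH) hite
    (by
      refine tendsto_eLpNorm_two_zero_of_dominated
        (fun n => (hηm.mul (((hsP n).comp (hF.sub_const l)).sub hlm)).aestronglyMeasurable) hw
        (fun n => Eventually.of_forall fun x => ?_) (Eventually.of_forall fun x => ?_)
      · rw [norm_mul]
        have e1 := softPos_nonneg n (F x - l)
        have e2 := softPos_le n (F x - l)
        have e3 : max (F x - l) 0 ≤ |F x| + |l| :=
          max_le ((le_abs_self _).trans (abs_sub _ _)) (by positivity)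
        have e4 : ‖softPos n (F x - l) - max (F x - l) 0‖ ≤ |F x| + |l| := by
          rw [Real.norm_eq_abs, abs_le]; constructor <;> linarith
        calc ‖η x‖ * ‖softPos n (F x - l) - max (F x - l) 0‖ ≤ ‖η x‖ * (|F x| + |l|) := by gcongr
          _ ≤ ‖F x‖ + |l| * ‖η x‖ := by
            have := mul_le_of_le_one_left (abs_nonneg (F x)) (hη1 x)
            simp only [Real.norm_eq_abs]; linarith
      · simpa using ((tendsto_softPos (F x - l)).sub_const (max (F x - l) 0)).const_mul (η x))
    (by
      refine tendsto_eLpNorm_two_zero_of_dominated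
        (fun n => (hηm.smul ((((hsT n).comp (hF.sub_const l)).smul hH).sub hite)).aestronglyMeasurable)
        hH2.norm (fun n => Eventually.of_forall fun x => ?_) (Eventually.of_forall fun x => ?_)
      · rw [norm_smul]
        refine (mul_le_of_le_one_left (norm_nonneg _) (hη1 x)).trans ?_
        split_ifs with hx
        · rw [← one_smul ℝ (H x), smul_smul, mul_one, ← sub_smul, norm_smul, one_smul]
          have := hbd2 ((n + 1) * (F x - l)) 1
          rw [Real.smoothTransition.one] at this
          exact mul_le_of_le_one_left (norm_nonneg _) this
        · rw [sub_zero, norm_smul]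
          exact mul_le_of_le_one_left (norm_nonneg _) (hbd _)
      · have := ((tendsto_smoothTransition_mul (F x - l)).smul_const (H x)).sub_const
          (if l < F x then H x else 0)
        have := this.const_smul (η x)
        refine this.trans (le_of_eq ?_)
        by_cases hx : l < F x <;> simp [hx])
  refine SobApprox.of_tendsto (fun φ hφ => hφ.1.of_le (by exact_mod_cast le_top)) hstep ?_ ?_ ?_ ?_
    ha hb
  · exact fun n => ((hηm.pow_const 2).mul ((hsP n).comp (hF.sub_const l))).aestronglyMeasurable
  · exact fun n => (((hηm.pow_const 2).smul (((hsT n).comp (hF.sub_const l)).smul hH)).add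
      (((hηm.const_mul 2).mul ((hsP n).comp (hF.sub_const l))).smul hgm)).aestronglyMeasurable
  · exact ((hηm.pow_const 2).mul hlm).aestronglyMeasurable
  · exact (((hηm.pow_const 2).smul hite).add
      (((hηm.const_mul 2).mul hlm).smul hgm)).aestronglyMeasurable

end Cutoff

section Pairing

variable {Z : Type*} [MeasurableSpace Z] {μ : Measure Z} [SFinite μ]
  {E : Type*} [NormedAddCommGroup E]

theorem MeasureTheory.MemLp.comp_snd_restrict {Ψ : Z → E} (hΨ : MemLp Ψ 2 μ) (a b : ℝ) :
    MemLp (fun p : ℝ × Z => Ψ p.2) 2 ((volume.restrict (Ioc a b)).prod μ) := by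
  refine MemLp.comp_of_map ?_ measurable_snd.aemeasurable
  rw [Measure.map_snd_prod]
  exact hΨ.smul_measure (by simp)

theorem eLpNorm_comp_snd_restrict {Ψ : Z → E} (hΨ : AEStronglyMeasurable Ψ μ) (a b : ℝ) :
    eLpNorm (fun p : ℝ × Z => Ψ p.2) 2 ((volume.restrict (Ioc a b)).prod μ) =
      ENNReal.ofReal (b - a) ^ (1 / (2 : ℝ)) * eLpNorm Ψ 2 μ := by
  have h : eLpNorm Ψ 2 (Measure.map Prod.snd ((volume.restrict (Ioc a b)).prod μ)) =
      eLpNorm (fun p : ℝ × Z => Ψ p.2) 2 ((volume.restrict (Ioc a b)).prod μ) := by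
    refine eLpNorm_map_measure ?_ measurable_snd.aemeasurable
    rw [Measure.map_snd_prod]
    exact hΨ.smul_measure _
  rw [← h, Measure.map_snd_prod, eLpNorm_smul_measure_of_ne_top (by simp)]
  simp

theorem MeasureTheory.MemLp.restrict_Ioc_prod {F : ℝ × Z → E} (hF : MemLp F 2 (volume.prod μ)) (a b : ℝ) :
    MemLp F 2 ((volume.restrict (Ioc a b)).prod μ) := by
  have : (volume.restrict (Ioc a b)).prod μ = (volume.prod μ).restrict (Ioc a b ×ˢ univ) := by
    rw [← Measure.prod_restrict, Measure.restrict_univ]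
  rw [this]
  exact hF.restrict _

variable [InnerProductSpace ℝ E]

theorem integrable_pairing_const {F : ℝ × Z → E} (hF : MemLp F 2 (volume.prod μ)) {Ψ : Z → E}
    (hΨ : MemLp Ψ 2 μ) (a b : ℝ) :
    IntegrableOn (fun τ => ∫ z, ⟪F (τ, z), Ψ z⟫ ∂μ) (Ioc a b) :=
  ((hF.restrict_Ioc_prod a b).integrable_inner (hΨ.comp_snd_restrict a b)).integral_prod_left

theorem tendsto_integral_pairing_const {F : ℝ × Z → E} (hF : MemLp F 2 (volume.prod μ))
    {Ψ : ℕ → Z → E} {Φ : Z → E} (hΦ : MemLp Φ 2 μ) (hΨ : ∀ n, MemLp (Ψ n) 2 μ)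
    (h : Tendsto (fun n => eLpNorm (Ψ n - Φ) 2 μ) atTop (𝓝 0)) (a b : ℝ) :
    Tendsto (fun n => ∫ τ in Ioc a b, ∫ z, ⟪F (τ, z), Ψ n z⟫ ∂μ) atTop
      (𝓝 (∫ τ in Ioc a b, ∫ z, ⟪F (τ, z), Φ z⟫ ∂μ)) := by
  have hF' := hF.restrict_Ioc_prod a b
  have key := tendsto_integral_inner_of_tendsto_eLpNorm hF' (hΦ.comp_snd_restrict a b)
    (fun n => (hΨ n).comp_snd_restrict a b) (by
      have h' := ENNReal.Tendsto.const_mul (a := ENNReal.ofReal (b - a) ^ (1 / (2 : ℝ))) h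
        (Or.inr (by simp))
      rw [mul_zero] at h'
      refine h'.congr fun n => ?_
      exact (eLpNorm_comp_snd_restrict ((hΨ n).sub hΦ).1 a b).symm)
  rw [integral_prod _ (hF'.integrable_inner (hΦ.comp_snd_restrict a b))] at key
  refine key.congr fun n => ?_
  rw [integral_prod _ (hF'.integrable_inner ((hΨ n).comp_snd_restrict a b))]

end Pairing

/-- Square integrable fields representing the local and nonlocal parts of the equation in a
space-time cylinder. -/
structure FormFields (d : ℕ) where
  flux : ℝ × Ed d → Ed d
  near : ℝ × Ed d × Ed d → ℝ
  far : ℝ × Ed d → ℝ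
  flux_meas : Measurable flux
  near_meas : Measurable near
  far_meas : Measurable far
  flux_memLp : MemLp flux 2 volume
  near_memLp : MemLp near 2 volume
  far_memLp : MemLp far 2 volume

/-- The form `∫ ⟨flux, G⟩ + ∬ near · D^s f + ∫ far · f` at time `τ`. -/
def FormFields.form (F : FormFields d) (s τ : ℝ) (f : Ed d → ℝ) (G : Ed d → Ed d) : ℝ :=
  (∫ x, ⟪F.flux (τ, x), G x⟫) + (∫ p, ⟪F.near (τ, p), fracDiff s f p⟫) +
    ∫ x, ⟪F.far (τ, x), f x⟫

theorem FormFields.integral_form (F : FormFields d) {s : ℝ} {f : Ed d → ℝ} {G : Ed d → Ed d}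
    (hf : MemLp f 2 volume) (hG : MemLp G 2 volume) (hff : MemLp (fracDiff s f) 2 volume) (a b : ℝ) :
    ∫ τ in Ioc a b, F.form s τ f G =
      (∫ τ in Ioc a b, ∫ x, ⟪F.flux (τ, x), G x⟫) +
      (∫ τ in Ioc a b, ∫ p, ⟪F.near (τ, p), fracDiff s f p⟫) +
      ∫ τ in Ioc a b, ∫ x, ⟪F.far (τ, x), f x⟫ := by
  have h1 := integrable_pairing_const F.flux_memLp hG a b
  have h2 := integrable_pairing_const F.near_memLp hff a b
  have h3 := integrable_pairing_const F.far_memLp hf a b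
  have h12 : IntegrableOn (fun τ => (∫ x, ⟪F.flux (τ, x), G x⟫) +
      ∫ p, ⟪F.near (τ, p), fracDiff s f p⟫) (Ioc a b) := h1.add h2
  simp only [FormFields.form]
  rw [integral_add h12 h3, integral_add h1 h2]

theorem memLp_of_mem_nonnegTests {S : Set (Ed d)} (hS : IsCompact S) {φ : Ed d → ℝ}
    (h : φ ∈ nonnegTests S) : MemLp φ 2 volume ∧ MemLp (gradient φ) 2 volume := by
  have hc : HasCompactSupport φ := hS.of_isClosed_subset (isClosed_tsupport φ) h.2.2
  have h1 : ContDiff ℝ 1 φ := h.1.of_le (by exact_mod_cast le_top)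
  refine ⟨h1.continuous.memLp_of_hasCompactSupport hc,
    (continuous_gradient h1).memLp_of_hasCompactSupport ?_⟩
  refine hc.mono' fun x hx => ?_
  by_contra hx'
  exact hx (gradient_eq_zero_of_notMem_tsupport hx')

theorem memLp_fracDiff (hd : 2 ≤ d) {s : ℝ} (hs : s ∈ Ioo (0 : ℝ) 1)
    {f : Ed d → ℝ} {G : Ed d → Ed d} (hfm : Measurable f) (hGm : Measurable G)
    (h : SobApprox {φ | ContDiff ℝ 1 φ} f G) (hf : MemLp f 2 volume) (hG : MemLp G 2 volume) :
    MemLp (fracDiff s f) 2 volume := by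
  refine ⟨(measurable_fracDiff s hfm).aestronglyMeasurable,
    (h.eLpNorm_fracDiff_le hd hs hfm hGm).trans_lt ?_⟩
  exact ENNReal.mul_lt_top ENNReal.ofReal_lt_top
    (ENNReal.add_lt_top.2 ⟨ENNReal.mul_lt_top (by simp) hf.2, hG.2⟩)

theorem sobApprox_self {φ : Ed d → ℝ} (h : ContDiff ℝ 1 φ) :
    SobApprox {φ | ContDiff ℝ 1 φ} φ (gradient φ) :=
  ⟨fun _ => φ, fun _ => h, by simp, by simp⟩

theorem FormFields.tendsto_integral_form (F : FormFields d) (hd : 2 ≤ d) {s : ℝ}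
    (hs : s ∈ Ioo (0 : ℝ) 1) {S : Set (Ed d)} (hS : IsCompact S) {f : Ed d → ℝ} {G : Ed d → Ed d}
    (hfm : Measurable f) (hGm : Measurable G) (hf : MemLp f 2 volume) (hG : MemLp G 2 volume)
    {φ : ℕ → Ed d → ℝ} (h1 : ∀ n, φ n ∈ nonnegTests S)
    (h2 : Tendsto (fun n => eLpNorm (φ n - f) 2 volume) atTop (𝓝 0))
    (h3 : Tendsto (fun n => eLpNorm (gradient (φ n) - G) 2 volume) atTop (𝓝 0)) (a b : ℝ) :
    Tendsto (fun n => ∫ τ in Ioc a b, F.form s τ (φ n) (gradient (φ n))) atTop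
      (𝓝 (∫ τ in Ioc a b, F.form s τ f G)) := by
  have hC : ∀ n, ContDiff ℝ 1 (φ n) := fun n => (h1 n).1.of_le (by exact_mod_cast le_top)
  have hm := fun n => memLp_of_mem_nonnegTests hS (h1 n)
  have hff : MemLp (fracDiff s f) 2 volume := memLp_fracDiff hd hs hfm hGm ⟨φ, hC, h2, h3⟩ hf hG
  have hfn : ∀ n, MemLp (fracDiff s (φ n)) 2 volume := fun n =>
    memLp_fracDiff hd hs (hC n).continuous.measurable (continuous_gradient (hC n)).measurable
      (sobApprox_self (hC n)) (hm n).1 (hm n).2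
  rw [F.integral_form hf hG hff]
  simp only [fun n => F.integral_form (hm n).1 (hm n).2 (hfn n) a b]
  exact ((tendsto_integral_pairing_const F.flux_memLp hG (fun n => (hm n).2) h3 a b).add
    (tendsto_integral_pairing_const F.near_memLp hff hfn
      (tendsto_eLpNorm_fracDiff_sub hd hs hfm hGm hC h2 h3) a b)).add
    (tendsto_integral_pairing_const F.far_memLp hf (fun n => (hm n).1) h2 a b)

section Averages

variable {Z : Type*} [MeasurableSpace Z] {μ : Measure Z} [SFinite μ]
  {E : Type*} [NormedAddCommGroup E] [InnerProductSpace ℝ E]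
  [TopologicalSpace Z] [R1Space Z] [SecondCountableTopology Z]
  [BorelSpace Z] [IsLocallyFiniteMeasure μ] [(volume.prod μ : Measure (ℝ × Z)).InnerRegularCompactLTTop]

theorem tendsto_average_backward_pairing_Ioo {F Φ : ℝ × Z → E} (hFm : StronglyMeasurable F)
    (hΦm : StronglyMeasurable Φ) (hF : MemLp F 2 (volume.prod μ))
    (hΦ : MemLp Φ 2 (volume.prod μ)) (t₁ t₂ : ℝ) :
    Tendsto (fun h : ℝ => h⁻¹ * ∫ t in Ioo t₁ t₂, ∫ τ in Ioc (t - h) t,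
      ∫ z, ⟪F (τ, z), Φ (t, z)⟫ ∂μ)
      (𝓝[>] 0) (𝓝 (∫ t in Ioo t₁ t₂, ∫ z, ⟪F (t, z), Φ (t, z)⟫ ∂μ)) := by
  have hS : MeasurableSet (Ioo t₁ t₂ ×ˢ (univ : Set Z)) := measurableSet_Ioo.prod MeasurableSet.univ
  have key := tendsto_average_backward_pairing hFm (hΦm.indicator hS) hF (hΦ.indicator hS)
  have hlim : ∫ p, ⟪F p, (Ioo t₁ t₂ ×ˢ (univ : Set Z)).indicator Φ p⟫ ∂(volume.prod μ) =
      ∫ t in Ioo t₁ t₂, ∫ z, ⟪F (t, z), Φ (t, z)⟫ ∂μ := by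
    rw [integral_prod _ (hF.integrable_inner (hΦ.indicator hS)), ← integral_indicator measurableSet_Ioo]
    congr 1; ext t
    by_cases ht : t ∈ Ioo t₁ t₂ <;> simp [ht]
  rw [hlim] at key
  refine key.congr fun h => ?_
  rw [← integral_indicator measurableSet_Ioo]
  congr 2; ext t
  by_cases ht : t ∈ Ioo t₁ t₂ <;> simp [ht]

end Averages

theorem lintegral_fracDiff_sq_le (hd : 2 ≤ d) {s : ℝ} (hs : s ∈ Ioo (0 : ℝ) 1)
    {f : Ed d → ℝ} {G : Ed d → Ed d} (hfm : Measurable f) (hGm : Measurable G)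
    (h : SobApprox {φ | ContDiff ℝ 1 φ} f G) :
    ∫⁻ p, ‖fracDiff s f p‖ₑ ^ 2 ≤ ENNReal.ofReal (9 * fracConst d s) *
      ((∫⁻ x, ‖f x‖ₑ ^ 2) + ∫⁻ x, ‖G x‖ₑ ^ 2) := by
  simp only [← eLpNorm_two_sq]
  have h0 := h.eLpNorm_fracDiff_le hd hs hfm hGm
  have hsq : ENNReal.ofReal (√(fracConst d s)) ^ 2 = ENNReal.ofReal (fracConst d s) := by
    rw [← ENNReal.ofReal_pow (Real.sqrt_nonneg _), Real.sq_sqrt (fracConst_nonneg d s)]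
  have h9 : ∀ a b : ℝ≥0∞, (2 * a + b) ^ 2 ≤ 9 * (a ^ 2 + b ^ 2) := by
    intro a b
    rcases le_total a b with hab | hab
    · calc (2 * a + b) ^ 2 ≤ (2 * b + b) ^ 2 := by gcongr
        _ = 9 * b ^ 2 := by ring
        _ ≤ _ := by gcongr; exact le_add_self
    · calc (2 * a + b) ^ 2 ≤ (2 * a + a) ^ 2 := by gcongr
        _ = 9 * a ^ 2 := by ring
        _ ≤ _ := by gcongr; exact le_self_add
  calc _ ≤ (ENNReal.ofReal (√(fracConst d s)) * (2 * eLpNorm f 2 volume + eLpNorm G 2 volume)) ^ 2 := by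
        gcongr
    _ ≤ ENNReal.ofReal (fracConst d s) * (9 * (eLpNorm f 2 volume ^ 2 + eLpNorm G 2 volume ^ 2)) := by
        rw [mul_pow, hsq]; gcongr; exact h9 _ _
    _ = _ := by
        rw [ENNReal.ofReal_mul (by norm_num)]
        norm_num
        ring

theorem memLp_two_iff_lintegral {X E : Type*} [MeasurableSpace X] [NormedAddCommGroup E]
    {μ : Measure X} {f : X → E} (hf : AEStronglyMeasurable f μ) :
    MemLp f 2 μ ↔ ∫⁻ x, ‖f x‖ₑ ^ 2 ∂μ < ∞ := by
  rw [MemLp, ← eLpNorm_two_sq, and_iff_right hf]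
  simp [lt_top_iff_ne_top]

theorem lintegral_enorm_sq_lt_top {X E : Type*} [MeasurableSpace X] [NormedAddCommGroup E]
    {μ : Measure X} {f : X → E} (hf : MemLp f 2 μ) : ∫⁻ x, ‖f x‖ₑ ^ 2 ∂μ < ∞ :=
  (memLp_two_iff_lintegral hf.1).1 hf

theorem ae_memLp_slice {Z E : Type*} [MeasurableSpace Z] {μ : Measure Z} [SFinite μ]
    [NormedAddCommGroup E] [MeasurableSpace E] [BorelSpace E] [SecondCountableTopology E]
    {f : ℝ × Z → E} (hfm : Measurable f) (hf : MemLp f 2 (volume.prod μ)) :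
    ∀ᵐ τ, MemLp (fun z => f (τ, z)) 2 μ := by
  have h := lintegral_enorm_sq_lt_top hf
  rw [lintegral_prod _ (by fun_prop)] at h
  have hm : Measurable fun τ => ∫⁻ z, ‖f (τ, z)‖ₑ ^ 2 ∂μ :=
    Measurable.lintegral_prod_right' (f := fun p => ‖f p‖ₑ ^ 2) (by fun_prop)
  filter_upwards [ae_lt_top hm h.ne] with τ hτ
  exact (memLp_two_iff_lintegral (hfm.comp measurable_prodMk_left).aestronglyMeasurable).2 hτ

theorem measurable_fracDiff_family (s : ℝ) {f : ℝ × Ed d → ℝ} (hf : Measurable f) :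
    Measurable fun q : ℝ × Ed d × Ed d => fracDiff s (fun x => f (q.1, x)) q.2 := by
  unfold fracDiff
  fun_prop

theorem memLp_fracDiff_family (hd : 2 ≤ d) {s : ℝ} (hs : s ∈ Ioo (0 : ℝ) 1)
    {f : ℝ × Ed d → ℝ} {G : ℝ × Ed d → Ed d} (hfm : Measurable f) (hGm : Measurable G)
    (hf : MemLp f 2 volume) (hG : MemLp G 2 volume)
    (h : ∀ᵐ τ, SobApprox {φ | ContDiff ℝ 1 φ} (fun x => f (τ, x)) (fun x => G (τ, x))) :
    MemLp (fun q : ℝ × Ed d × Ed d => fracDiff s (fun x => f (q.1, x)) q.2) 2 volume := by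
  have hm := measurable_fracDiff_family s hfm
  rw [memLp_two_iff_lintegral hm.aestronglyMeasurable, Measure.volume_eq_prod,
    lintegral_prod _ (hm.enorm.pow_const 2).aemeasurable]
  have hf2 := lintegral_enorm_sq_lt_top hf
  have hG2 := lintegral_enorm_sq_lt_top hG
  rw [Measure.volume_eq_prod, lintegral_prod _ (by fun_prop)] at hf2 hG2
  have hmf : Measurable fun τ => ∫⁻ x, ‖f (τ, x)‖ₑ ^ 2 :=
    Measurable.lintegral_prod_right' (f := fun p => ‖f p‖ₑ ^ 2) (by fun_prop)
  calc _ ≤ ∫⁻ τ, ENNReal.ofReal (9 * fracConst d s) *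
        ((∫⁻ x, ‖f (τ, x)‖ₑ ^ 2) + ∫⁻ x, ‖G (τ, x)‖ₑ ^ 2) := by
        refine lintegral_mono_ae ?_
        filter_upwards [h] with τ hτ
        exact lintegral_fracDiff_sq_le hd hs (by fun_prop) (by fun_prop) hτ
    _ = ENNReal.ofReal (9 * fracConst d s) *
        ((∫⁻ τ, ∫⁻ x, ‖f (τ, x)‖ₑ ^ 2) + ∫⁻ τ, ∫⁻ x, ‖G (τ, x)‖ₑ ^ 2) := by
        rw [lintegral_const_mul' _ _ ENNReal.ofReal_ne_top, lintegral_add_left hmf]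
    _ < ∞ := ENNReal.mul_lt_top ENNReal.ofReal_lt_top (ENNReal.add_lt_top.2 ⟨hf2, hG2⟩)

theorem SobApprox.contDiff_of_nonnegTests {S : Set (Ed d)} {f : Ed d → ℝ} {G : Ed d → Ed d}
    (h : SobApprox (nonnegTests S) f G) : SobApprox {φ | ContDiff ℝ 1 φ} f G :=
  h.mono fun φ hφ => show ContDiff ℝ 1 φ from hφ.1.of_le (by exact_mod_cast le_top)

theorem FormFields.integrable_form (F : FormFields d) {s : ℝ}
    {f : ℝ × Ed d → ℝ} {G : ℝ × Ed d → Ed d} (hf : MemLp f 2 volume) (hG : MemLp G 2 volume)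
    (hff : MemLp (fun q : ℝ × Ed d × Ed d => fracDiff s (fun x => f (q.1, x)) q.2) 2 volume) :
    Integrable fun τ => F.form s τ (fun x => f (τ, x)) (fun x => G (τ, x)) :=
  ((F.flux_memLp.integrable_inner hG).integral_prod_left.add
    (F.near_memLp.integrable_inner hff).integral_prod_left).add
    (F.far_memLp.integrable_inner hf).integral_prod_left

/-- If the form inequality holds for nonnegative tests, it holds for limits of such tests. -/
theorem FormFields.weak_inequality_of_sobApprox (F : FormFields d) (hd : 2 ≤ d) {s : ℝ}
    (hs : s ∈ Ioo (0 : ℝ) 1) {S : Set (Ed d)} (hS : IsCompact S) {u₁ u₂ : Ed d → ℝ} {t₁ t₂ : ℝ}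
    (hu₁ : MemLp u₁ 2 volume) (hu₂ : MemLp u₂ 2 volume)
    (hweak : ∀ φ ∈ nonnegTests S, (∫ x, ⟪u₂ x, φ x⟫) - (∫ x, ⟪u₁ x, φ x⟫) +
      ∫ τ in Ioc t₁ t₂, F.form s τ φ (gradient φ) ≤ 0)
    {f : Ed d → ℝ} {G : Ed d → Ed d} (hfm : Measurable f) (hGm : Measurable G)
    (hf : MemLp f 2 volume) (hG : MemLp G 2 volume) (h : SobApprox (nonnegTests S) f G) :
    (∫ x, ⟪u₂ x, f x⟫) - (∫ x, ⟪u₁ x, f x⟫) + ∫ τ in Ioc t₁ t₂, F.form s τ f G ≤ 0 := by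
  obtain ⟨φ, h1, h2, h3⟩ := h
  have hm := fun n => (memLp_of_mem_nonnegTests hS (h1 n)).1
  refine le_of_tendsto (((tendsto_integral_inner_of_tendsto_eLpNorm hu₂ hf hm h2).sub
    (tendsto_integral_inner_of_tendsto_eLpNorm hu₁ hf hm h2)).add
    (F.tendsto_integral_form hd hs hS hfm hGm hf hG h1 h2 h3 t₁ t₂))
    (Eventually.of_forall fun n => hweak _ (h1 n))

theorem tendsto_backward_average {g : ℝ → ℝ} {c t : ℝ}
    (h : HasDerivAt (fun x => ∫ τ in c..x, g τ) (g t) t) :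
    Tendsto (fun h : ℝ => h⁻¹ * ((∫ τ in c..t, g τ) - ∫ τ in c..(t - h), g τ)) (𝓝[>] 0)
      (𝓝 (g t)) := by
  have h1 := h.tendsto_slope_zero_left
  have h2 : Tendsto (fun h : ℝ => -h) (𝓝[>] 0) (𝓝[<] 0) := by
    simpa using tendsto_neg_nhdsGT (a := (0 : ℝ))
  refine (h1.comp h2).congr fun h => ?_
  simp only [Function.comp, smul_eq_mul, inv_neg, ← sub_eq_add_neg]
  ring

/-- Abstract energy inequality obtained by testing the equation with a truncation of the solution,
without any differentiability in time. -/
theorem FormFields.energy_inequality (F : FormFields d) (hd : 2 ≤ d) {s : ℝ}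
    (hs : s ∈ Ioo (0 : ℝ) 1) {S : Set (Ed d)} (hS : IsCompact S) {α β : ℝ}
    {U f e : ℝ × Ed d → ℝ} {G : ℝ × Ed d → Ed d} (hUm : Measurable U) (hU : MemLp U 2 volume)
    (hfm : Measurable f) (hGm : Measurable G) (hf : MemLp f 2 volume) (hG : MemLp G 2 volume)
    (happ : ∀ᵐ τ, SobApprox (nonnegTests S) (fun x => f (τ, x)) (fun x => G (τ, x)))
    (hweak : ∀ t₁ t₂, α < t₁ → t₁ ≤ t₂ → t₂ < β → ∀ φ ∈ nonnegTests S,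
      (∫ x, ⟪U (t₂, x), φ x⟫) - (∫ x, ⟪U (t₁, x), φ x⟫) +
        ∫ τ in Ioc t₁ t₂, F.form s τ φ (gradient φ) ≤ 0)
    (he : Integrable e)
    (hconv : ∀ t₁ t₂, α < t₁ → t₁ ≤ t₂ → t₂ < β → ∀ x, e (t₂, x) - e (t₁, x) ≤
      ⟪U (t₂, x), f (t₂, x)⟫ - ⟪U (t₁, x), f (t₂, x)⟫) :
    ∃ N : Set ℝ, (∀ᵐ t, t ∈ N) ∧ ∀ t₁ ∈ N, ∀ t₂ ∈ N, α < t₁ → t₁ < t₂ → t₂ < β →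
      (∫ x, e (t₂, x)) + ∫ τ in Ioo t₁ t₂, F.form s τ (fun x => f (τ, x)) (fun x => G (τ, x)) ≤
        ∫ x, e (t₁, x) := by
  have hff := memLp_fracDiff_family hd hs hfm hGm hf hG
    (happ.mono fun τ h => h.contDiff_of_nonnegTests)
  have hffm := measurable_fracDiff_family s hfm
  set g : ℝ → ℝ := fun t => ∫ x, e (t, x) with hg
  have hgi : Integrable g := he.integral_prod_left
  obtain ⟨good, hgood, hstep⟩ : ∃ good : Set ℝ, (∀ᵐ t, t ∈ good) ∧ ∀ t₁ ∈ good, ∀ t₂ ∈ good,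
      α < t₁ → t₁ ≤ t₂ → t₂ < β → g t₂ - g t₁ +
        ((∫ τ in Ioc t₁ t₂, ∫ x, ⟪F.flux (τ, x), G (t₂, x)⟫) +
        (∫ τ in Ioc t₁ t₂, ∫ p, ⟪F.near (τ, p), fracDiff s (fun x => f (t₂, x)) p⟫) +
        ∫ τ in Ioc t₁ t₂, ∫ x, ⟪F.far (τ, x), f (t₂, x)⟫) ≤ 0 := by
    refine ⟨{t | MemLp (fun x => U (t, x)) 2 volume ∧ MemLp (fun x => f (t, x)) 2 volume ∧
      MemLp (fun x => G (t, x)) 2 volume ∧ Integrable (fun x => e (t, x)) ∧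
      SobApprox (nonnegTests S) (fun x => f (t, x)) (fun x => G (t, x))}, ?_, ?_⟩
    · filter_upwards [ae_memLp_slice hUm hU, ae_memLp_slice hfm hf, ae_memLp_slice hGm hG,
        he.prod_right_ae, happ] with t h1 h2 h3 h4 h5
      exact ⟨h1, h2, h3, h4, h5⟩
    · rintro t₁ ⟨hU1, -, -, he1, -⟩ t₂ ⟨hU2, hf2, hG2, he2, ha2⟩ hα h12 hβ
      have hw := F.weak_inequality_of_sobApprox hd hs hS hU1 hU2
        (hweak t₁ t₂ hα h12 hβ) (by fun_prop) (by fun_prop) hf2 hG2 ha2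
      rw [F.integral_form hf2 hG2 (memLp_fracDiff hd hs (by fun_prop) (by fun_prop)
        ha2.contDiff_of_nonnegTests hf2 hG2)] at hw
      have hle : g t₂ - g t₁ ≤ (∫ x, ⟪U (t₂, x), f (t₂, x)⟫) - ∫ x, ⟪U (t₁, x), f (t₂, x)⟫ := by
        rw [hg, ← integral_sub he2 he1,
          ← integral_sub (hU2.integrable_inner hf2) (hU1.integrable_inner hf2)]
        exact integral_mono (he2.sub he1)
          ((hU2.integrable_inner hf2).sub (hU1.integrable_inner hf2))
          (hconv t₁ t₂ hα h12 hβ)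
      linarith
  have hleb := LocallyIntegrable.ae_hasDerivAt_integral hgi.locallyIntegrable
  refine ⟨{t | HasDerivAt (fun x => ∫ τ in (0 : ℝ)..x, g τ) (g t) t},
    hleb.mono fun t ht => ht 0, fun t₁ ht₁ t₂ ht₂ hα h12 hβ => ?_⟩
  have hgI : ∀ a b, IntervalIntegrable g volume a b := fun a b => hgi.intervalIntegrable
  have hA1 := tendsto_average_backward_pairing_Ioo F.flux_meas.stronglyMeasurable
    hGm.stronglyMeasurable F.flux_memLp hG t₁ t₂
  have hA2 := tendsto_average_backward_pairing_Ioo F.near_meas.stronglyMeasurable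
    hffm.stronglyMeasurable F.near_memLp hff t₁ t₂
  have hA3 := tendsto_average_backward_pairing_Ioo F.far_meas.stronglyMeasurable
    hfm.stronglyMeasurable F.far_memLp hf t₁ t₂
  have hlim := ((tendsto_backward_average ht₂).sub (tendsto_backward_average ht₁)).add
    ((hA1.add hA2).add hA3)
  have hev : ∀ᶠ h in 𝓝[>] (0 : ℝ), h < t₁ - α :=
    nhdsWithin_le_nhds (Iio_mem_nhds (by linarith))
  have hfin := le_of_tendsto hlim (b := 0) (by
    filter_upwards [hev, self_mem_nhdsWithin] with h hh1 (hh0 : 0 < h)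
    have hI1 := (integral_backward_pairing_eq F.flux_meas.stronglyMeasurable
      hGm.stronglyMeasurable F.flux_memLp hG hh0.le).1.integrableOn (s := Ioo t₁ t₂)
    have hI2 := (integral_backward_pairing_eq F.near_meas.stronglyMeasurable
      hffm.stronglyMeasurable F.near_memLp hff hh0.le).1.integrableOn (s := Ioo t₁ t₂)
    have hI3 := (integral_backward_pairing_eq F.far_meas.stronglyMeasurable
      hfm.stronglyMeasurable F.far_memLp hf hh0.le).1.integrableOn (s := Ioo t₁ t₂)
    have hgs : IntegrableOn (fun t => g (t - h)) (Ioo t₁ t₂) := (hgi.comp_sub_right h).integrableOn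
    have hneg : ∫ t in Ioo t₁ t₂, (g t - g (t - h) +
        ((∫ τ in Ioc (t - h) t, ∫ x, ⟪F.flux (τ, x), G (t, x)⟫) +
        (∫ τ in Ioc (t - h) t, ∫ p, ⟪F.near (τ, p), fracDiff s (fun x => f (t, x)) p⟫) +
        ∫ τ in Ioc (t - h) t, ∫ x, ⟪F.far (τ, x), f (t, x)⟫)) ≤ 0 := by
      refine integral_nonpos_of_ae ?_
      have hgood' : ∀ᵐ t : ℝ, t - h ∈ good :=
        (measurePreserving_sub_right volume h).quasiMeasurePreserving.ae hgood
      filter_upwards [ae_restrict_of_ae hgood, ae_restrict_of_ae hgood',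
        ae_restrict_mem measurableSet_Ioo] with t h1 h2 h3
      exact hstep _ h2 _ h1 (by linarith [h3.1]) (by linarith) (by linarith [h3.2])
    have hI12 := hI1.add hI2
    have hI123 := hI12.add hI3
    have hsplit := integral_add (hgi.integrableOn.sub hgs) hI123
    have hsplit1 := integral_add hI12 hI3
    have hsplit2 := integral_add hI1 hI2
    have hsplit3 := integral_sub (hgi.integrableOn (s := Ioo t₁ t₂)) hgs
    have hshift : ∫ t in Ioo t₁ t₂, g (t - h) = (∫ τ in (0 : ℝ)..(t₂ - h), g τ) -
        ∫ τ in (0 : ℝ)..(t₁ - h), g τ := by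
      rw [← integral_Ioc_eq_integral_Ioo, ← intervalIntegral.integral_of_le h12.le,
        intervalIntegral.integral_comp_sub_right, intervalIntegral.integral_interval_sub_left
          (hgI _ _) (hgI _ _)]
    have hnosh : ∫ t in Ioo t₁ t₂, g t = (∫ τ in (0 : ℝ)..t₂, g τ) -
        ∫ τ in (0 : ℝ)..t₁, g τ := by
      rw [← integral_Ioc_eq_integral_Ioo, ← intervalIntegral.integral_of_le h12.le,
        intervalIntegral.integral_interval_sub_left (hgI _ _) (hgI _ _)]
    simp only [Pi.add_apply, Pi.sub_apply] at hsplit hsplit1 hsplit2 hsplit3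
    rw [hsplit, hsplit1, hsplit2, hsplit3, hshift, hnosh] at hneg
    have := mul_nonpos_of_nonneg_of_nonpos (inv_nonneg.2 hh0.le) hneg
    refine le_trans (le_of_eq ?_) this
    ring)
  have hform : ∫ τ in Ioo t₁ t₂, F.form s τ (fun x => f (τ, x)) (fun x => G (τ, x)) =
      (∫ t in Ioo t₁ t₂, ∫ x, ⟪F.flux (t, x), G (t, x)⟫) +
      (∫ t in Ioo t₁ t₂, ∫ p, ⟪F.near (t, p), fracDiff s (fun x => f (t, x)) p⟫) +
      ∫ t in Ioo t₁ t₂, ∫ x, ⟪F.far (t, x), f (t, x)⟫ := by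
    have h1 := ((F.flux_memLp.integrable_inner hG).integral_prod_left).integrableOn (s := Ioo t₁ t₂)
    have h2 := ((F.near_memLp.integrable_inner hff).integral_prod_left).integrableOn (s := Ioo t₁ t₂)
    have h3 := ((F.far_memLp.integrable_inner hf).integral_prod_left).integrableOn (s := Ioo t₁ t₂)
    exact (integral_add (h1.add h2) h3).trans (congrArg (· + _) (integral_add h1 h2))
  rw [hform]
  linarith

/-- The data of a Caccioppoli estimate: a local weak function in `J × Ω`, a time interval
`(α, β)` compactly contained in `J`, and concentric balls of radii `ρ' < ρ < 2ρ` in `Ω`. -/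
structure CylinderSetting (d : ℕ) (s Λ α β ρ' ρ : ℝ) (x₀ : Ed d) (J : Set ℝ) (Ω : Set (Ed d))
    (A : ℝ → Ed d → Ed d → Ed d) (K : ℝ → Ed d → Ed d → ℝ) (v : ℝ → Ed d → ℝ)
    (Dv : ℝ → Ed d → Ed d) : Prop where
  two_le_dim : 2 ≤ d
  order : s ∈ Ioo (0 : ℝ) 1
  one_le : 1 ≤ Λ
  field : VectorFieldHyp d Λ A
  kernel : KernelHyp d s Λ K
  reg : LocalWeakReg d s J Ω v Dv
  time : Icc α β ⊆ J
  ball : closedBall x₀ (2 * ρ) ⊆ Ω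
  radius_pos : 0 < ρ'
  radius_lt : ρ' < ρ

namespace CylinderSetting

variable {s Λ α β ρ' ρ : ℝ} {x₀ : Ed d} {J : Set ℝ} {Ω : Set (Ed d)}
  {A : ℝ → Ed d → Ed d → Ed d} {K : ℝ → Ed d → Ed d → ℝ} {v : ℝ → Ed d → ℝ}
  {Dv : ℝ → Ed d → Ed d}

theorem dim_add_pos (h : CylinderSetting d s Λ α β ρ' ρ x₀ J Ω A K v Dv) :
    0 < (d : ℝ) + 2 * s := by
  have := h.order.1; positivity

theorem radius_pos' (h : CylinderSetting d s Λ α β ρ' ρ x₀ J Ω A K v Dv) : 0 < ρ :=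
  h.radius_pos.trans h.radius_lt

theorem memLp_restrict (h : CylinderSetting d s Λ α β ρ' ρ x₀ J Ω A K v Dv) :
    MemLp (fun p : ℝ × Ed d => v p.1 p.2) 2
        (volume.restrict (Ioo α β ×ˢ closedBall x₀ (2 * ρ))) ∧
      MemLp (fun p : ℝ × Ed d => Dv p.1 p.2) 2
        (volume.restrict (Ioo α β ×ˢ closedBall x₀ (2 * ρ))) := by
  have hv : Measurable fun p : ℝ × Ed d => v p.1 p.2 := h.reg.meas
  have hD : Measurable fun p : ℝ × Ed d => Dv p.1 p.2 := h.reg.measD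
  have hint := h.reg.l2w12 α β h.time _ (isCompact_closedBall x₀ (2 * ρ)) h.ball
  constructor
  · rw [memLp_two_iff_integrable_sq hv.aestronglyMeasurable]
    refine Integrable.mono' hint (by fun_prop) (Eventually.of_forall fun p => ?_)
    simp only [norm_pow, Real.norm_eq_abs, sq_abs]
    exact le_add_of_nonneg_right (sq_nonneg _)
  · rw [← memLp_norm_iff hD.aestronglyMeasurable, memLp_two_iff_integrable_sq (by fun_prop)]
    refine Integrable.mono' hint (by fun_prop) (Eventually.of_forall fun p => ?_)
    simp only [norm_pow, norm_norm]
    exact le_add_of_nonneg_left (sq_nonneg _)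

theorem ae_slice (h : CylinderSetting d s Λ α β ρ' ρ x₀ J Ω A K v Dv) :
    ∀ᵐ τ, τ ∈ Ioo α β →
      MemLp (v τ) 2 (volume.restrict (closedBall x₀ (2 * ρ))) ∧
      MemLp (Dv τ) 2 (volume.restrict (closedBall x₀ (2 * ρ))) ∧
      Integrable (fun y : Ed d => |v τ y| / (1 + ‖y‖ ^ ((d : ℝ) + 2 * s))) := by
  have hS : MeasurableSet (Ioo α β ×ˢ closedBall x₀ (2 * ρ)) :=
    measurableSet_Ioo.prod measurableSet_closedBall
  have h1 := ae_memLp_slice (h.reg.meas.indicator hS)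
    ((memLp_indicator_iff_restrict hS).2 h.memLp_restrict.1)
  have h2 := ae_memLp_slice (h.reg.measD.indicator hS)
    ((memLp_indicator_iff_restrict hS).2 h.memLp_restrict.2)
  filter_upwards [h1, h2, h.reg.tail_ae] with τ h1 h2 h3 hτ
  refine ⟨?_, ?_, h3 (h.time (Ioo_subset_Icc_self hτ))⟩
  · rw [← memLp_indicator_iff_restrict measurableSet_closedBall]
    refine h1.congr_norm ?_ (Eventually.of_forall fun x => ?_)
    · exact ((h.reg.meas.comp measurable_prodMk_left).indicator
        measurableSet_closedBall).aestronglyMeasurable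
    · by_cases hx : x ∈ closedBall x₀ (2 * ρ) <;> simp [indicator, hτ.1, hτ.2, hx]
  · rw [← memLp_indicator_iff_restrict measurableSet_closedBall]
    refine h2.congr_norm ?_ (Eventually.of_forall fun x => ?_)
    · exact ((h.reg.measD.comp measurable_prodMk_left).indicator
        measurableSet_closedBall).aestronglyMeasurable
    · by_cases hx : x ∈ closedBall x₀ (2 * ρ) <;> simp [indicator, hτ.1, hτ.2, hx]

/-- A smooth cutoff function equal to one on the ball of radius `ρ`. -/
def bump (h : CylinderSetting d s Λ α β ρ' ρ x₀ J Ω A K v Dv) : ContDiffBump x₀ :=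
  ⟨ρ, 2 * ρ, h.radius_pos', by linarith [h.radius_pos']⟩

/-- The localized function `χ v`. -/
def locFun (h : CylinderSetting d s Λ α β ρ' ρ x₀ J Ω A K v Dv) (p : ℝ × Ed d) : ℝ :=
  (Ioo α β).indicator (fun τ => h.bump p.2 * v τ p.2) p.1

/-- The gradient of the localized function `χ v`. -/
def locGrad (h : CylinderSetting d s Λ α β ρ' ρ x₀ J Ω A K v Dv) (p : ℝ × Ed d) : Ed d :=
  (Ioo α β).indicator (fun τ => h.bump p.2 • Dv τ p.2 + v τ p.2 • gradient h.bump p.2) p.1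

theorem bump_contDiff (h : CylinderSetting d s Λ α β ρ' ρ x₀ J Ω A K v Dv) :
    ContDiff ℝ (⊤ : ℕ∞) h.bump := h.bump.contDiff

theorem bump_contDiff_one (h : CylinderSetting d s Λ α β ρ' ρ x₀ J Ω A K v Dv) :
    ContDiff ℝ 1 h.bump := h.bump.contDiff

theorem tsupport_bump (h : CylinderSetting d s Λ α β ρ' ρ x₀ J Ω A K v Dv) :
    tsupport h.bump = closedBall x₀ (2 * ρ) := h.bump.tsupport_eq

theorem bump_eq_one (h : CylinderSetting d s Λ α β ρ' ρ x₀ J Ω A K v Dv) {x : Ed d}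
    (hx : x ∈ Metric.ball x₀ ρ) : h.bump x = 1 :=
  h.bump.one_of_mem_closedBall (ball_subset_closedBall hx)

theorem gradient_bump_eq_zero (h : CylinderSetting d s Λ α β ρ' ρ x₀ J Ω A K v Dv) {x : Ed d}
    (hx : x ∈ Metric.ball x₀ ρ) : gradient h.bump x = 0 := by
  have : (h.bump : Ed d → ℝ) =ᶠ[𝓝 x] fun _ => 1 := by
    filter_upwards [isOpen_ball.mem_nhds hx] with y hy using h.bump_eq_one hy
  rw [gradient, this.fderiv_eq]
  simp

theorem measurable_indicator_fst {E : Type*} [MeasurableSpace E] [Zero E] {f : ℝ × Ed d → E}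
    (hf : Measurable f) (a b : ℝ) :
    Measurable fun p : ℝ × Ed d => (Ioo a b).indicator (fun τ => f (τ, p.2)) p.1 := by
  have : (fun p : ℝ × Ed d => (Ioo a b).indicator (fun τ => f (τ, p.2)) p.1) =
      (Prod.fst ⁻¹' Ioo a b).indicator f := by
    ext p; simp [indicator]
  rw [this]
  exact hf.indicator (measurable_fst measurableSet_Ioo)

theorem measurable_locFun (h : CylinderSetting d s Λ α β ρ' ρ x₀ J Ω A K v Dv) :
    Measurable h.locFun := by
  have hv : Measurable fun p : ℝ × Ed d => v p.1 p.2 := h.reg.meas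
  have hb := h.bump.continuous.measurable
  exact measurable_indicator_fst (f := fun p => h.bump p.2 * v p.1 p.2)
    ((hb.comp measurable_snd).mul hv) α β

theorem measurable_locGrad (h : CylinderSetting d s Λ α β ρ' ρ x₀ J Ω A K v Dv) :
    Measurable h.locGrad := by
  have hv : Measurable fun p : ℝ × Ed d => v p.1 p.2 := h.reg.meas
  have hD : Measurable fun p : ℝ × Ed d => Dv p.1 p.2 := h.reg.measD
  have hb := h.bump.continuous.measurable
  have hg := (continuous_gradient h.bump_contDiff_one).measurable
  exact measurable_indicator_fst
    (f := fun p => h.bump p.2 • Dv p.1 p.2 + v p.1 p.2 • gradient h.bump p.2)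
    (((hb.comp measurable_snd).smul hD).add (hv.smul (hg.comp measurable_snd))) α β

theorem memLp_locFun (h : CylinderSetting d s Λ α β ρ' ρ x₀ J Ω A K v Dv) :
    MemLp h.locFun 2 volume := by
  refine MemLp.of_le_mul_of_restrict (M := 1)
    (measurableSet_Ioo.prod measurableSet_closedBall) h.memLp_restrict.1
    h.measurable_locFun.aestronglyMeasurable (fun p hp => ?_) (fun p hp => ?_)
  · simp only [locFun, indicator_of_mem hp.1, norm_mul]
    gcongr
    rw [Real.norm_eq_abs, abs_of_nonneg h.bump.nonneg]
    exact h.bump.le_one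
  · by_cases h1 : p.1 ∈ Ioo α β
    · have h2 : p.2 ∉ tsupport h.bump := by
        rw [h.tsupport_bump]; exact fun h2 => hp ⟨h1, h2⟩
      simp [locFun, image_eq_zero_of_notMem_tsupport h2]
    · simp [locFun, indicator_of_notMem h1]

theorem memLp_locGrad (h : CylinderSetting d s Λ α β ρ' ρ x₀ J Ω A K v Dv) :
    MemLp h.locGrad 2 volume := by
  obtain ⟨M, hM⟩ := exists_bound_gradient h.bump_contDiff_one h.bump.hasCompactSupport
  refine MemLp.of_le_mul_of_restrict (M := 1)
    (measurableSet_Ioo.prod measurableSet_closedBall)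
    (h.memLp_restrict.2.norm.add (h.memLp_restrict.1.norm.mul_const M))
    h.measurable_locGrad.aestronglyMeasurable (fun p hp => ?_) (fun p hp => ?_)
  · simp only [locGrad, indicator_of_mem hp.1, Pi.add_apply]
    refine (norm_add_le _ _).trans ?_
    rw [norm_smul, norm_smul, one_mul, Real.norm_eq_abs (_ + _)]
    refine le_trans ?_ (le_abs_self _)
    refine add_le_add (mul_le_of_le_one_left (norm_nonneg _) ?_)
      (mul_le_mul_of_nonneg_left (hM _) (norm_nonneg _))
    rw [Real.norm_eq_abs, abs_of_nonneg h.bump.nonneg]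
    exact h.bump.le_one
  · by_cases h1 : p.1 ∈ Ioo α β
    · have h2 : p.2 ∉ tsupport h.bump := by
        rw [h.tsupport_bump]; exact fun h2 => hp ⟨h1, h2⟩
      simp [locGrad, image_eq_zero_of_notMem_tsupport h2, gradient_eq_zero_of_notMem_tsupport h2]
    · simp [locGrad, indicator_of_notMem h1]

theorem ae_sobApprox (h : CylinderSetting d s Λ α β ρ' ρ x₀ J Ω A K v Dv) :
    ∀ᵐ τ, SobApprox {φ | ContDiff ℝ (⊤ : ℕ∞) φ} (fun x => h.locFun (τ, x))
      (fun x => h.locGrad (τ, x)) := by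
  filter_upwards [h.ae_slice] with τ hτ
  by_cases h1 : τ ∈ Ioo α β
  · simp only [locFun, locGrad, indicator_of_mem h1]
    obtain ⟨h2, h3, -⟩ := hτ h1
    have hw : IsWeakGradient Ω (v τ) (Dv τ) := h.reg.grad τ (h.time (Ioo_subset_Icc_self h1))
    exact hw.sobApprox_mul (h.reg.meas.comp measurable_prodMk_left)
      (h.reg.measD.comp measurable_prodMk_left) h.bump_contDiff h.bump.hasCompactSupport
      (h.tsupport_bump.le.trans h.ball) (by rwa [h.tsupport_bump]) (by rwa [h.tsupport_bump])
  · simp only [locFun, locGrad, indicator_of_notMem h1]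
    refine ⟨fun _ _ => 0, fun _ => show ContDiff ℝ (⊤ : ℕ∞) _ from contDiff_const, by simp, ?_⟩
    have : gradient (fun _ : Ed d => (0 : ℝ)) = fun _ => 0 := by
      ext x : 1; simp [gradient]
    simp [this]

theorem memLp_fracDiff_locFun (h : CylinderSetting d s Λ α β ρ' ρ x₀ J Ω A K v Dv) :
    MemLp (fun q : ℝ × Ed d × Ed d => fracDiff s (fun x => h.locFun (q.1, x)) q.2) 2 volume :=
  memLp_fracDiff_family h.two_le_dim h.order h.measurable_locFun h.measurable_locGrad
    h.memLp_locFun h.memLp_locGrad (h.ae_sobApprox.mono fun _ hτ =>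
      hτ.mono fun φ (hφ : ContDiff ℝ (⊤ : ℕ∞) φ) =>
        show ContDiff ℝ 1 φ from hφ.of_le (by exact_mod_cast le_top))

end CylinderSetting

/-- The weight of the nonlocal tail space is comparable with the kernel away from the diagonal. -/
theorem one_add_norm_rpow_le {p : ℝ} (hp : 0 < p) {ρ' ρ : ℝ} (hρ : ρ' < ρ) (hρ' : 0 < ρ')
    (x₀ : Ed d) : ∃ c : ℝ, 0 ≤ c ∧ ∀ x ∈ closedBall x₀ ρ', ∀ y ∉ Metric.ball x₀ ρ,
      1 + ‖y‖ ^ p ≤ c * ‖x - y‖ ^ p := by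
  have hδ : 0 < ρ - ρ' := sub_pos.2 hρ
  refine ⟨(ρ - ρ')⁻¹ ^ p + (1 + (‖x₀‖ + ρ') / (ρ - ρ')) ^ p, by positivity, fun x hx y hy => ?_⟩
  have hx' : ‖x - x₀‖ ≤ ρ' := by rwa [mem_closedBall, dist_eq_norm] at hx
  have hy' : ρ ≤ ‖y - x₀‖ := by rwa [mem_ball, dist_eq_norm, not_lt] at hy
  have h1 : ρ - ρ' ≤ ‖x - y‖ := by
    have := norm_sub_le_norm_sub_add_norm_sub y x x₀
    rw [norm_sub_rev y x] at this
    linarith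
  have h2 : ‖y‖ ≤ (1 + (‖x₀‖ + ρ') / (ρ - ρ')) * ‖x - y‖ := by
    have h3 : ‖y‖ ≤ ‖x - y‖ + (‖x₀‖ + ρ') := by
      have e : y = x₀ + (x - x₀) - (x - y) := by abel
      calc ‖y‖ = ‖x₀ + (x - x₀) - (x - y)‖ := by rw [← e]
        _ ≤ ‖x₀‖ + ‖x - x₀‖ + ‖x - y‖ := (norm_sub_le _ _).trans (by gcongr; exact norm_add_le _ _)
        _ ≤ _ := by linarith
    have h4 : ‖x₀‖ + ρ' ≤ (‖x₀‖ + ρ') / (ρ - ρ') * ‖x - y‖ := by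
      rw [div_mul_eq_mul_div, le_div_iff₀ hδ]
      gcongr
    linarith
  rw [add_mul, ← Real.mul_rpow (by positivity) (norm_nonneg _),
    ← Real.mul_rpow (by positivity) (norm_nonneg _)]
  gcongr
  refine Real.one_le_rpow ?_ hp.le
  rw [inv_mul_eq_div, one_le_div hδ]
  exact h1

theorem integrable_inv_one_add_norm_rpow {p : ℝ} (hp : (d : ℝ) < p) :
    Integrable fun y : Ed d => (1 + ‖y‖ ^ p)⁻¹ := by
  have hp0 : 0 < p := (Nat.cast_nonneg d).trans_lt hp
  have h := (integrable_one_add_norm (E := Ed d) (μ := volume) (r := p) (by simpa using hp))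
  refine (h.const_mul (2 ^ p)).mono' ?_ (Eventually.of_forall fun y => ?_)
  · exact Measurable.aestronglyMeasurable (by fun_prop)
  · have hn := norm_nonneg y
    rw [Real.norm_eq_abs, abs_of_nonneg (by positivity), Real.rpow_neg (by positivity),
      ← div_eq_mul_inv, le_div_iff₀ (by positivity), inv_mul_le_iff₀ (by positivity)]
    rcases le_total ‖y‖ 1 with h1 | h1
    · calc (1 + ‖y‖) ^ p ≤ 2 ^ p := by gcongr; linarith
        _ ≤ (1 + ‖y‖ ^ p) * 2 ^ p :=
          le_mul_of_one_le_left (by positivity) (le_add_of_nonneg_right (by positivity))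
    · calc (1 + ‖y‖) ^ p ≤ (2 * ‖y‖) ^ p := by gcongr; linarith
        _ = ‖y‖ ^ p * 2 ^ p := by rw [Real.mul_rpow (by simp) hn, mul_comm]
        _ ≤ (1 + ‖y‖ ^ p) * 2 ^ p := by gcongr; simp

namespace CylinderSetting

variable {s Λ α β ρ' ρ : ℝ} {x₀ : Ed d} {J : Set ℝ} {Ω : Set (Ed d)}
  {A : ℝ → Ed d → Ed d → Ed d} {K : ℝ → Ed d → Ed d → ℝ} {v : ℝ → Ed d → ℝ}
  {Dv : ℝ → Ed d → Ed d}

theorem kernel_nonneg (h : CylinderSetting d s Λ α β ρ' ρ x₀ J Ω A K v Dv) (τ : ℝ) {x y : Ed d}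
    (hxy : x ≠ y) : 0 ≤ K τ x y :=
  le_trans (div_nonneg (inv_nonneg.2 (zero_le_one.trans h.one_le)) (by positivity))
    (h.kernel.lower τ x y hxy)

theorem ne_of_mem_closedBall (h : CylinderSetting d s Λ α β ρ' ρ x₀ J Ω A K v Dv) {x y : Ed d}
    (hx : x ∈ closedBall x₀ ρ') (hy : y ∉ Metric.ball x₀ ρ) : x ≠ y := by
  rintro rfl
  exact hy (closedBall_subset_ball h.radius_lt hx)

theorem exists_kernel_le (h : CylinderSetting d s Λ α β ρ' ρ x₀ J Ω A K v Dv) :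
    ∃ c : ℝ, 0 ≤ c ∧ ∀ τ, ∀ x ∈ closedBall x₀ ρ', ∀ y ∉ Metric.ball x₀ ρ,
      |K τ x y| ≤ c * (1 + ‖y‖ ^ ((d : ℝ) + 2 * s))⁻¹ := by
  obtain ⟨c, hc, hle⟩ := one_add_norm_rpow_le h.dim_add_pos h.radius_lt h.radius_pos x₀
  have hΛ := h.one_le
  refine ⟨Λ * c, by positivity, fun τ x hx y hy => ?_⟩
  have hne := h.ne_of_mem_closedBall hx hy
  have hpos : 0 < ‖x - y‖ ^ ((d : ℝ) + 2 * s) :=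
    Real.rpow_pos_of_pos (norm_pos_iff.2 (sub_ne_zero.2 hne)) _
  rw [abs_of_nonneg (h.kernel_nonneg τ hne)]
  refine (h.kernel.upper τ x y hne).trans ?_
  rw [div_le_iff₀ hpos, mul_assoc, mul_assoc]
  refine le_mul_of_one_le_right (by positivity) ?_
  have h1 : 0 < 1 + ‖y‖ ^ ((d : ℝ) + 2 * s) := by positivity
  rw [mul_left_comm, inv_mul_eq_div, one_le_div h1]
  exact hle x hx y hy

/-- The integrand `(v(x) - v(y)) K(x,y)` of the interaction with the exterior of the ball. -/
def farKernel (_ : CylinderSetting d s Λ α β ρ' ρ x₀ J Ω A K v Dv) (τ : ℝ) (x y : Ed d) : ℝ :=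
  (Metric.ball x₀ ρ)ᶜ.indicator (fun y => (v τ x - v τ y) * K τ x y) y

theorem measurable_farKernel (h : CylinderSetting d s Λ α β ρ' ρ x₀ J Ω A K v Dv) :
    Measurable fun q : (ℝ × Ed d) × Ed d => h.farKernel q.1.1 q.1.2 q.2 := by
  have hv : Measurable fun p : ℝ × Ed d => v p.1 p.2 := h.reg.meas
  have h1 : Measurable fun q : (ℝ × Ed d) × Ed d => v q.1.1 q.1.2 := hv.comp measurable_fst
  have h2 : Measurable fun q : (ℝ × Ed d) × Ed d => v q.1.1 q.2 :=
    hv.comp ((measurable_fst.comp measurable_fst).prodMk measurable_snd)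
  have h3 : Measurable fun q : (ℝ × Ed d) × Ed d => K q.1.1 q.1.2 q.2 :=
    h.kernel.meas.comp ((measurable_fst.comp measurable_fst).prodMk
      ((measurable_snd.comp measurable_fst).prodMk measurable_snd))
  exact ((h1.sub h2).mul h3).indicator (measurable_snd measurableSet_ball.compl)

theorem measurable_farKernel_right (h : CylinderSetting d s Λ α β ρ' ρ x₀ J Ω A K v Dv)
    (τ : ℝ) (x : Ed d) : Measurable (h.farKernel τ x) := by
  have hv : Measurable fun y : Ed d => v τ y := h.reg.meas.comp measurable_prodMk_left
  have hK : Measurable fun y : Ed d => K τ x y := h.kernel.meas.comp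
    (measurable_const.prodMk (measurable_const.prodMk measurable_id))
  exact ((measurable_const.sub hv).mul hK).indicator measurableSet_ball.compl

theorem exists_abs_farKernel_le (h : CylinderSetting d s Λ α β ρ' ρ x₀ J Ω A K v Dv) :
    ∃ c : ℝ, 0 ≤ c ∧ ∀ τ, ∀ x ∈ closedBall x₀ ρ', ∀ y,
      |h.farKernel τ x y| ≤ c * (|v τ x| * (1 + ‖y‖ ^ ((d : ℝ) + 2 * s))⁻¹ +
        |v τ y| / (1 + ‖y‖ ^ ((d : ℝ) + 2 * s))) := by
  obtain ⟨c, hc, hle⟩ := h.exists_kernel_le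
  refine ⟨c, hc, fun τ x hx y => ?_⟩
  by_cases hy : y ∈ (Metric.ball x₀ ρ)ᶜ
  · rw [farKernel, indicator_of_mem hy, abs_mul]
    calc |v τ x - v τ y| * |K τ x y|
        ≤ (|v τ x| + |v τ y|) * (c * (1 + ‖y‖ ^ ((d : ℝ) + 2 * s))⁻¹) := by
          gcongr
          · exact abs_sub _ _
          · exact hle τ x hx y hy
      _ = _ := by rw [div_eq_mul_inv]; ring
  · rw [farKernel, indicator_of_notMem hy, abs_zero]
    positivity

theorem exists_far_bound (h : CylinderSetting d s Λ α β ρ' ρ x₀ J Ω A K v Dv) :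
    ∃ c : ℝ, 0 ≤ c ∧ ∀ᵐ τ, τ ∈ Ioo α β → ∀ x ∈ closedBall x₀ ρ',
      Integrable (h.farKernel τ x) ∧ |∫ y, h.farKernel τ x y| ≤
        c * (|v τ x| + ∫ y, |v τ y| / (1 + ‖y‖ ^ ((d : ℝ) + 2 * s))) := by
  obtain ⟨c, hc, hle⟩ := h.exists_abs_farKernel_le
  have hm : Integrable fun y : Ed d => (1 + ‖y‖ ^ ((d : ℝ) + 2 * s))⁻¹ :=
    integrable_inv_one_add_norm_rpow (by linarith [h.order.1])
  obtain ⟨M, hM⟩ : ∃ M, M = ∫ y : Ed d, (1 + ‖y‖ ^ ((d : ℝ) + 2 * s))⁻¹ := ⟨_, rfl⟩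
  have hM0 : 0 ≤ M := hM ▸ integral_nonneg fun y => by positivity
  refine ⟨c * (M + 1), by positivity, ?_⟩
  refine h.ae_slice.mono fun τ hτ hτJ x hx => ?_
  have h3 := (hτ hτJ).2.2
  have h4 := hm.const_mul |v τ x|
  have hi : Integrable fun y : Ed d => c * (|v τ x| * (1 + ‖y‖ ^ ((d : ℝ) + 2 * s))⁻¹ +
      |v τ y| / (1 + ‖y‖ ^ ((d : ℝ) + 2 * s))) := (h4.add h3).const_mul c
  have hmeas := h.measurable_farKernel_right τ x
  have hb : ∀ᵐ y, ‖h.farKernel τ x y‖ ≤ c * (|v τ x| * (1 + ‖y‖ ^ ((d : ℝ) + 2 * s))⁻¹ +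
      |v τ y| / (1 + ‖y‖ ^ ((d : ℝ) + 2 * s))) := Eventually.of_forall (hle τ x hx)
  refine ⟨hi.mono' hmeas.aestronglyMeasurable hb, ?_⟩
  have h5 := norm_integral_le_of_norm_le hi hb
  rw [integral_const_mul, integral_add h4 h3, integral_const_mul, ← hM] at h5
  have hT : 0 ≤ ∫ y, |v τ y| / (1 + ‖y‖ ^ ((d : ℝ) + 2 * s)) :=
    integral_nonneg fun y => by positivity
  refine h5.trans ?_
  rw [mul_assoc]
  refine mul_le_mul_of_nonneg_left ?_ hc
  nlinarith [mul_nonneg hM0 hT, abs_nonneg (v τ x)]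

/-- The flux field of the local operator in the cylinder. -/
def flux (_ : CylinderSetting d s Λ α β ρ' ρ x₀ J Ω A K v Dv) (p : ℝ × Ed d) : Ed d :=
  (Ioo α β ×ˢ Metric.ball x₀ ρ).indicator (fun p => A p.1 p.2 (Dv p.1 p.2)) p

/-- The interaction field of the nonlocal operator within the ball. -/
def near (_ : CylinderSetting d s Λ α β ρ' ρ x₀ J Ω A K v Dv) (q : ℝ × Ed d × Ed d) : ℝ :=
  (Ioo α β ×ˢ Metric.ball x₀ ρ ×ˢ Metric.ball x₀ ρ).indicator
    (fun q => (v q.1 q.2.1 - v q.1 q.2.2) * K q.1 q.2.1 q.2.2 *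
      ‖q.2.1 - q.2.2‖ ^ ((d : ℝ) / 2 + s)) q

/-- The interaction field of the nonlocal operator with the exterior of the ball. -/
def far (h : CylinderSetting d s Λ α β ρ' ρ x₀ J Ω A K v Dv) (p : ℝ × Ed d) : ℝ :=
  (Ioo α β ×ˢ closedBall x₀ ρ').indicator (fun p => 2 * ∫ y, h.farKernel p.1 p.2 y) p

theorem measurable_flux (h : CylinderSetting d s Λ α β ρ' ρ x₀ J Ω A K v Dv) :
    Measurable h.flux := by
  have h1 := measurable_uncurry_of_continuous_of_measurable
    (u := fun (ξ : Ed d) (p : ℝ × Ed d) => A p.1 p.2 ξ)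
    (fun p => h.field.cont p.1 p.2) h.field.meas
  have h2 : Measurable fun p : ℝ × Ed d => A p.1 p.2 (Dv p.1 p.2) :=
    h1.comp (Measurable.prodMk h.reg.measD measurable_id)
  exact h2.indicator (measurableSet_Ioo.prod measurableSet_ball)

theorem measurable_near (h : CylinderSetting d s Λ α β ρ' ρ x₀ J Ω A K v Dv) :
    Measurable h.near := by
  have hv : Measurable fun p : ℝ × Ed d => v p.1 p.2 := h.reg.meas
  have h1 : Measurable fun q : ℝ × Ed d × Ed d => v q.1 q.2.1 :=
    hv.comp (measurable_fst.prodMk (measurable_fst.comp measurable_snd))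
  have h2 : Measurable fun q : ℝ × Ed d × Ed d => v q.1 q.2.2 :=
    hv.comp (measurable_fst.prodMk (measurable_snd.comp measurable_snd))
  exact (((h1.sub h2).mul h.kernel.meas).mul (by fun_prop)).indicator
    (measurableSet_Ioo.prod (measurableSet_ball.prod measurableSet_ball))

theorem measurable_far (h : CylinderSetting d s Λ α β ρ' ρ x₀ J Ω A K v Dv) :
    Measurable h.far :=
  ((h.measurable_farKernel.stronglyMeasurable.integral_prod_right').measurable.const_mul
    2).indicator (measurableSet_Ioo.prod measurableSet_closedBall)

theorem locFun_eq (h : CylinderSetting d s Λ α β ρ' ρ x₀ J Ω A K v Dv) {τ : ℝ}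
    (hτ : τ ∈ Ioo α β) {x : Ed d} (hx : x ∈ Metric.ball x₀ ρ) : h.locFun (τ, x) = v τ x := by
  simp [locFun, indicator_of_mem hτ, h.bump_eq_one hx]

theorem locGrad_eq (h : CylinderSetting d s Λ α β ρ' ρ x₀ J Ω A K v Dv) {τ : ℝ}
    (hτ : τ ∈ Ioo α β) {x : Ed d} (hx : x ∈ Metric.ball x₀ ρ) : h.locGrad (τ, x) = Dv τ x := by
  simp [locGrad, indicator_of_mem hτ, h.bump_eq_one hx, h.gradient_bump_eq_zero hx]

theorem memLp_flux (h : CylinderSetting d s Λ α β ρ' ρ x₀ J Ω A K v Dv) :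
    MemLp h.flux 2 volume := by
  refine h.memLp_locGrad.of_le_mul h.measurable_flux.aestronglyMeasurable (c := Λ)
    (Eventually.of_forall fun p => ?_)
  by_cases hp : p ∈ Ioo α β ×ˢ Metric.ball x₀ ρ
  · rw [flux, indicator_of_mem hp, show h.locGrad p = Dv p.1 p.2 from h.locGrad_eq hp.1 hp.2]
    exact h.field.growth _ _ _
  · rw [flux, indicator_of_notMem hp, norm_zero]
    exact mul_nonneg (zero_le_one.trans h.one_le) (norm_nonneg _)

theorem memLp_near (h : CylinderSetting d s Λ α β ρ' ρ x₀ J Ω A K v Dv) :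
    MemLp h.near 2 volume := by
  have hΛ : 0 ≤ Λ := zero_le_one.trans h.one_le
  refine h.memLp_fracDiff_locFun.of_le_mul h.measurable_near.aestronglyMeasurable (c := Λ)
    (Eventually.of_forall fun q => ?_)
  by_cases hq : q ∈ Ioo α β ×ˢ Metric.ball x₀ ρ ×ˢ Metric.ball x₀ ρ
  · rw [near, indicator_of_mem hq]
    obtain ⟨hτ, hx, hy⟩ := hq
    rw [fracDiff, h.locFun_eq hτ hx, h.locFun_eq hτ hy]
    by_cases hne : q.2.1 = q.2.2
    · simp [hne]
    · have hpos : 0 < ‖q.2.1 - q.2.2‖ := norm_pos_iff.2 (sub_ne_zero.2 hne)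
      rw [norm_mul, norm_mul, norm_mul, Real.norm_of_nonneg (h.kernel_nonneg q.1 hne),
        Real.norm_of_nonneg (Real.rpow_nonneg hpos.le _),
        Real.norm_of_nonneg (Real.rpow_nonneg hpos.le _), mul_assoc, mul_left_comm Λ]
      refine mul_le_mul_of_nonneg_left ?_ (norm_nonneg _)
      calc K q.1 q.2.1 q.2.2 * ‖q.2.1 - q.2.2‖ ^ ((d : ℝ) / 2 + s)
          ≤ Λ / ‖q.2.1 - q.2.2‖ ^ ((d : ℝ) + 2 * s) * ‖q.2.1 - q.2.2‖ ^ ((d : ℝ) / 2 + s) := by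
            gcongr
            exact h.kernel.upper _ _ _ hne
        _ = Λ * ‖q.2.1 - q.2.2‖ ^ (-((d : ℝ) / 2 + s)) := by
            rw [div_eq_mul_inv, ← Real.rpow_neg hpos.le, mul_assoc, ← Real.rpow_add hpos]
            congr 2; ring
  · rw [near, indicator_of_notMem hq, norm_zero]
    positivity

theorem memLp_far (h : CylinderSetting d s Λ α β ρ' ρ x₀ J Ω A K v Dv) :
    MemLp h.far 2 volume := by
  obtain ⟨c, hc, hle⟩ := h.exists_far_bound
  set t : ℝ → ℝ := fun τ => ∫ y, |v τ y| / (1 + ‖y‖ ^ ((d : ℝ) + 2 * s)) with ht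
  have ht0 : ∀ τ, 0 ≤ t τ := fun τ => integral_nonneg fun y => by positivity
  have hv : Measurable fun p : ℝ × Ed d => v p.1 p.2 := h.reg.meas
  have htm : Measurable t := by
    have h1 : Measurable fun p : ℝ × Ed d => |v p.1 p.2| / (1 + ‖p.2‖ ^ ((d : ℝ) + 2 * s)) := by
      fun_prop
    exact h1.stronglyMeasurable.integral_prod_right'.measurable
  set S := Ioo α β ×ˢ closedBall x₀ ρ' with hSdef
  have hS : MeasurableSet S := measurableSet_Ioo.prod measurableSet_closedBall
  have hT : MemLp (S.indicator fun p : ℝ × Ed d => t p.1) 2 volume := by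
    have hm : Measurable (S.indicator fun p : ℝ × Ed d => t p.1) :=
      (htm.comp measurable_fst).indicator hS
    rw [memLp_two_iff_integrable_sq hm.aestronglyMeasurable]
    have h1 := (h.reg.tail_l2 α β h.time).integrable_indicator measurableSet_Ioo
    have h2 : Integrable ((closedBall x₀ ρ').indicator fun _ : Ed d => (1 : ℝ)) :=
      (integrable_indicator_iff measurableSet_closedBall).2
        (integrableOn_const (hs := measure_closedBall_lt_top.ne))
    refine (h1.mul_prod h2).congr (Eventually.of_forall fun p => ?_)
    by_cases h1 : p.1 ∈ Ioo α β <;> by_cases h2 : p.2 ∈ closedBall x₀ ρ' <;>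
      simp only [indicator, S, mem_prod, h1, h2, ht] <;> simp
  have hV : MemLp (fun p => |h.locFun p|) 2 volume := h.memLp_locFun.norm
  refine (hV.add hT).of_le_mul h.measurable_far.aestronglyMeasurable (c := 2 * c) ?_
  have hle' : ∀ᵐ p : ℝ × Ed d, p.1 ∈ Ioo α β → ∀ x ∈ closedBall x₀ ρ',
      Integrable (h.farKernel p.1 x) ∧ |∫ y, h.farKernel p.1 x y| ≤ c * (|v p.1 x| + t p.1) :=
    Measure.quasiMeasurePreserving_fst.ae hle
  filter_upwards [hle'] with p hp
  by_cases hpS : p ∈ S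
  · have h1 : h.locFun p = v p.1 p.2 :=
      h.locFun_eq hpS.1 (closedBall_subset_ball h.radius_lt hpS.2)
    have h2 := (hp hpS.1 p.2 hpS.2).2
    have h3 := ht0 p.1
    rw [far, indicator_of_mem hpS, Pi.add_apply, indicator_of_mem hpS, h1, norm_mul,
      Real.norm_eq_abs, Real.norm_eq_abs, Real.norm_eq_abs, abs_of_nonneg (a := |v p.1 p.2| + _)
      (by positivity), abs_of_pos two_pos, mul_assoc]
    gcongr
  · rw [far, indicator_of_notMem hpS, norm_zero]
    positivity

/-- The square integrable fields representing the equation in the cylinder. -/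
def fields (h : CylinderSetting d s Λ α β ρ' ρ x₀ J Ω A K v Dv) : FormFields d where
  flux := h.flux
  near := h.near
  far := h.far
  flux_meas := h.measurable_flux
  near_meas := h.measurable_near
  far_meas := h.measurable_far
  flux_memLp := h.memLp_flux
  near_memLp := h.memLp_near
  far_memLp := h.memLp_far

end CylinderSetting

namespace CylinderSetting

variable {s Λ α β ρ' ρ : ℝ} {x₀ : Ed d} {J : Set ℝ} {Ω : Set (Ed d)}
  {A : ℝ → Ed d → Ed d → Ed d} {K : ℝ → Ed d → Ed d → ℝ} {v : ℝ → Ed d → ℝ}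
  {Dv : ℝ → Ed d → Ed d}

theorem near_mul_fracDiff (h : CylinderSetting d s Λ α β ρ' ρ x₀ J Ω A K v Dv) {τ : ℝ}
    (hτ : τ ∈ Ioo α β) {φ : Ed d → ℝ} {x y : Ed d} (hx : x ∈ Metric.ball x₀ ρ)
    (hy : y ∈ Metric.ball x₀ ρ) :
    h.near (τ, x, y) * fracDiff s φ (x, y) = (v τ x - v τ y) * (φ x - φ y) * K τ x y := by
  have hm : (τ, x, y) ∈ Ioo α β ×ˢ Metric.ball x₀ ρ ×ˢ Metric.ball x₀ ρ := ⟨hτ, hx, hy⟩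
  rw [near, indicator_of_mem hm, fracDiff]
  by_cases hne : x = y
  · simp [hne]
  · have hpos : 0 < ‖x - y‖ := norm_pos_iff.2 (sub_ne_zero.2 hne)
    have h1 : ‖x - y‖ ^ ((d : ℝ) / 2 + s) * ‖x - y‖ ^ (-((d : ℝ) / 2 + s)) = 1 := by
      rw [← Real.rpow_add hpos]; simp
    linear_combination ((v τ x - v τ y) * (φ x - φ y) * K τ x y) * h1

theorem near_eq_zero (h : CylinderSetting d s Λ α β ρ' ρ x₀ J Ω A K v Dv) {τ : ℝ} {x y : Ed d}
    (hxy : ¬(x ∈ Metric.ball x₀ ρ ∧ y ∈ Metric.ball x₀ ρ)) : h.near (τ, x, y) = 0 :=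
  indicator_of_notMem (fun hm => hxy hm.2) _

theorem nonlocal_integrand_eq (h : CylinderSetting d s Λ α β ρ' ρ x₀ J Ω A K v Dv) {τ : ℝ}
    (hτ : τ ∈ Ioo α β) {φ : Ed d → ℝ} (hφ0 : ∀ x ∉ closedBall x₀ ρ', φ x = 0) (p : Ed d × Ed d) :
    (v τ p.1 - v τ p.2) * (φ p.1 - φ p.2) * K τ p.1 p.2 =
      h.near (τ, p) * fracDiff s φ p + h.farKernel τ p.1 p.2 * φ p.1 +
        h.farKernel τ p.2 p.1 * φ p.2 := by
  obtain ⟨x, y⟩ := p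
  have hφ : ∀ x ∉ Metric.ball x₀ ρ, φ x = 0 := fun x hx =>
    hφ0 x fun h' => hx (closedBall_subset_ball h.radius_lt h')
  by_cases hx : x ∈ Metric.ball x₀ ρ <;> by_cases hy : y ∈ Metric.ball x₀ ρ
  · simp [h.near_mul_fracDiff hτ hx hy, farKernel, hx, hy]
  · simp only [h.near_eq_zero (fun h' => hy h'.2), farKernel, hφ y hy,
      indicator_of_mem (show y ∈ (Metric.ball x₀ ρ)ᶜ from hy)]
    ring
  · simp only [h.near_eq_zero (fun h' => hx h'.1), farKernel, hφ x hx,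
      indicator_of_mem (show x ∈ (Metric.ball x₀ ρ)ᶜ from hx), h.kernel.symm τ x y]
    ring
  · simp [h.near_eq_zero (fun h' => hx h'.1), hφ x hx, hφ y hy]

theorem integrable_farKernel_mul (h : CylinderSetting d s Λ α β ρ' ρ x₀ J Ω A K v Dv) :
    ∀ᵐ τ, τ ∈ Ioo α β → ∀ φ : Ed d → ℝ, Measurable φ → MemLp φ 2 volume → Integrable φ →
      (∀ x ∉ closedBall x₀ ρ', φ x = 0) →
      Integrable fun p : Ed d × Ed d => h.farKernel τ p.1 p.2 * φ p.1 := by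
  obtain ⟨c, hc, hle⟩ := h.exists_abs_farKernel_le
  have hm : Integrable fun y : Ed d => (1 + ‖y‖ ^ ((d : ℝ) + 2 * s))⁻¹ :=
    integrable_inv_one_add_norm_rpow (by linarith [h.order.1])
  filter_upwards [h.ae_slice, ae_memLp_slice h.measurable_locFun h.memLp_locFun]
    with τ hτ hL hτJ φ hφm hφ2 hφi hφ0
  have h3 := (hτ hτJ).2.2
  have hLφ : Integrable fun x => |φ x| * |h.locFun (τ, x)| := by
    simpa using hL.norm.integrable_inner hφ2.norm
  have hφa : Integrable fun x => |φ x| := hφi.abs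
  have hb := ((hLφ.mul_prod hm).add (hφa.mul_prod h3)).const_mul c
  have hmeas : Measurable fun p : Ed d × Ed d => h.farKernel τ p.1 p.2 := by
    have hv : Measurable fun p : ℝ × Ed d => v p.1 p.2 := h.reg.meas
    have h1 : Measurable (v τ) := hv.comp measurable_prodMk_left
    have hK : Measurable fun p : Ed d × Ed d => K τ p.1 p.2 :=
      h.kernel.meas.comp measurable_prodMk_left
    exact (((h1.comp measurable_fst).sub (h1.comp measurable_snd)).mul hK).indicator
      (measurable_snd measurableSet_ball.compl)
  refine hb.mono' (hmeas.mul (hφm.comp measurable_fst)).aestronglyMeasurable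
    (Eventually.of_forall fun p => ?_)
  simp only [Pi.add_apply]
  by_cases hx : p.1 ∈ closedBall x₀ ρ'
  · rw [h.locFun_eq hτJ (closedBall_subset_ball h.radius_lt hx), norm_mul, Real.norm_eq_abs,
      Real.norm_eq_abs]
    calc _ ≤ _ * |φ p.1| := mul_le_mul_of_nonneg_right (hle τ p.1 hx p.2) (abs_nonneg _)
      _ = _ := by ring
  · rw [hφ0 _ hx, mul_zero, norm_zero]
    positivity

theorem nonlocal_form_eq (h : CylinderSetting d s Λ α β ρ' ρ x₀ J Ω A K v Dv) :
    ∀ᵐ τ, τ ∈ Ioo α β → ∀ φ : Ed d → ℝ, Measurable φ → MemLp φ 2 volume → Integrable φ →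
      MemLp (fracDiff s φ) 2 volume → (∀ x ∉ closedBall x₀ ρ', φ x = 0) →
      ∫ x, ∫ y, (v τ x - v τ y) * (φ x - φ y) * K τ x y =
        (∫ p, ⟪h.near (τ, p), fracDiff s φ p⟫) + ∫ x, ⟪h.far (τ, x), φ x⟫ := by
  filter_upwards [h.integrable_farKernel_mul, ae_memLp_slice h.measurable_near h.memLp_near]
    with τ hτ hN hτJ φ hφm hφ2 hφi hφf hφ0
  have hg := hτ hτJ φ hφm hφ2 hφi hφ0
  have hn : Integrable fun p : Ed d × Ed d => h.near (τ, p) * fracDiff s φ p := by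
    simpa [mul_comm] using hN.integrable_inner hφf
  have hgs : Integrable fun p : Ed d × Ed d => h.farKernel τ p.2 p.1 * φ p.2 := hg.swap
  have hΦ : (fun p : Ed d × Ed d => (v τ p.1 - v τ p.2) * (φ p.1 - φ p.2) * K τ p.1 p.2) =
      fun p => h.near (τ, p) * fracDiff s φ p + h.farKernel τ p.1 p.2 * φ p.1 +
        h.farKernel τ p.2 p.1 * φ p.2 := funext (h.nonlocal_integrand_eq hτJ hφ0)
  have hng : Integrable fun p : Ed d × Ed d => h.near (τ, p) * fracDiff s φ p +
      h.farKernel τ p.1 p.2 * φ p.1 := hn.add hg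
  have hΦi : Integrable fun p : Ed d × Ed d =>
      (v τ p.1 - v τ p.2) * (φ p.1 - φ p.2) * K τ p.1 p.2 := by
    rw [hΦ]; exact hng.add hgs
  have hswap : ∫ p : Ed d × Ed d, h.farKernel τ p.2 p.1 * φ p.2 =
      ∫ p : Ed d × Ed d, h.farKernel τ p.1 p.2 * φ p.1 :=
    integral_prod_swap (fun p : Ed d × Ed d => h.farKernel τ p.1 p.2 * φ p.1)
  have hgx : ∫ p : Ed d × Ed d, h.farKernel τ p.1 p.2 * φ p.1 =
      ∫ x, (∫ y, h.farKernel τ x y) * φ x := by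
    rw [Measure.volume_eq_prod, integral_prod _ hg]
    simp only [integral_mul_const]
  have hfar : ∫ x, ⟪h.far (τ, x), φ x⟫ = 2 * ∫ x, (∫ y, h.farKernel τ x y) * φ x := by
    rw [← integral_const_mul]
    refine integral_congr_ae (Eventually.of_forall fun x => ?_)
    by_cases hx : x ∈ closedBall x₀ ρ'
    · have hm : (τ, x) ∈ Ioo α β ×ˢ closedBall x₀ ρ' := ⟨hτJ, hx⟩
      simp only [far, indicator_of_mem hm, RCLike.inner_apply,
        conj_trivial]
      ring
    · simp [hφ0 x hx]
  calc ∫ x, ∫ y, (v τ x - v τ y) * (φ x - φ y) * K τ x y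
      = ∫ p : Ed d × Ed d, (v τ p.1 - v τ p.2) * (φ p.1 - φ p.2) * K τ p.1 p.2 := by
        rw [Measure.volume_eq_prod, integral_prod _ hΦi]
    _ = (∫ p, h.near (τ, p) * fracDiff s φ p) + 2 * ∫ x, (∫ y, h.farKernel τ x y) * φ x := by
        rw [hΦ, integral_add hng hgs, integral_add hn hg, hswap, hgx]
        ring
    _ = _ := by
        rw [hfar]
        simp [mul_comm]

theorem ball_subset (h : CylinderSetting d s Λ α β ρ' ρ x₀ J Ω A K v Dv) :
    Metric.ball x₀ ρ ⊆ Ω :=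
  (ball_subset_closedBall.trans (closedBall_subset_closedBall (by linarith [h.radius_pos']))).trans
    h.ball

theorem weak_inequality (h : CylinderSetting d s Λ α β ρ' ρ x₀ J Ω A K v Dv)
    (hsub : IsLocalWeakSubsolutionHom A K J Ω v Dv) (t₁ t₂ : ℝ) (h1 : α < t₁) (h12 : t₁ ≤ t₂)
    (h2 : t₂ < β) (φ : Ed d → ℝ) (hφ : φ ∈ nonnegTests (closedBall x₀ ρ')) :
    (∫ x, ⟪h.locFun (t₂, x), φ x⟫) - (∫ x, ⟪h.locFun (t₁, x), φ x⟫) +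
      ∫ τ in Ioc t₁ t₂, h.fields.form s τ φ (gradient φ) ≤ 0 := by
  obtain ⟨hφs, hφ0, hφS⟩ := hφ
  have hSΩ : closedBall x₀ ρ' ⊆ Ω := (closedBall_subset_ball h.radius_lt).trans h.ball_subset
  have hts : IsTestFunction Ω (fun _ : ℝ => φ) :=
    ⟨hφs.comp contDiff_snd, closedBall x₀ ρ', isCompact_closedBall _ _, hSΩ, fun _ => hφS⟩
  have hw := hsub t₁ t₂ h12 ((Icc_subset_Icc h1.le h2.le).trans h.time) _ hts fun _ => hφ0
  have hφ1 : ContDiff ℝ 1 φ := hφs.of_le (by exact_mod_cast le_top)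
  have hz : ∀ x ∉ closedBall x₀ ρ', φ x = 0 := fun x hx =>
    image_eq_zero_of_notMem_tsupport fun h' => hx (hφS h')
  have hgz : ∀ x ∉ closedBall x₀ ρ', gradient φ x = 0 := fun x hx =>
    gradient_eq_zero_of_notMem_tsupport fun h' => hx (hφS h')
  obtain ⟨hφ2, hg2⟩ := memLp_of_mem_nonnegTests (isCompact_closedBall x₀ ρ') ⟨hφs, hφ0, hφS⟩
  have hφm : Measurable φ := hφs.continuous.measurable
  have hφf : MemLp (fracDiff s φ) 2 volume := memLp_fracDiff h.two_le_dim h.order hφm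
    (continuous_gradient hφ1).measurable (sobApprox_self hφ1) hφ2 hg2
  have hφi : Integrable φ := hφs.continuous.integrable_of_hasCompactSupport
    ((isCompact_closedBall x₀ ρ').of_isClosed_subset (isClosed_tsupport _) hφS)
  have hv : ∀ t ∈ Ioo α β, ∫ x in Ω, v t x * φ x = ∫ x, ⟪h.locFun (t, x), φ x⟫ := by
    intro t ht
    rw [setIntegral_eq_integral_of_forall_compl_eq_zero fun x hx => by
      rw [hz x fun h' => hx (hSΩ h'), mul_zero]]
    refine integral_congr_ae (Eventually.of_forall fun x => ?_)
    by_cases hx : x ∈ closedBall x₀ ρ'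
    · simp [h.locFun_eq ht (closedBall_subset_ball h.radius_lt hx), mul_comm]
    · simp [hz x hx]
  have hA : ∀ t ∈ Ioo α β, ∫ x in Ω, ⟪A t x (Dv t x), gradient φ x⟫ =
      ∫ x, ⟪h.flux (t, x), gradient φ x⟫ := by
    intro t ht
    rw [setIntegral_eq_integral_of_forall_compl_eq_zero fun x hx => by
      rw [hgz x fun h' => hx (hSΩ h'), inner_zero_right]]
    refine integral_congr_ae (Eventually.of_forall fun x => ?_)
    by_cases hx : x ∈ closedBall x₀ ρ'
    · have hm : (t, x) ∈ Ioo α β ×ˢ Metric.ball x₀ ρ :=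
        ⟨ht, closedBall_subset_ball h.radius_lt hx⟩
      simp only [flux, indicator_of_mem hm]
    · simp [hgz x hx]
  have hsubI : Ioc t₁ t₂ ⊆ Ioo α β := fun t ht => ⟨h1.trans ht.1, ht.2.trans_lt h2⟩
  have e1 : ∫ τ in Ioc t₁ t₂, ∫ x in Ω, ⟪A τ x (Dv τ x), gradient φ x⟫ =
      ∫ τ in Ioc t₁ t₂, ∫ x, ⟪h.flux (τ, x), gradient φ x⟫ :=
    setIntegral_congr_fun measurableSet_Ioc fun τ hτ => hA τ (hsubI hτ)
  have e2 : ∫ τ in Ioc t₁ t₂, ∫ x, ∫ y, (v τ x - v τ y) * (φ x - φ y) * K τ x y =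
      ∫ τ in Ioc t₁ t₂, ((∫ p, ⟪h.near (τ, p), fracDiff s φ p⟫) +
        ∫ x, ⟪h.far (τ, x), φ x⟫) := by
    refine setIntegral_congr_ae measurableSet_Ioc ?_
    filter_upwards [h.nonlocal_form_eq] with τ hτ hτ'
    exact hτ (hsubI hτ') φ hφm hφ2 hφi hφf hz
  have e3 : ∫ τ in Ioc t₁ t₂, ((∫ p, ⟪h.near (τ, p), fracDiff s φ p⟫) +
      ∫ x, ⟪h.far (τ, x), φ x⟫) =
      (∫ τ in Ioc t₁ t₂, ∫ p, ⟪h.near (τ, p), fracDiff s φ p⟫) +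
        ∫ τ in Ioc t₁ t₂, ∫ x, ⟪h.far (τ, x), φ x⟫ :=
    integral_add (integrable_pairing_const h.memLp_near hφf t₁ t₂)
      (integrable_pairing_const h.memLp_far hφ2 t₁ t₂)
  have e4 := h.fields.integral_form hφ2 hg2 hφf t₁ t₂
  have hd0 : ∀ (t : ℝ) (x : Ed d), deriv (fun _ : ℝ => φ x) t = 0 := fun t x => deriv_const _ _
  simp only [mixedLHS, hd0, mul_zero, integral_zero, neg_zero, zero_add] at hw
  rw [hv t₁ ⟨h1, h12.trans_lt h2⟩, hv t₂ ⟨h1.trans_le h12, h2⟩, e1, e2, e3] at hw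
  rw [e4]
  have e5 : h.fields.flux = h.flux := rfl
  have e6 : h.fields.near = h.near := rfl
  have e7 : h.fields.far = h.far := rfl
  rw [e5, e6, e7]
  linarith

end CylinderSetting

/-- A smooth cutoff function with values in `[0, 1]` supported in `S`. -/
structure IsCutoff (S : Set (Ed d)) (η : Ed d → ℝ) : Prop where
  smooth : ContDiff ℝ (⊤ : ℕ∞) η
  nonneg : ∀ x, 0 ≤ η x
  le_one : ∀ x, η x ≤ 1
  support : tsupport η ⊆ S

namespace IsCutoff

variable {S : Set (Ed d)} {η : Ed d → ℝ}

theorem eq_zero (hη : IsCutoff S η) {x : Ed d} (hx : x ∉ S) : η x = 0 :=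
  image_eq_zero_of_notMem_tsupport fun h' => hx (hη.support h')

theorem contDiff_one (hη : IsCutoff S η) : ContDiff ℝ 1 η :=
  hη.smooth.of_le (by exact_mod_cast le_top)

theorem hasCompactSupport (hη : IsCutoff S η) (hS : IsCompact S) : HasCompactSupport η :=
  hS.of_isClosed_subset (isClosed_tsupport _) hη.support

theorem abs_le_one (hη : IsCutoff S η) (x : Ed d) : |η x| ≤ 1 := by
  rw [abs_of_nonneg (hη.nonneg x)]; exact hη.le_one x

theorem sq_le_one (hη : IsCutoff S η) (x : Ed d) : η x ^ 2 ≤ 1 :=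
  pow_le_one₀ (hη.nonneg x) (hη.le_one x)

end IsCutoff

theorem abs_max_sub_le (a l : ℝ) : |max (a - l) 0| ≤ |a| + |l| := by
  rw [abs_of_nonneg (le_max_right _ _)]
  exact max_le ((le_abs_self _).trans (abs_sub a l)) (by positivity)

theorem half_sq_max_sub_le (a b l : ℝ) :
    2⁻¹ * max (b - l) 0 ^ 2 - 2⁻¹ * max (a - l) 0 ^ 2 ≤ (b - a) * max (b - l) 0 := by
  rcases le_total (b - l) 0 with hb | hb
  · rw [max_eq_right hb]; nlinarith [sq_nonneg (max (a - l) 0)]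
  · rw [max_eq_left hb]
    rcases le_total (a - l) 0 with ha | ha
    · rw [max_eq_right ha]; nlinarith
    · rw [max_eq_left ha]; nlinarith [sq_nonneg (b - a)]

namespace CylinderSetting

variable {s Λ α β ρ' ρ : ℝ} {x₀ : Ed d} {J : Set ℝ} {Ω : Set (Ed d)}
  {A : ℝ → Ed d → Ed d → Ed d} {K : ℝ → Ed d → Ed d → ℝ} {v : ℝ → Ed d → ℝ}
  {Dv : ℝ → Ed d → Ed d} {η : Ed d → ℝ}

/-- The localized truncation `η² (v - l)₊`. -/
def truncFun (_ : CylinderSetting d s Λ α β ρ' ρ x₀ J Ω A K v Dv) (η : Ed d → ℝ) (l : ℝ)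
    (p : ℝ × Ed d) : ℝ :=
  (Ioo α β).indicator (fun τ => η p.2 ^ 2 * max (v τ p.2 - l) 0) p.1

/-- The gradient of the localized truncation `η² (v - l)₊`. -/
def truncGrad (_ : CylinderSetting d s Λ α β ρ' ρ x₀ J Ω A K v Dv) (η : Ed d → ℝ) (l : ℝ)
    (p : ℝ × Ed d) : Ed d :=
  (Ioo α β).indicator (fun τ => η p.2 ^ 2 • truncGradPos v Dv l τ p.2 +
    (2 * η p.2 * max (v τ p.2 - l) 0) • gradient η p.2) p.1

/-- The energy density `η² (v - l)₊² / 2`. -/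
def truncEnergy (_ : CylinderSetting d s Λ α β ρ' ρ x₀ J Ω A K v Dv) (η : Ed d → ℝ) (l : ℝ)
    (p : ℝ × Ed d) : ℝ :=
  (Ioo α β).indicator (fun τ => 2⁻¹ * (η p.2 * max (v τ p.2 - l) 0) ^ 2) p.1

/-- The form of the equation tested with `η² (v - l)₊`. -/
def truncForm (h : CylinderSetting d s Λ α β ρ' ρ x₀ J Ω A K v Dv) (η : Ed d → ℝ) (l τ : ℝ) : ℝ :=
  h.fields.form s τ (fun x => h.truncFun η l (τ, x)) (fun x => h.truncGrad η l (τ, x))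

theorem measurable_truncGradPos (h : CylinderSetting d s Λ α β ρ' ρ x₀ J Ω A K v Dv) (l : ℝ) :
    Measurable fun p : ℝ × Ed d => truncGradPos v Dv l p.1 p.2 := by
  have hv : Measurable fun p : ℝ × Ed d => v p.1 p.2 := h.reg.meas
  have hD : Measurable fun p : ℝ × Ed d => Dv p.1 p.2 := h.reg.measD
  exact Measurable.ite (measurableSet_lt measurable_const hv) hD measurable_const

theorem measurable_truncFun (h : CylinderSetting d s Λ α β ρ' ρ x₀ J Ω A K v Dv)
    (hη : IsCutoff (closedBall x₀ ρ') η) (l : ℝ) : Measurable (h.truncFun η l) := by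
  have hv : Measurable fun p : ℝ × Ed d => v p.1 p.2 := h.reg.meas
  have hm : Measurable fun p : ℝ × Ed d => η p.2 :=
    hη.smooth.continuous.measurable.comp measurable_snd
  exact measurable_indicator_fst (f := fun p => η p.2 ^ 2 * max (v p.1 p.2 - l) 0)
    ((hm.pow_const 2).mul ((hv.sub_const l).max measurable_const)) α β

theorem measurable_truncGrad (h : CylinderSetting d s Λ α β ρ' ρ x₀ J Ω A K v Dv)
    (hη : IsCutoff (closedBall x₀ ρ') η) (l : ℝ) : Measurable (h.truncGrad η l) := by
  have hv : Measurable fun p : ℝ × Ed d => v p.1 p.2 := h.reg.meas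
  have hm : Measurable fun p : ℝ × Ed d => η p.2 :=
    hη.smooth.continuous.measurable.comp measurable_snd
  have hg : Measurable fun p : ℝ × Ed d => gradient η p.2 :=
    (continuous_gradient hη.contDiff_one).measurable.comp measurable_snd
  exact measurable_indicator_fst (f := fun p => η p.2 ^ 2 • truncGradPos v Dv l p.1 p.2 +
      (2 * η p.2 * max (v p.1 p.2 - l) 0) • gradient η p.2)
    (((hm.pow_const 2).smul (h.measurable_truncGradPos l)).add
      (((hm.const_mul 2).mul ((hv.sub_const l).max measurable_const)).smul hg)) α β

theorem memLp_abs_add_const (h : CylinderSetting d s Λ α β ρ' ρ x₀ J Ω A K v Dv) (l : ℝ) :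
    MemLp (fun p : ℝ × Ed d => |v p.1 p.2| + |l|) 2
      (volume.restrict (Ioo α β ×ˢ closedBall x₀ (2 * ρ))) := by
  have : IsFiniteMeasure ((volume : Measure (ℝ × Ed d)).restrict
      (Ioo α β ×ˢ closedBall x₀ (2 * ρ))) := by
    rw [Measure.volume_eq_prod, ← Measure.prod_restrict]
    have : IsFiniteMeasure ((volume : Measure (Ed d)).restrict (closedBall x₀ (2 * ρ))) :=
      isFiniteMeasure_restrict.2 measure_closedBall_lt_top.ne
    infer_instance
  exact h.memLp_restrict.1.norm.add (memLp_const _)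

theorem closedBall_subset (h : CylinderSetting d s Λ α β ρ' ρ x₀ J Ω A K v Dv) :
    closedBall x₀ ρ' ⊆ closedBall x₀ (2 * ρ) :=
  closedBall_subset_closedBall (by linarith [h.radius_pos', h.radius_lt])

theorem memLp_truncFun (h : CylinderSetting d s Λ α β ρ' ρ x₀ J Ω A K v Dv)
    (hη : IsCutoff (closedBall x₀ ρ') η) (l : ℝ) : MemLp (h.truncFun η l) 2 volume := by
  refine (h.memLp_abs_add_const l).of_le_mul_of_restrict (M := 1)
    (measurableSet_Ioo.prod measurableSet_closedBall)
    (h.measurable_truncFun hη l).aestronglyMeasurable (fun p hp => ?_) (fun p hp => ?_)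
  · rw [truncFun, indicator_of_mem hp.1, one_mul, Real.norm_eq_abs, Real.norm_eq_abs, abs_mul,
      abs_of_nonneg (sq_nonneg (η p.2))]
    exact ((mul_le_of_le_one_left (abs_nonneg _) (hη.sq_le_one _)).trans
      (abs_max_sub_le _ _)).trans (le_abs_self _)
  · by_cases h1 : p.1 ∈ Ioo α β
    · have h2 : p.2 ∉ closedBall x₀ ρ' := fun h2 => hp ⟨h1, h.closedBall_subset h2⟩
      simp [truncFun, hη.eq_zero h2]
    · simp [truncFun, indicator_of_notMem h1]

theorem norm_truncGradPos_le (v : ℝ → Ed d → ℝ) (Dv : ℝ → Ed d → Ed d) (l τ : ℝ) (x : Ed d) :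
    ‖truncGradPos v Dv l τ x‖ ≤ ‖Dv τ x‖ := by
  unfold truncGradPos; split_ifs <;> simp

theorem memLp_truncGrad (h : CylinderSetting d s Λ α β ρ' ρ x₀ J Ω A K v Dv)
    (hη : IsCutoff (closedBall x₀ ρ') η) (l : ℝ) : MemLp (h.truncGrad η l) 2 volume := by
  obtain ⟨M, hM⟩ := exists_bound_gradient hη.contDiff_one
    (hη.hasCompactSupport (isCompact_closedBall _ _))
  refine (h.memLp_restrict.2.norm.add
    ((h.memLp_abs_add_const l).mul_const (2 * M))).of_le_mul_of_restrict (M := 1)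
    (measurableSet_Ioo.prod measurableSet_closedBall)
    (h.measurable_truncGrad hη l).aestronglyMeasurable (fun p hp => ?_) (fun p hp => ?_)
  · simp only [truncGrad, indicator_of_mem hp.1, Pi.add_apply]
    refine (norm_add_le _ _).trans ?_
    rw [norm_smul, norm_smul, one_mul, Real.norm_eq_abs (_ + _)]
    refine le_trans ?_ (le_abs_self _)
    refine add_le_add ?_ ?_
    · rw [Real.norm_of_nonneg (sq_nonneg _)]
      exact (mul_le_of_le_one_left (norm_nonneg _) (hη.sq_le_one _)).trans
        (norm_truncGradPos_le _ _ _ _ _)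
    · calc ‖2 * η p.2 * max (v p.1 p.2 - l) 0‖ * ‖gradient η p.2‖
          = 2 * |η p.2| * |max (v p.1 p.2 - l) 0| * ‖gradient η p.2‖ := by
            rw [norm_mul, norm_mul, Real.norm_eq_abs, Real.norm_eq_abs, Real.norm_eq_abs, abs_two]
        _ ≤ 2 * 1 * (|v p.1 p.2| + |l|) * M := by
            gcongr
            · exact hη.abs_le_one _
            · exact abs_max_sub_le _ _
            · exact hM _
        _ = _ := by ring
  · by_cases h1 : p.1 ∈ Ioo α β
    · have h2 : p.2 ∉ closedBall x₀ ρ' := fun h2 => hp ⟨h1, h.closedBall_subset h2⟩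
      simp [truncGrad, hη.eq_zero h2]
    · simp [truncGrad, indicator_of_notMem h1]

theorem integrable_truncEnergy (h : CylinderSetting d s Λ α β ρ' ρ x₀ J Ω A K v Dv)
    (hη : IsCutoff (closedBall x₀ ρ') η) (l : ℝ) : Integrable (h.truncEnergy η l) := by
  have hv : Measurable fun p : ℝ × Ed d => v p.1 p.2 := h.reg.meas
  have hm : Measurable fun p : ℝ × Ed d => η p.2 :=
    hη.smooth.continuous.measurable.comp measurable_snd
  have hmeas : Measurable (h.truncEnergy η l) :=
    measurable_indicator_fst (f := fun p => 2⁻¹ * (η p.2 * max (v p.1 p.2 - l) 0) ^ 2)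
      (((hm.mul ((hv.sub_const l).max measurable_const)).pow_const 2).const_mul _) α β
  have hS : MeasurableSet (Ioo α β ×ˢ closedBall x₀ (2 * ρ)) :=
    measurableSet_Ioo.prod measurableSet_closedBall
  have hi := ((memLp_indicator_iff_restrict hS).2 (h.memLp_abs_add_const l)).integrable_sq
  refine hi.mono' hmeas.aestronglyMeasurable (Eventually.of_forall fun p => ?_)
  by_cases hp : p ∈ Ioo α β ×ˢ closedBall x₀ (2 * ρ)
  · rw [truncEnergy, indicator_of_mem hp.1, indicator_of_mem hp,
      Real.norm_of_nonneg (by positivity)]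
    have h1 : |η p.2 * max (v p.1 p.2 - l) 0| ≤ |v p.1 p.2| + |l| := by
      rw [abs_mul]
      exact (mul_le_of_le_one_left (abs_nonneg _) (hη.abs_le_one _)).trans (abs_max_sub_le _ _)
    have h2 := sq_le_sq' (by linarith [abs_nonneg (η p.2 * max (v p.1 p.2 - l) 0)]) h1
    rw [sq_abs] at h2
    nlinarith [sq_nonneg (η p.2 * max (v p.1 p.2 - l) 0)]
  · rw [indicator_of_notMem hp]
    by_cases h1 : p.1 ∈ Ioo α β
    · have h2 : p.2 ∉ closedBall x₀ ρ' := fun h2 => hp ⟨h1, h.closedBall_subset h2⟩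
      simp [truncEnergy, hη.eq_zero h2]
    · simp [truncEnergy, indicator_of_notMem h1]

theorem ae_sobApprox_trunc (h : CylinderSetting d s Λ α β ρ' ρ x₀ J Ω A K v Dv)
    (hη : IsCutoff (closedBall x₀ ρ') η) (l : ℝ) :
    ∀ᵐ τ, SobApprox (nonnegTests (closedBall x₀ ρ')) (fun x => h.truncFun η l (τ, x))
      (fun x => h.truncGrad η l (τ, x)) := by
  filter_upwards [h.ae_sobApprox, ae_memLp_slice h.measurable_locFun h.memLp_locFun,
    ae_memLp_slice h.measurable_locGrad h.memLp_locGrad] with τ h1 h2 h3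
  by_cases hτ : τ ∈ Ioo α β
  · have h4 := h1.truncation (h.measurable_locFun.comp measurable_prodMk_left)
      (h.measurable_locGrad.comp measurable_prodMk_left) h2 h3 hη.smooth
      (hη.hasCompactSupport (isCompact_closedBall _ _)) hη.abs_le_one l
    have e1 : (fun x => h.truncFun η l (τ, x)) =
        fun x => η x ^ 2 * max (h.locFun (τ, x) - l) 0 := by
      ext x
      by_cases hx : x ∈ closedBall x₀ ρ'
      · simp [truncFun, indicator_of_mem hτ, h.locFun_eq hτ (closedBall_subset_ball h.radius_lt hx)]
      · simp [truncFun, hη.eq_zero hx]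
    have e2 : (fun x => h.truncGrad η l (τ, x)) = fun x =>
        η x ^ 2 • (if l < h.locFun (τ, x) then h.locGrad (τ, x) else 0) +
          (2 * η x * max (h.locFun (τ, x) - l) 0) • gradient η x := by
      ext x : 1
      by_cases hx : x ∈ closedBall x₀ ρ'
      · have hx' := closedBall_subset_ball h.radius_lt hx
        simp only [truncGrad, indicator_of_mem hτ, h.locFun_eq hτ hx', h.locGrad_eq hτ hx',
          truncGradPos]
      · simp [truncGrad, hη.eq_zero hx]
    rw [e1, e2]
    exact h4.mono fun φ hφ => ⟨hφ.1, hφ.2.1, hφ.2.2.trans hη.support⟩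
  · simp only [truncFun, truncGrad, indicator_of_notMem hτ]
    refine ⟨fun _ _ => 0, fun _ => ⟨contDiff_const, fun _ => le_rfl, ?_⟩, by simp, ?_⟩
    · simp [tsupport]
    · have : gradient (fun _ : Ed d => (0 : ℝ)) = fun _ => 0 := by
        ext x : 1; simp [gradient]
      simp [this]

theorem memLp_fracDiff_truncFun (h : CylinderSetting d s Λ α β ρ' ρ x₀ J Ω A K v Dv)
    (hη : IsCutoff (closedBall x₀ ρ') η) (l : ℝ) :
    MemLp (fun q : ℝ × Ed d × Ed d => fracDiff s (fun x => h.truncFun η l (q.1, x)) q.2) 2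
      volume :=
  memLp_fracDiff_family h.two_le_dim h.order (h.measurable_truncFun hη l)
    (h.measurable_truncGrad hη l) (h.memLp_truncFun hη l) (h.memLp_truncGrad hη l)
    ((h.ae_sobApprox_trunc hη l).mono fun _ hτ => hτ.contDiff_of_nonnegTests)

theorem integrable_truncForm (h : CylinderSetting d s Λ α β ρ' ρ x₀ J Ω A K v Dv)
    (hη : IsCutoff (closedBall x₀ ρ') η) (l : ℝ) : Integrable (h.truncForm η l) :=
  h.fields.integrable_form (h.memLp_truncFun hη l) (h.memLp_truncGrad hη l)
    (h.memLp_fracDiff_truncFun hη l)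

theorem truncated_energy_inequality (h : CylinderSetting d s Λ α β ρ' ρ x₀ J Ω A K v Dv)
    (hsub : IsLocalWeakSubsolutionHom A K J Ω v Dv) (hη : IsCutoff (closedBall x₀ ρ') η) (l : ℝ) :
    ∃ N : Set ℝ, (∀ᵐ t, t ∈ N) ∧ ∀ t₁ ∈ N, ∀ t₂ ∈ N, α < t₁ → t₁ < t₂ → t₂ < β →
      (∫ x, h.truncEnergy η l (t₂, x)) + ∫ τ in Ioo t₁ t₂, h.truncForm η l τ ≤
        ∫ x, h.truncEnergy η l (t₁, x) := by
  refine h.fields.energy_inequality h.two_le_dim h.order (isCompact_closedBall x₀ ρ')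
    h.measurable_locFun h.memLp_locFun (h.measurable_truncFun hη l)
    (h.measurable_truncGrad hη l) (h.memLp_truncFun hη l) (h.memLp_truncGrad hη l)
    (h.ae_sobApprox_trunc hη l) (h.weak_inequality hsub) (h.integrable_truncEnergy hη l)
    fun t₁ t₂ h1 h12 h2 x => ?_
  have ht₁ : t₁ ∈ Ioo α β := ⟨h1, h12.trans_lt h2⟩
  have ht₂ : t₂ ∈ Ioo α β := ⟨h1.trans_le h12, h2⟩
  by_cases hx : x ∈ closedBall x₀ ρ'
  · have hx' := closedBall_subset_ball h.radius_lt hx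
    simp only [truncEnergy, truncFun, indicator_of_mem ht₁, indicator_of_mem ht₂,
      h.locFun_eq ht₁ hx', h.locFun_eq ht₂ hx', RCLike.inner_apply, conj_trivial]
    have := mul_le_mul_of_nonneg_left (half_sq_max_sub_le (v t₁ x) (v t₂ x) l)
      (sq_nonneg (η x))
    linarith
  · simp [truncEnergy, truncFun, hη.eq_zero hx]

end CylinderSetting

section Convolution

theorem integrable_snd_mul_sub {u g : Ed d → ℝ} (hu : Integrable u) (hg : Integrable g) :
    Integrable (fun p : Ed d × Ed d => g (p.1 - p.2) * u p.2) ∧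
      ∫ p : Ed d × Ed d, g (p.1 - p.2) * u p.2 = (∫ x, g x) * ∫ x, u x := by
  have hmp : MeasurePreserving (fun z : Ed d × Ed d => (z.1 - z.2, z.2)) volume volume :=
    measurePreserving_sub_prod volume volume
  have hi : Integrable (fun p : Ed d × Ed d => g p.1 * u p.2) := hg.mul_prod hu
  refine ⟨hmp.integrable_comp hi.aestronglyMeasurable |>.2 hi, ?_⟩
  rw [← integral_prod_mul]
  have h := integral_map hmp.aemeasurable
    (by rw [hmp.map_eq]; exact hi.aestronglyMeasurable : AEStronglyMeasurable
      (fun p : Ed d × Ed d => g p.1 * u p.2) _)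
  rw [hmp.map_eq] at h
  exact h.symm

theorem integrable_fst_mul_sub {u g : Ed d → ℝ} (hu : Integrable u) (hg : Integrable g)
    (hg' : ∀ z, g (-z) = g z) :
    Integrable (fun p : Ed d × Ed d => g (p.1 - p.2) * u p.1) ∧
      ∫ p : Ed d × Ed d, g (p.1 - p.2) * u p.1 = (∫ x, g x) * ∫ x, u x := by
  obtain ⟨h1, h2⟩ := integrable_snd_mul_sub hu hg
  have e : (fun p : Ed d × Ed d => g (p.1 - p.2) * u p.1) =
      (fun p : Ed d × Ed d => g (p.1 - p.2) * u p.2) ∘ Prod.swap := by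
    ext p
    simp only [Function.comp_apply, Prod.fst_swap, Prod.snd_swap]
    rw [← hg' (p.2 - p.1), neg_sub]
  rw [e]
  refine ⟨h1.swap, ?_⟩
  rw [← h2]
  exact integral_prod_swap fun p : Ed d × Ed d => g (p.1 - p.2) * u p.2

theorem setIntegral_setIntegral_le_integral {X Z : Ed d × Ed d → ℝ} {B : Set (Ed d)}
    (hB : MeasurableSet B) (hX : Measurable X) (hZ : Integrable Z) (hZ0 : ∀ p, 0 ≤ Z p)
    (hX0 : ∀ x ∈ B, ∀ y ∈ B, 0 ≤ X (x, y)) (hXZ : ∀ x ∈ B, ∀ y ∈ B, X (x, y) ≤ Z (x, y)) :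
    ∫ x in B, ∫ y in B, X (x, y) ≤ ∫ p, Z p := by
  have hi : IntegrableOn X (B ×ˢ B) := by
    refine Integrable.mono' hZ.integrableOn hX.aestronglyMeasurable ?_
    filter_upwards [ae_restrict_mem (hB.prod hB)] with p hp
    rw [Real.norm_of_nonneg (hX0 _ hp.1 _ hp.2)]
    exact hXZ _ hp.1 _ hp.2
  calc ∫ x in B, ∫ y in B, X (x, y) = ∫ p in B ×ˢ B, X p := (setIntegral_prod X hi).symm
    _ ≤ ∫ p in B ×ˢ B, Z p :=
      setIntegral_mono_on hi hZ.integrableOn (hB.prod hB) fun p hp => hXZ _ hp.1 _ hp.2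
    _ ≤ ∫ p, Z p := setIntegral_le_integral hZ (Eventually.of_forall hZ0)

end Convolution

namespace CylinderSetting

variable {s Λ α β ρ' ρ : ℝ} {x₀ : Ed d} {J : Set ℝ} {Ω : Set (Ed d)}
  {A : ℝ → Ed d → Ed d → Ed d} {K : ℝ → Ed d → Ed d → ℝ} {v : ℝ → Ed d → ℝ}
  {Dv : ℝ → Ed d → Ed d} {η : Ed d → ℝ} {M r : ℝ}

theorem measurable_slice (h : CylinderSetting d s Λ α β ρ' ρ x₀ J Ω A K v Dv) (τ : ℝ) :
    Measurable (v τ) :=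
  Measurable.comp (g := fun p : ℝ × Ed d => v p.1 p.2) h.reg.meas measurable_prodMk_left

theorem ae_memLp_trunc (h : CylinderSetting d s Λ α β ρ' ρ x₀ J Ω A K v Dv) (l : ℝ) :
    ∀ᵐ τ, τ ∈ Ioo α β →
      MemLp (fun x => max (v τ x - l) 0) 2 (volume.restrict (Metric.ball x₀ ρ)) := by
  filter_upwards [h.ae_slice] with τ h1 hτ
  have hle : volume.restrict (Metric.ball x₀ ρ) ≤ volume.restrict (closedBall x₀ (2 * ρ)) :=
    Measure.restrict_mono (ball_subset_closedBall.trans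
      (closedBall_subset_closedBall (by linarith [h.radius_pos']))) le_rfl
  have h2 := ((h1 hτ).1.mono_measure hle)
  have : IsFiniteMeasure (volume.restrict (Metric.ball x₀ ρ)) :=
    isFiniteMeasure_restrict.2 measure_ball_lt_top.ne
  refine (h2.abs.add (memLp_const |l|)).mono
    (((h.measurable_slice τ).sub_const l).max measurable_const).aestronglyMeasurable
    (Eventually.of_forall fun x => ?_)
  exact (abs_max_sub_le _ _).trans (le_abs_self _)

theorem ae_integrable_sq_trunc (h : CylinderSetting d s Λ α β ρ' ρ x₀ J Ω A K v Dv) (l : ℝ) :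
    ∀ᵐ τ, τ ∈ Ioo α β →
      IntegrableOn (fun x => (max (v τ x - l) 0) ^ 2) (Metric.ball x₀ ρ) := by
  filter_upwards [h.ae_memLp_trunc l] with τ h1 hτ using (h1 hτ).integrable_sq

theorem ae_flux_lower_bound (h : CylinderSetting d s Λ α β ρ' ρ x₀ J Ω A K v Dv)
    (hη : IsCutoff (closedBall x₀ ρ') η) (l : ℝ) (hr : r ≤ ρ)
    (h1 : ∀ x ∈ Metric.ball x₀ r, η x = 1) (hM : ∀ x, ‖gradient η x‖ ≤ M) :
    ∀ᵐ τ, τ ∈ Ioo α β →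
      ∫ x in Metric.ball x₀ r, ‖truncGradPos v Dv l τ x‖ ^ 2 ≤
        2 * Λ * (∫ x, ⟪h.flux (τ, x), h.truncGrad η l (τ, x)⟫) +
          4 * Λ ^ 4 * M ^ 2 * ∫ x in Metric.ball x₀ ρ, (max (v τ x - l) 0) ^ 2 := by
  filter_upwards [h.ae_integrable_sq_trunc l, ae_memLp_slice h.measurable_flux h.memLp_flux,
    ae_memLp_slice (h.measurable_truncGrad hη l) (h.memLp_truncGrad hη l)] with τ hw hF hG hτ
  have hΛ : 0 < Λ := lt_of_lt_of_le one_pos h.one_le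
  have hM0 : 0 ≤ M := (norm_nonneg _).trans (hM x₀)
  have hu := (integrable_indicator_iff measurableSet_ball).2 (hw hτ)
  rw [← integral_indicator (measurableSet_ball (x := x₀) (ε := ρ)), ← integral_const_mul,
    ← integral_const_mul, ← integral_add ((hF.integrable_inner hG).const_mul _) (hu.const_mul _)]
  have key : ∀ x ∈ Metric.ball x₀ ρ, η x ^ 2 * ‖truncGradPos v Dv l τ x‖ ^ 2 ≤
      2 * Λ * ⟪h.flux (τ, x), h.truncGrad η l (τ, x)⟫ +
        4 * Λ ^ 4 * M ^ 2 * (max (v τ x - l) 0) ^ 2 := by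
    intro x hx
    have hm : (τ, x) ∈ Ioo α β ×ˢ Metric.ball x₀ ρ := ⟨hτ, hx⟩
    rw [flux, indicator_of_mem hm, truncGrad, indicator_of_mem hτ]
    by_cases hv : l < v τ x
    · have e : max (v τ x - l) 0 = v τ x - l := max_eq_left (by linarith)
      simp only [truncGradPos, if_pos hv, e, inner_add_right, inner_smul_right]
      set w := v τ x - l with hw
      have hw0 : 0 < w := by linarith
      have ha : Λ⁻¹ * ‖Dv τ x‖ ^ 2 ≤ ⟪A τ x (Dv τ x), Dv τ x⟫ := by
        have h0 : A τ x 0 = 0 := by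
          have := h.field.growth τ x 0
          rwa [norm_zero, mul_zero, norm_le_zero_iff] at this
        simpa [h0] using h.field.monotone τ x 0 (Dv τ x)
      have hb : -(Λ * ‖Dv τ x‖ * M) ≤ ⟪A τ x (Dv τ x), gradient η x⟫ := by
        have h2 := neg_le_of_abs_le (abs_real_inner_le_norm (A τ x (Dv τ x)) (gradient η x))
        have h3 : ‖A τ x (Dv τ x)‖ * ‖gradient η x‖ ≤ Λ * ‖Dv τ x‖ * M :=
          mul_le_mul (h.field.growth _ _ _) (hM x) (norm_nonneg _) (by positivity)
        linarith
      have hη0 := hη.nonneg x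
      have ha' := mul_le_mul_of_nonneg_left ha (by positivity : 0 ≤ 2 * Λ * η x ^ 2)
      have hb' := mul_le_mul_of_nonneg_left hb (by positivity : 0 ≤ 2 * Λ * (2 * η x * w))
      have e2 : 2 * Λ * η x ^ 2 * (Λ⁻¹ * ‖Dv τ x‖ ^ 2) = 2 * η x ^ 2 * ‖Dv τ x‖ ^ 2 := by
        field_simp
      nlinarith [sq_nonneg (η x * ‖Dv τ x‖ - 2 * Λ ^ 2 * M * w)]
    · have e : max (v τ x - l) 0 = 0 := max_eq_right (by linarith)
      simp [truncGradPos, if_neg hv, e]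
  refine le_trans ?_ (setIntegral_le_integral (s := Metric.ball x₀ r)
    (((hF.integrable_inner hG).const_mul _).add (hu.const_mul _))
    (Eventually.of_forall fun x => ?_))
  · refine integral_mono_of_nonneg (Eventually.of_forall fun x => sq_nonneg _)
      (((hF.integrable_inner hG).const_mul _).add (hu.const_mul _)).integrableOn ?_
    filter_upwards [ae_restrict_mem measurableSet_ball] with x hx
    have hx' := ball_subset_ball hr hx
    have := key x hx'
    rw [h1 x hx, one_pow, one_mul] at this
    simpa [indicator_of_mem hx'] using this
  · by_cases hx : x ∈ Metric.ball x₀ ρ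
    · have := (mul_nonneg (sq_nonneg (η x)) (sq_nonneg ‖truncGradPos v Dv l τ x‖)).trans (key x hx)
      simpa [indicator_of_mem hx] using this
    · have hm : (τ, x) ∉ Ioo α β ×ˢ Metric.ball x₀ ρ := fun h' => hx h'.2
      simp only [Pi.zero_apply, flux, indicator_of_notMem hm, indicator_of_notMem hx]
      simp

end CylinderSetting

theorem sub_mul_trunc_eq (a b l s t : ℝ) :
    (a - b) * (s ^ 2 * max (a - l) 0 - t ^ 2 * max (b - l) 0) =
      (s * max (a - l) 0 - t * max (b - l) 0) ^ 2
        - max (a - l) 0 * max (b - l) 0 * (s - t) ^ 2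
        + max (l - a) 0 * (t ^ 2 * max (b - l) 0) + max (l - b) 0 * (s ^ 2 * max (a - l) 0) := by
  have h (c : ℝ) : c - l = max (c - l) 0 - max (l - c) 0 ∧ max (c - l) 0 * max (l - c) 0 = 0 := by
    rcases le_total c l with hc | hc
    · simp [max_eq_right (sub_nonpos.2 hc), max_eq_left (sub_nonneg.2 hc)]
    · simp [max_eq_right (sub_nonpos.2 hc), max_eq_left (sub_nonneg.2 hc)]
  obtain ⟨ha, ha'⟩ := h a
  obtain ⟨hb, hb'⟩ := h b
  linear_combination (s ^ 2 * max (a - l) 0 - t ^ 2 * max (b - l) 0) * (ha - hb) - s ^ 2 * ha' -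
    t ^ 2 * hb'

namespace IsCutoff

variable {S : Set (Ed d)} {η : Ed d → ℝ} {M : ℝ}

theorem sq_sub_le (hη : IsCutoff S η) (hM : ∀ x, ‖gradient η x‖ ≤ M) (hM1 : 1 ≤ M) (x y : Ed d) :
    (η x - η y) ^ 2 ≤ M ^ 2 * min (‖x - y‖ ^ 2) 1 := by
  have hlip : |η x - η y| ≤ M * ‖x - y‖ := by
    have := convex_univ.norm_image_sub_le_of_norm_fderiv_le (𝕜 := ℝ) (f := η) (C := M)
      (fun z _ => (hη.contDiff_one.differentiable one_ne_zero) z)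
      (fun z _ => by rw [← norm_gradient_eq]; exact hM z) (mem_univ y) (mem_univ x)
    simpa using this
  rw [mul_min_of_nonneg _ _ (sq_nonneg M)]
  refine le_min ?_ ?_
  · rw [← mul_pow]
    exact sq_le_sq' (by linarith [neg_le_of_abs_le hlip]) ((le_abs_self _).trans hlip)
  · have h1 : |η x - η y| ≤ 1 := by
      rw [abs_le]
      constructor <;> linarith [hη.nonneg x, hη.nonneg y, hη.le_one x, hη.le_one y]
    nlinarith [(sq_le_one_iff_abs_le_one (η x - η y)).2 h1]

end IsCutoff

namespace CylinderSetting

variable {s Λ α β ρ' ρ : ℝ} {x₀ : Ed d} {J : Set ℝ} {Ω : Set (Ed d)}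
  {A : ℝ → Ed d → Ed d → Ed d} {K : ℝ → Ed d → Ed d → ℝ} {v : ℝ → Ed d → ℝ}
  {Dv : ℝ → Ed d → Ed d} {η : Ed d → ℝ} {M r : ℝ}

theorem le_near_mul_fracDiff (h : CylinderSetting d s Λ α β ρ' ρ x₀ J Ω A K v Dv)
    (hη : IsCutoff (closedBall x₀ ρ') η) (l : ℝ) (hM : ∀ x, ‖gradient η x‖ ≤ M) (hM1 : 1 ≤ M)
    {τ : ℝ} (hτ : τ ∈ Ioo α β) {x y : Ed d} (hx : x ∈ Metric.ball x₀ ρ)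
    (hy : y ∈ Metric.ball x₀ ρ) :
    (‖x - y‖ ^ ((d : ℝ) + 2 * s))⁻¹ * ((η x * max (v τ x - l) 0 - η y * max (v τ y - l) 0) ^ 2 +
        η x ^ 2 * max (v τ x - l) 0 * max (l - v τ y) 0) ≤
      Λ * (h.near (τ, x, y) * fracDiff s (fun x => h.truncFun η l (τ, x)) (x, y)) +
        2⁻¹ * Λ ^ 2 * M ^ 2 * (min (‖x - y‖ ^ 2) 1 * (‖x - y‖ ^ ((d : ℝ) + 2 * s))⁻¹ *
          ((max (v τ x - l) 0) ^ 2 + (max (v τ y - l) 0) ^ 2)) := by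
  have hΛ : 0 < Λ := lt_of_lt_of_le one_pos h.one_le
  rw [h.near_mul_fracDiff hτ hx hy, truncFun, truncFun, indicator_of_mem hτ, indicator_of_mem hτ]
  rcases eq_or_ne x y with rfl | hne
  · have := h.dim_add_pos.ne'
    simp [Real.zero_rpow this]
  have hK1 := h.kernel.lower τ x y hne
  have hK2 := h.kernel.upper τ x y hne
  rw [div_eq_mul_inv] at hK1 hK2
  have hsub := hη.sq_sub_le hM hM1 x y
  simp only [sub_mul_trunc_eq]
  set k := (‖x - y‖ ^ ((d : ℝ) + 2 * s))⁻¹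
  have hk : 0 ≤ k := by positivity
  have hwx : 0 ≤ max (v τ x - l) 0 := le_max_right _ _
  have hwy : 0 ≤ max (v τ y - l) 0 := le_max_right _ _
  have hmx : 0 ≤ max (l - v τ x) 0 := le_max_right _ _
  have hmy : 0 ≤ max (l - v τ y) 0 := le_max_right _ _
  set a := max (v τ x - l) 0
  set b := max (v τ y - l) 0
  set a' := max (l - v τ x) 0
  set b' := max (l - v τ y) 0
  have hL1 : k ≤ Λ * K τ x y := by
    have := mul_le_mul_of_nonneg_left hK1 hΛ.le
    rwa [mul_inv_cancel_left₀ hΛ.ne'] at this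
  have hL2 : Λ * K τ x y ≤ Λ ^ 2 * k := by
    have := mul_le_mul_of_nonneg_left hK2 hΛ.le
    linarith
  have hL0 : 0 ≤ Λ * K τ x y := hk.trans hL1
  have e1 := mul_le_mul_of_nonneg_right hL1
    (by positivity : 0 ≤ (η x * a - η y * b) ^ 2 + b' * (η x ^ 2 * a))
  have e2 := mul_le_mul_of_nonneg_right hL2 (by positivity : 0 ≤ a * b * (η x - η y) ^ 2)
  have e3 : 0 ≤ Λ * K τ x y * (a' * (η y ^ 2 * b)) := by positivity
  have e4 : a * b * (η x - η y) ^ 2 ≤ 2⁻¹ * (a ^ 2 + b ^ 2) * (M ^ 2 * min (‖x - y‖ ^ 2) 1) :=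
    mul_le_mul (by nlinarith [sq_nonneg (a - b)]) hsub (sq_nonneg _) (by positivity)
  have e5 := mul_le_mul_of_nonneg_left e4 (by positivity : 0 ≤ Λ ^ 2 * k)
  linarith

theorem ae_near_lower_bound (h : CylinderSetting d s Λ α β ρ' ρ x₀ J Ω A K v Dv)
    (hη : IsCutoff (closedBall x₀ ρ') η) (l : ℝ) (hr : r ≤ ρ)
    (h1 : ∀ x ∈ Metric.ball x₀ r, η x = 1) (hM : ∀ x, ‖gradient η x‖ ≤ M) (hM1 : 1 ≤ M) :
    ∀ᵐ τ, τ ∈ Ioo α β →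
      (∫ x in Metric.ball x₀ r, ∫ y in Metric.ball x₀ r,
        (max (v τ x - l) 0 - max (v τ y - l) 0) ^ 2 / ‖x - y‖ ^ ((d : ℝ) + 2 * s)) ≤
        Λ * (∫ p, ⟪h.near (τ, p), fracDiff s (fun x => h.truncFun η l (τ, x)) p⟫) +
          Λ ^ 2 * M ^ 2 * fracConst d s * ∫ x in Metric.ball x₀ ρ, (max (v τ x - l) 0) ^ 2 ∧
      (∫ x in Metric.ball x₀ r, ∫ y in Metric.ball x₀ r,
        max (v τ x - l) 0 * max (l - v τ y) 0 / (2 * r) ^ ((d : ℝ) + 2 * s)) ≤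
        Λ * (∫ p, ⟪h.near (τ, p), fracDiff s (fun x => h.truncFun η l (τ, x)) p⟫) +
          Λ ^ 2 * M ^ 2 * fracConst d s * ∫ x in Metric.ball x₀ ρ, (max (v τ x - l) 0) ^ 2 := by
  filter_upwards [h.ae_integrable_sq_trunc l, ae_memLp_slice h.measurable_near h.memLp_near,
    ae_memLp_slice (measurable_fracDiff_family s (h.measurable_truncFun hη l))
      (h.memLp_fracDiff_truncFun hη l)] with τ hw hN hF hτ
  have hΛ : 0 < Λ := lt_of_lt_of_le one_pos h.one_le
  have hp := h.dim_add_pos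
  have hv := h.measurable_slice τ
  set u := (Metric.ball x₀ ρ).indicator fun x => (max (v τ x - l) 0) ^ 2 with hu_def
  have hu : Integrable u := (integrable_indicator_iff measurableSet_ball).2 (hw hτ)
  have hg := integrable_fracKernel h.two_le_dim h.order
  obtain ⟨i1, j1⟩ := integrable_fst_mul_sub hu hg (by simp)
  obtain ⟨i2, j2⟩ := integrable_snd_mul_sub hu hg
  have iN : Integrable fun p => h.near (τ, p) * fracDiff s (fun x => h.truncFun η l (τ, x)) p := by
    refine (hN.integrable_inner hF).congr (Eventually.of_forall fun p => ?_)
    simp [RCLike.inner_apply, mul_comm]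
  set Z : Ed d × Ed d → ℝ := fun p =>
    Λ * (h.near (τ, p) * fracDiff s (fun x => h.truncFun η l (τ, x)) p) + 2⁻¹ * Λ ^ 2 * M ^ 2 *
      (min (‖p.1 - p.2‖ ^ 2) 1 * (‖p.1 - p.2‖ ^ ((d : ℝ) + 2 * s))⁻¹ * u p.1 +
        min (‖p.1 - p.2‖ ^ 2) 1 * (‖p.1 - p.2‖ ^ ((d : ℝ) + 2 * s))⁻¹ * u p.2) with hZ_def
  have hZ : Integrable Z := (iN.const_mul _).add ((i1.add i2).const_mul _)
  have hZint : ∫ p, Z p =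
      Λ * (∫ p, ⟪h.near (τ, p), fracDiff s (fun x => h.truncFun η l (τ, x)) p⟫) +
        Λ ^ 2 * M ^ 2 * fracConst d s * ∫ x in Metric.ball x₀ ρ, (max (v τ x - l) 0) ^ 2 := by
    have e0 := integral_add (iN.const_mul Λ) ((i1.add i2).const_mul (2⁻¹ * Λ ^ 2 * M ^ 2))
    rw [integral_const_mul, integral_const_mul, integral_add' i1 i2, j1, j2] at e0
    refine e0.trans ?_
    rw [← integral_indicator measurableSet_ball]
    have e : ∫ p, h.near (τ, p) * fracDiff s (fun x => h.truncFun η l (τ, x)) p =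
        ∫ p, ⟪h.near (τ, p), fracDiff s (fun x => h.truncFun η l (τ, x)) p⟫ :=
      integral_congr_ae (Eventually.of_forall fun p => by
        simp [RCLike.inner_apply, mul_comm])
    rw [e, fracConst]
    ring
  have hlow : ∀ x ∈ Metric.ball x₀ ρ, ∀ y ∈ Metric.ball x₀ ρ,
      (‖x - y‖ ^ ((d : ℝ) + 2 * s))⁻¹ *
        ((η x * max (v τ x - l) 0 - η y * max (v τ y - l) 0) ^ 2 +
          η x ^ 2 * max (v τ x - l) 0 * max (l - v τ y) 0) ≤ Z (x, y) := by
    intro x hx y hy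
    refine (h.le_near_mul_fracDiff hη l hM hM1 hτ hx hy).trans_eq ?_
    simp only [hZ_def, hu_def, indicator_of_mem hx, indicator_of_mem hy]
    ring
  have hZ0 : ∀ p, 0 ≤ Z p := by
    rintro ⟨x, y⟩
    by_cases hxy : x ∈ Metric.ball x₀ ρ ∧ y ∈ Metric.ball x₀ ρ
    · refine le_trans ?_ (hlow x hxy.1 y hxy.2)
      have := le_max_right (v τ x - l) 0
      have := le_max_right (l - v τ y) 0
      positivity
    · have hu0 : ∀ z, 0 ≤ u z := indicator_nonneg fun z _ => sq_nonneg _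
      have := hu0 x
      have := hu0 y
      simp only [hZ_def, h.near_eq_zero hxy, zero_mul, mul_zero, zero_add]
      positivity
  rw [← hZint]
  constructor
  · refine setIntegral_setIntegral_le_integral (X := fun p => (max (v τ p.1 - l) 0 -
      max (v τ p.2 - l) 0) ^ 2 / ‖p.1 - p.2‖ ^ ((d : ℝ) + 2 * s)) measurableSet_ball
      (by fun_prop) hZ hZ0 (fun x _ y _ => by positivity) fun x hx y hy => ?_
    refine le_trans ?_ (hlow x (ball_subset_ball hr hx) y (ball_subset_ball hr hy))
    rw [h1 x hx, h1 y hy, one_mul, one_mul, div_eq_inv_mul]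
    have := le_max_right (v τ x - l) 0
    have := le_max_right (l - v τ y) 0
    exact mul_le_mul_of_nonneg_left (le_add_of_nonneg_right (by positivity)) (by positivity)
  · refine setIntegral_setIntegral_le_integral (X := fun p => max (v τ p.1 - l) 0 *
      max (l - v τ p.2) 0 / (2 * r) ^ ((d : ℝ) + 2 * s)) measurableSet_ball
      (by fun_prop) hZ hZ0 (fun x hx y _ => ?_) fun x hx y hy => ?_
    · have : 0 < r := pos_of_mem_ball hx
      have := le_max_right (v τ x - l) 0
      have := le_max_right (l - v τ y) 0
      positivity
    refine le_trans ?_ (hlow x (ball_subset_ball hr hx) y (ball_subset_ball hr hy))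
    have ha := le_max_right (v τ x - l) 0
    have hb := le_max_right (l - v τ y) 0
    rcases eq_or_ne x y with rfl | hne
    · have e : max (v τ x - l) 0 * max (l - v τ x) 0 = 0 := by
        rcases le_total (v τ x) l with hc | hc
        · simp [max_eq_right (sub_nonpos.2 hc)]
        · simp [max_eq_right (sub_nonpos.2 hc)]
      rw [e, zero_div]
      positivity
    have hpos : 0 < ‖x - y‖ := norm_pos_iff.2 (sub_ne_zero.2 hne)
    have hle : ‖x - y‖ ≤ 2 * r := by
      rw [← dist_eq_norm]
      linarith [dist_triangle_right x y x₀, mem_ball.1 hx, mem_ball.1 hy]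
    rw [h1 x hx, one_pow, one_mul, div_eq_inv_mul]
    refine mul_le_mul ?_ (le_add_of_nonneg_left (sq_nonneg _)) (by positivity) (by positivity)
    exact inv_anti₀ (by positivity) (Real.rpow_le_rpow hpos.le hle hp.le)

end CylinderSetting

theorem norm_sub_center_le {ρ' ρ : ℝ} (hρ' : 0 ≤ ρ') (hρ : ρ' < ρ) {x₀ x y : Ed d}
    (hx : x ∈ closedBall x₀ ρ') (hy : y ∉ Metric.ball x₀ ρ) :
    ‖x₀ - y‖ ≤ ρ / (ρ - ρ') * ‖x - y‖ := by
  have hx' : ‖x₀ - x‖ ≤ ρ' := by rwa [mem_closedBall, dist_eq_norm, norm_sub_rev] at hx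
  have hy' : ρ ≤ ‖x₀ - y‖ := by rwa [mem_ball, dist_eq_norm, not_lt, norm_sub_rev] at hy
  have h3 := norm_sub_le_norm_sub_add_norm_sub x₀ x y
  rw [div_mul_eq_mul_div, le_div_iff₀ (sub_pos.2 hρ)]
  nlinarith [norm_nonneg (x₀ - y)]

theorem Tail_nonneg (s : ℝ) (u : Ed d → ℝ) (x₀ : Ed d) (R : ℝ) : 0 ≤ Tail s u x₀ R :=
  mul_nonneg (sq_nonneg R) (integral_nonneg fun y => by positivity)

namespace CylinderSetting

variable {s Λ α β ρ' ρ : ℝ} {x₀ : Ed d} {J : Set ℝ} {Ω : Set (Ed d)}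
  {A : ℝ → Ed d → Ed d → Ed d} {K : ℝ → Ed d → Ed d → ℝ} {v : ℝ → Ed d → ℝ}
  {Dv : ℝ → Ed d → Ed d} {η : Ed d → ℝ}

theorem exists_tail_bound (h : CylinderSetting d s Λ α β ρ' ρ x₀ J Ω A K v Dv) (l : ℝ) :
    ∃ c : ℝ, 0 ≤ c ∧ ∀ᵐ τ, τ ∈ Ioo α β →
      IntegrableOn (fun y => |max (v τ y - l) 0| / ‖x₀ - y‖ ^ ((d : ℝ) + 2 * s))
        (Metric.ball x₀ ρ)ᶜ ∧
      Tail s (fun y => max (v τ y - l) 0) x₀ ρ ≤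
        c * (1 + ∫ y, |v τ y| / (1 + ‖y‖ ^ ((d : ℝ) + 2 * s))) := by
  obtain ⟨c, hc, hle⟩ := one_add_norm_rpow_le h.dim_add_pos h.radius_lt h.radius_pos x₀
  have hm : Integrable fun y : Ed d => (1 + ‖y‖ ^ ((d : ℝ) + 2 * s))⁻¹ :=
    integrable_inv_one_add_norm_rpow (by linarith [h.order.1])
  set m := ∫ y : Ed d, (1 + ‖y‖ ^ ((d : ℝ) + 2 * s))⁻¹
  have hm0 : 0 ≤ m := integral_nonneg fun y => by positivity
  refine ⟨ρ ^ 2 * (c * (1 + |l| * m)), by positivity, h.ae_slice.mono fun τ hτ hτJ => ?_⟩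
  have h3 := (hτ hτJ).2.2
  have hi := (h3.add (hm.const_mul |l|)).const_mul c
  have hb : ∀ y ∈ (Metric.ball x₀ ρ)ᶜ,
      |max (v τ y - l) 0| / ‖x₀ - y‖ ^ ((d : ℝ) + 2 * s) ≤
        c * (|v τ y| / (1 + ‖y‖ ^ ((d : ℝ) + 2 * s)) +
          |l| * (1 + ‖y‖ ^ ((d : ℝ) + 2 * s))⁻¹) := by
    intro y hy
    have h1 := hle x₀ (mem_closedBall_self h.radius_pos.le) y hy
    have h2 : 0 < ‖x₀ - y‖ ^ ((d : ℝ) + 2 * s) := by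
      refine Real.rpow_pos_of_pos (norm_pos_iff.2 (sub_ne_zero.2 ?_)) _
      exact h.ne_of_mem_closedBall (mem_closedBall_self h.radius_pos.le) hy
    have h4 : (‖x₀ - y‖ ^ ((d : ℝ) + 2 * s))⁻¹ ≤ c * (1 + ‖y‖ ^ ((d : ℝ) + 2 * s))⁻¹ := by
      rw [← div_eq_mul_inv, inv_eq_one_div, div_le_div_iff₀ h2 (by positivity)]
      linarith
    calc |max (v τ y - l) 0| / ‖x₀ - y‖ ^ ((d : ℝ) + 2 * s)
        ≤ (|v τ y| + |l|) * (c * (1 + ‖y‖ ^ ((d : ℝ) + 2 * s))⁻¹) := by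
          rw [div_eq_mul_inv]
          exact mul_le_mul (abs_max_sub_le _ _) h4 (by positivity) (by positivity)
      _ = _ := by rw [div_eq_mul_inv]; ring
  have hI : IntegrableOn (fun y => |max (v τ y - l) 0| / ‖x₀ - y‖ ^ ((d : ℝ) + 2 * s))
      (Metric.ball x₀ ρ)ᶜ := by
    have hv := h.measurable_slice τ
    refine Integrable.mono' hi.integrableOn (Measurable.aestronglyMeasurable (by fun_prop)) ?_
    filter_upwards [ae_restrict_mem measurableSet_ball.compl] with y hy
    rw [Real.norm_of_nonneg (by positivity)]
    exact hb y hy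
  refine ⟨hI, ?_⟩
  have ht0 : 0 ≤ ∫ y, |v τ y| / (1 + ‖y‖ ^ ((d : ℝ) + 2 * s)) :=
    integral_nonneg fun y => by positivity
  have h5 : ∫ y in (Metric.ball x₀ ρ)ᶜ, |max (v τ y - l) 0| / ‖x₀ - y‖ ^ ((d : ℝ) + 2 * s) ≤
      c * ((∫ y, |v τ y| / (1 + ‖y‖ ^ ((d : ℝ) + 2 * s))) + |l| * m) := by
    refine (setIntegral_mono_on hI hi.integrableOn measurableSet_ball.compl hb).trans
      ((setIntegral_le_integral hi (Eventually.of_forall fun y => ?_)).trans_eq ?_)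
    · simp only [Pi.zero_apply, Pi.add_apply]
      positivity
    · rw [integral_const_mul, integral_add' h3 (hm.const_mul _), integral_const_mul]
  rw [Tail, mul_assoc (ρ ^ 2), mul_assoc c]
  refine mul_le_mul_of_nonneg_left (h5.trans (mul_le_mul_of_nonneg_left ?_ hc)) (sq_nonneg ρ)
  nlinarith [mul_nonneg (mul_nonneg (abs_nonneg l) hm0) ht0]

theorem le_farKernel (h : CylinderSetting d s Λ α β ρ' ρ x₀ J Ω A K v Dv) {l τ : ℝ} {x : Ed d}
    (hx : x ∈ closedBall x₀ ρ') (hl : l ≤ v τ x) (y : Ed d) :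
    -(Λ * (ρ / (ρ - ρ')) ^ ((d : ℝ) + 2 * s) * (Metric.ball x₀ ρ)ᶜ.indicator
      (fun y => |max (v τ y - l) 0| / ‖x₀ - y‖ ^ ((d : ℝ) + 2 * s)) y) ≤ h.farKernel τ x y := by
  by_cases hy : y ∈ (Metric.ball x₀ ρ)ᶜ
  · rw [farKernel, indicator_of_mem hy, indicator_of_mem hy]
    have hΛ : 0 < Λ := lt_of_lt_of_le one_pos h.one_le
    have hne := h.ne_of_mem_closedBall hx hy
    have hne0 := h.ne_of_mem_closedBall (mem_closedBall_self h.radius_pos.le) hy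
    have hxy : 0 < ‖x - y‖ := norm_pos_iff.2 (sub_ne_zero.2 hne)
    have hxy0 : 0 < ‖x₀ - y‖ := norm_pos_iff.2 (sub_ne_zero.2 hne0)
    have hw : 0 ≤ max (v τ y - l) 0 := le_max_right _ _
    have hκ : 0 ≤ ρ / (ρ - ρ') := div_nonneg h.radius_pos'.le (sub_pos.2 h.radius_lt).le
    have h1 : K τ x y ≤ Λ * (ρ / (ρ - ρ')) ^ ((d : ℝ) + 2 * s) /
        ‖x₀ - y‖ ^ ((d : ℝ) + 2 * s) := by
      refine (h.kernel.upper τ x y hne).trans ?_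
      rw [div_le_div_iff₀ (by positivity) (by positivity), mul_assoc Λ,
        ← Real.mul_rpow hκ hxy.le]
      gcongr
      · exact h.dim_add_pos.le
      · exact norm_sub_center_le h.radius_pos.le h.radius_lt hx hy
    have h2 : -max (v τ y - l) 0 ≤ v τ x - v τ y := by linarith [le_max_left (v τ y - l) 0]
    have h3 := mul_le_mul_of_nonneg_right h2 (h.kernel_nonneg τ hne)
    have h4 := mul_le_mul_of_nonneg_left h1 hw
    rw [abs_of_nonneg hw]
    calc _ = -(max (v τ y - l) 0 * (Λ * (ρ / (ρ - ρ')) ^ ((d : ℝ) + 2 * s) /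
        ‖x₀ - y‖ ^ ((d : ℝ) + 2 * s))) := by ring
      _ ≤ _ := by linarith
  · rw [farKernel, indicator_of_notMem hy, indicator_of_notMem hy, mul_zero, neg_zero]

theorem ae_far_lower_bound (h : CylinderSetting d s Λ α β ρ' ρ x₀ J Ω A K v Dv)
    (hη : IsCutoff (closedBall x₀ ρ') η) (l : ℝ) :
    ∀ᵐ τ, τ ∈ Ioo α β →
      -(2 * Λ * (ρ / (ρ - ρ')) ^ ((d : ℝ) + 2 * s) * (ρ ^ 2)⁻¹ *
        ((∫ x in Metric.ball x₀ ρ, max (v τ x - l) 0) *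
          Tail s (fun y => max (v τ y - l) 0) x₀ ρ)) ≤
        ∫ x, ⟪h.far (τ, x), h.truncFun η l (τ, x)⟫ := by
  obtain ⟨c, -, hT⟩ := h.exists_tail_bound l
  obtain ⟨c', -, hfar⟩ := h.exists_far_bound
  filter_upwards [hT, hfar, h.ae_memLp_trunc l, ae_memLp_slice h.measurable_far h.memLp_far,
    ae_memLp_slice (h.measurable_truncFun hη l) (h.memLp_truncFun hη l)] with τ hT hfar hw hF hf hτ
  have hΛ : 0 < Λ := lt_of_lt_of_le one_pos h.one_le
  have hρ := h.radius_pos'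
  have hκ : 0 ≤ ρ / (ρ - ρ') := div_nonneg hρ.le (sub_pos.2 h.radius_lt).le
  have : IsFiniteMeasure (volume.restrict (Metric.ball x₀ ρ)) :=
    isFiniteMeasure_restrict.2 measure_ball_lt_top.ne
  have hwi : IntegrableOn (fun x => max (v τ x - l) 0) (Metric.ball x₀ ρ) :=
    (hw hτ).integrable one_le_two
  set θ := Tail s (fun y => max (v τ y - l) 0) x₀ ρ with hθ
  have hθ0 : 0 ≤ θ := Tail_nonneg _ _ _ _
  set c₁ := 2 * Λ * (ρ / (ρ - ρ')) ^ ((d : ℝ) + 2 * s) * (ρ ^ 2)⁻¹ with hc₁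
  have hc₁0 : 0 ≤ c₁ := by positivity
  have hb : ∀ x, (Metric.ball x₀ ρ).indicator (fun x => -(c₁ * θ) * max (v τ x - l) 0) x ≤
      ⟪h.far (τ, x), h.truncFun η l (τ, x)⟫ := by
    intro x
    have hwx : 0 ≤ max (v τ x - l) 0 := le_max_right _ _
    by_cases hx : x ∈ closedBall x₀ ρ'
    · have hm : (τ, x) ∈ Ioo α β ×ˢ closedBall x₀ ρ' := ⟨hτ, hx⟩
      rw [indicator_of_mem (closedBall_subset_ball h.radius_lt hx), far, indicator_of_mem hm,
        truncFun, indicator_of_mem hτ]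
      simp only [RCLike.inner_apply, conj_trivial]
      rcases le_or_gt (v τ x) l with hl | hl
      · simp [max_eq_right (sub_nonpos.2 hl)]
      · have h1 : -(Λ * (ρ / (ρ - ρ')) ^ ((d : ℝ) + 2 * s) * ((ρ ^ 2)⁻¹ * θ)) ≤
            ∫ y, h.farKernel τ x y := by
          have e : (ρ ^ 2)⁻¹ * θ = ∫ y, (Metric.ball x₀ ρ)ᶜ.indicator
              (fun y => |max (v τ y - l) 0| / ‖x₀ - y‖ ^ ((d : ℝ) + 2 * s)) y := by
            rw [integral_indicator measurableSet_ball.compl, hθ, Tail,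
              inv_mul_cancel_left₀ (by positivity)]
          rw [e, ← integral_const_mul, ← integral_neg]
          exact integral_mono (((integrable_indicator_iff measurableSet_ball.compl).2
            (hT hτ).1).const_mul _).neg (hfar hτ x hx).1 (h.le_farKernel hx hl.le)
        have h2 := mul_le_mul_of_nonneg_left h1
          (by positivity : 0 ≤ 2 * (η x ^ 2 * max (v τ x - l) 0))
        have h3 := mul_le_mul_of_nonneg_right (hη.sq_le_one x)
          (by positivity : 0 ≤ c₁ * θ * max (v τ x - l) 0)
        have e2 : Λ * (ρ / (ρ - ρ')) ^ ((d : ℝ) + 2 * s) * ((ρ ^ 2)⁻¹ * θ) = c₁ * θ / 2 := by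
          rw [hc₁]; ring
        rw [e2] at h2
        linarith
    · have hf0 : h.truncFun η l (τ, x) = 0 := by simp [truncFun, hη.eq_zero hx]
      rw [hf0, inner_zero_right]
      refine indicator_apply_nonpos fun _ => ?_
      rw [neg_mul]
      exact neg_nonpos.2 (by positivity)
  have hi : Integrable ((Metric.ball x₀ ρ).indicator fun x => -(c₁ * θ) * max (v τ x - l) 0) :=
    (integrable_indicator_iff measurableSet_ball).2 (hwi.const_mul _)
  refine le_trans (le_of_eq ?_) (integral_mono hi (hF.integrable_inner hf) hb)
  rw [integral_indicator measurableSet_ball, integral_const_mul]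
  ring

end CylinderSetting

theorem exists_mem_le_setAverage {f : ℝ → ℝ} {a b : ℝ} (hab : a < b) (hf : IntegrableOn f (Ioo a b))
    {p : ℝ → Prop} (hp : ∀ᵐ t, p t) :
    ∃ t ∈ Ioo a b, p t ∧ f t ≤ (b - a)⁻¹ * ∫ τ in Ioo a b, f τ := by
  have h1 := measure_le_setAverage_pos (μ := volume) (s := Ioo a b)
    (by simp [hab]) (by simp) hf
  obtain ⟨t, ht, hpt⟩ := ((frequently_ae_mem_iff.2 h1.ne').and_eventually hp).exists
  refine ⟨t, ht.1, hpt, ht.2.trans_eq ?_⟩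
  rw [setAverage_eq, smul_eq_mul, Measure.real, Real.volume_Ioo,
    ENNReal.toReal_ofReal (sub_pos.2 hab).le]

theorem setIntegral_Ioo_le_of_ae {f : ℝ → ℝ} (hf : Integrable f) {a b c : ℝ} (hab : a < b)
    {N : Set ℝ} (hN : ∀ᵐ t, t ∈ N) (h : ∀ t ∈ N, a < t → t < b → ∫ τ in Ioo a t, f τ ≤ c) :
    ∫ τ in Ioo a b, f τ ≤ c := by
  have e (t : ℝ) (ht : a < t) : ∫ τ in Ioo a t, f τ = ∫ τ in a..t, f τ := by
    rw [intervalIntegral.integral_of_le ht.le, integral_Ioc_eq_integral_Ioo]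
  have hc : Continuous fun t => ∫ τ in a..t, f τ :=
    intervalIntegral.continuous_primitive (fun _ _ => hf.intervalIntegrable) a
  by_contra! hlt
  rw [e b hab] at hlt
  have hU : IsOpen ({t | c < ∫ τ in a..t, f τ} ∩ Ioo a b) :=
    (isOpen_lt continuous_const hc).inter isOpen_Ioo
  have hne : ({t | c < ∫ τ in a..t, f τ} ∩ Ioo a b).Nonempty := by
    have hb : b ∈ closure (Ioo a b) := by
      rw [closure_Ioo hab.ne]; exact ⟨hab.le, le_rfl⟩
    exact mem_closure_iff.1 hb _ (isOpen_lt continuous_const hc) hlt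
  obtain ⟨t, ⟨ht, ht'⟩, htN⟩ := (Measure.dense_of_ae hN).inter_open_nonempty _ hU hne
  have := h t htN ht'.1 ht'.2
  rw [e t ht'.1] at this
  exact absurd ht (not_lt.2 this)

/-- The constant in the lower bound for the tested form. -/
def formConst (d : ℕ) (s Λ : ℝ) : ℝ := 4 * Λ ^ 4 + 2 * Λ ^ 2 * fracConst d s + 4 * Λ ^ 2

theorem formConst_nonneg (d : ℕ) (s Λ : ℝ) : 0 ≤ formConst d s Λ := by
  have := fracConst_nonneg d s
  rw [formConst]; positivity

namespace CylinderSetting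

variable {s Λ α β ρ' ρ : ℝ} {x₀ : Ed d} {J : Set ℝ} {Ω : Set (Ed d)}
  {A : ℝ → Ed d → Ed d → Ed d} {K : ℝ → Ed d → Ed d → ℝ} {v : ℝ → Ed d → ℝ}
  {Dv : ℝ → Ed d → Ed d} {η : Ed d → ℝ} {M r : ℝ}

/-- The squared `L²` norm of `(v - l)₊` on the ball of radius `ρ`. -/
def truncMass (_ : CylinderSetting d s Λ α β ρ' ρ x₀ J Ω A K v Dv) (l τ : ℝ) : ℝ :=
  ∫ x in Metric.ball x₀ ρ, (max (v τ x - l) 0) ^ 2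

/-- The product of the `L¹` norm of `(v - l)₊` on the ball with its nonlocal tail. -/
def truncTail (_ : CylinderSetting d s Λ α β ρ' ρ x₀ J Ω A K v Dv) (l τ : ℝ) : ℝ :=
  (∫ x in Metric.ball x₀ ρ, max (v τ x - l) 0) * Tail s (fun y => max (v τ y - l) 0) x₀ ρ

theorem truncMass_nonneg (h : CylinderSetting d s Λ α β ρ' ρ x₀ J Ω A K v Dv) (l τ : ℝ) :
    0 ≤ h.truncMass l τ :=
  integral_nonneg fun _ => sq_nonneg _

theorem truncTail_nonneg (h : CylinderSetting d s Λ α β ρ' ρ x₀ J Ω A K v Dv) (l τ : ℝ) :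
    0 ≤ h.truncTail l τ :=
  mul_nonneg (integral_nonneg fun _ => le_max_right _ _) (Tail_nonneg _ _ _ _)

theorem integrableOn_truncMass (h : CylinderSetting d s Λ α β ρ' ρ x₀ J Ω A K v Dv) (l : ℝ) :
    IntegrableOn (h.truncMass l) (Ioo α β) := by
  have hv : Measurable fun p : ℝ × Ed d => v p.1 p.2 := h.reg.meas
  have h1 : IntegrableOn (fun p : ℝ × Ed d => (max (v p.1 p.2 - l) 0) ^ 2)
      (Ioo α β ×ˢ closedBall x₀ (2 * ρ)) := by
    refine (h.memLp_abs_add_const l).integrable_sq.mono'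
      (Measurable.aestronglyMeasurable (by fun_prop)) (Eventually.of_forall fun p => ?_)
    rw [Real.norm_of_nonneg (sq_nonneg _), ← sq_abs (max _ _)]
    exact pow_le_pow_left₀ (abs_nonneg _) (abs_max_sub_le _ _) 2
  have h2 := h1.mono_set (prod_mono_right (ball_subset_closedBall.trans
      (closedBall_subset_closedBall (by linarith [h.radius_pos'] : ρ ≤ 2 * ρ))))
  rw [IntegrableOn, Measure.volume_eq_prod, ← Measure.prod_restrict] at h2
  exact h2.integral_prod_left

theorem integrableOn_truncTail (h : CylinderSetting d s Λ α β ρ' ρ x₀ J Ω A K v Dv) (l : ℝ) :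
    IntegrableOn (h.truncTail l) (Ioo α β) := by
  have hv : Measurable fun p : ℝ × Ed d => v p.1 p.2 := h.reg.meas
  obtain ⟨c, hc, hT⟩ := h.exists_tail_bound l
  set t : ℝ → ℝ := fun τ => ∫ y, |v τ y| / (1 + ‖y‖ ^ ((d : ℝ) + 2 * s)) with ht
  have hm1 : Measurable fun τ => ∫ x in Metric.ball x₀ ρ, max (v τ x - l) 0 := by
    have h1 : Measurable fun p : ℝ × Ed d => max (v p.1 p.2 - l) 0 := by fun_prop
    exact h1.stronglyMeasurable.integral_prod_right'.measurable
  have hm2 : Measurable fun τ => Tail s (fun y => max (v τ y - l) 0) x₀ ρ := by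
    have h1 : Measurable fun p : ℝ × Ed d =>
        |max (v p.1 p.2 - l) 0| / ‖x₀ - p.2‖ ^ ((d : ℝ) + 2 * s) := by fun_prop
    exact h1.stronglyMeasurable.integral_prod_right'.measurable.const_mul _
  set m := volume.real (Metric.ball x₀ ρ)
  have : IsFiniteMeasure (volume.restrict (Metric.ball x₀ ρ)) :=
    isFiniteMeasure_restrict.2 measure_ball_lt_top.ne
  have hb : IntegrableOn (fun τ => 2⁻¹ * h.truncMass l τ + m * (c ^ 2 * (1 + t τ ^ 2)))
      (Ioo α β) := by
    refine ((h.integrableOn_truncMass l).const_mul _).add (Integrable.const_mul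
      (Integrable.const_mul ((integrable_const 1).add (h.reg.tail_l2 α β h.time)) _) _)
  refine hb.mono' (hm1.mul hm2).aestronglyMeasurable ?_
  filter_upwards [ae_restrict_mem measurableSet_Ioo, ae_restrict_of_ae hT,
    ae_restrict_of_ae (h.ae_memLp_trunc l)] with τ hτ hT hw
  rw [Real.norm_of_nonneg (h.truncTail_nonneg l τ), truncTail, ← integral_mul_const]
  set θ := Tail s (fun y => max (v τ y - l) 0) x₀ ρ
  have hθ0 : 0 ≤ θ := Tail_nonneg _ _ _ _
  have hθ : θ ^ 2 ≤ c ^ 2 * (1 + t τ) ^ 2 := by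
    rw [← mul_pow]; exact pow_le_pow_left₀ hθ0 (hT hτ).2 2
  calc ∫ x in Metric.ball x₀ ρ, max (v τ x - l) 0 * θ
      ≤ ∫ x in Metric.ball x₀ ρ, (2⁻¹ * (max (v τ x - l) 0) ^ 2 + 2⁻¹ * θ ^ 2) := by
        refine integral_mono (((hw hτ).integrable one_le_two).mul_const _)
          (((hw hτ).integrable_sq.const_mul _).add (integrable_const _)) fun x => ?_
        simp only
        nlinarith [sq_nonneg (max (v τ x - l) 0 - θ)]
    _ = 2⁻¹ * h.truncMass l τ + m * (2⁻¹ * θ ^ 2) := by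
        rw [integral_add ((hw hτ).integrable_sq.const_mul _) (integrable_const _),
          integral_const_mul, setIntegral_const, smul_eq_mul, truncMass]
    _ ≤ _ := by
        refine add_le_add le_rfl (mul_le_mul_of_nonneg_left ?_ measureReal_nonneg)
        nlinarith [mul_nonneg (sq_nonneg c) (sq_nonneg (1 - t τ))]

/-- The tested form together with its lower order corrections. -/
def formBound (h : CylinderSetting d s Λ α β ρ' ρ x₀ J Ω A K v Dv) (η : Ed d → ℝ) (M l τ : ℝ) : ℝ :=
  2 * Λ * h.truncForm η l τ + formConst d s Λ * (M ^ 2 * h.truncMass l τ +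
    (ρ / (ρ - ρ')) ^ ((d : ℝ) + 2 * s) * (ρ ^ 2)⁻¹ * h.truncTail l τ)

theorem ae_le_formBound (h : CylinderSetting d s Λ α β ρ' ρ x₀ J Ω A K v Dv)
    (hη : IsCutoff (closedBall x₀ ρ') η) (l : ℝ) (hr : r ≤ ρ)
    (h1 : ∀ x ∈ Metric.ball x₀ r, η x = 1) (hM : ∀ x, ‖gradient η x‖ ≤ M) (hM1 : 1 ≤ M) :
    ∀ᵐ τ, τ ∈ Ioo α β →
      (∫ x in Metric.ball x₀ r, ‖truncGradPos v Dv l τ x‖ ^ 2) ≤ h.formBound η M l τ ∧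
      (∫ x in Metric.ball x₀ r, ∫ y in Metric.ball x₀ r,
        (max (v τ x - l) 0 - max (v τ y - l) 0) ^ 2 / ‖x - y‖ ^ ((d : ℝ) + 2 * s)) ≤
        h.formBound η M l τ ∧
      (∫ x in Metric.ball x₀ r, ∫ y in Metric.ball x₀ r,
        max (v τ x - l) 0 * max (l - v τ y) 0 / (2 * r) ^ ((d : ℝ) + 2 * s)) ≤
        h.formBound η M l τ := by
  filter_upwards [h.ae_flux_lower_bound hη l hr h1 hM, h.ae_near_lower_bound hη l hr h1 hM hM1,
    h.ae_far_lower_bound hη l] with τ hF hN hT hτ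
  have hΛ := h.one_le
  replace hF := hF hτ
  obtain ⟨hS, hX⟩ := hN hτ
  replace hT := hT hτ
  have hρ := h.radius_pos'
  have hκ : 0 ≤ ρ / (ρ - ρ') := div_nonneg hρ.le (sub_pos.2 h.radius_lt).le
  have hκp : 0 ≤ (ρ / (ρ - ρ')) ^ ((d : ℝ) + 2 * s) * (ρ ^ 2)⁻¹ := by positivity
  have hW := h.truncMass_nonneg l τ
  have hP := h.truncTail_nonneg l τ
  have hFC := fracConst_nonneg d s
  rw [formBound, truncForm, FormFields.form, formConst]
  change _ ≤ 2 * Λ * ((∫ x, ⟪h.flux (τ, x), h.truncGrad η l (τ, x)⟫) +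
    (∫ p, ⟪h.near (τ, p), fracDiff s (fun x => h.truncFun η l (τ, x)) p⟫) +
    ∫ x, ⟪h.far (τ, x), h.truncFun η l (τ, x)⟫) + _ ∧ _ ≤ 2 * Λ * ((∫ x, ⟪h.flux (τ, x),
      h.truncGrad η l (τ, x)⟫) +
    (∫ p, ⟪h.near (τ, p), fracDiff s (fun x => h.truncFun η l (τ, x)) p⟫) +
    ∫ x, ⟪h.far (τ, x), h.truncFun η l (τ, x)⟫) + _ ∧ _ ≤ 2 * Λ * ((∫ x, ⟪h.flux (τ, x),
      h.truncGrad η l (τ, x)⟫) +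
    (∫ p, ⟪h.near (τ, p), fracDiff s (fun x => h.truncFun η l (τ, x)) p⟫) +
    ∫ x, ⟪h.far (τ, x), h.truncFun η l (τ, x)⟫) + _
  have hD0 : 0 ≤ ∫ x in Metric.ball x₀ r, ‖truncGradPos v Dv l τ x‖ ^ 2 :=
    integral_nonneg fun _ => sq_nonneg _
  have hS0 : 0 ≤ ∫ x in Metric.ball x₀ r, ∫ y in Metric.ball x₀ r,
      (max (v τ x - l) 0 - max (v τ y - l) 0) ^ 2 / ‖x - y‖ ^ ((d : ℝ) + 2 * s) :=
    integral_nonneg fun _ => integral_nonneg fun _ => by positivity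
  have hX0 : 0 ≤ ∫ x in Metric.ball x₀ r, ∫ y in Metric.ball x₀ r,
      max (v τ x - l) 0 * max (l - v τ y) 0 / (2 * r) ^ ((d : ℝ) + 2 * s) := by
    rcases (Metric.ball x₀ r).eq_empty_or_nonempty with he | ⟨z, hz⟩
    · simp [he]
    have hr0 : 0 < r := pos_of_mem_ball hz
    refine integral_nonneg fun x => integral_nonneg fun y => ?_
    have := le_max_right (v τ x - l) 0
    have := le_max_right (l - v τ y) 0
    positivity
  have eW : ∫ x in Metric.ball x₀ ρ, (max (v τ x - l) 0) ^ 2 = h.truncMass l τ := rfl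
  have eP : (∫ x in Metric.ball x₀ ρ, max (v τ x - l) 0) *
      Tail s (fun y => max (v τ y - l) 0) x₀ ρ = h.truncTail l τ := rfl
  rw [eW] at hF hS hX
  rw [eP] at hT
  set κ := (ρ / (ρ - ρ')) ^ ((d : ℝ) + 2 * s) * (ρ ^ 2)⁻¹
  set W := h.truncMass l τ
  set P := h.truncTail l τ
  have e : 2 * Λ * (ρ / (ρ - ρ')) ^ ((d : ℝ) + 2 * s) * (ρ ^ 2)⁻¹ = 2 * Λ * κ := by ring
  rw [e] at hT
  have hT' := mul_le_mul_of_nonneg_left hT (by positivity : 0 ≤ 2 * Λ)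
  have p1 : 0 ≤ Λ ^ 4 * (κ * P) := by positivity
  have p2 : 0 ≤ Λ ^ 2 * fracConst d s * (κ * P) := by positivity
  have p3 : 0 ≤ Λ ^ 2 * (M ^ 2 * W) := by positivity
  refine ⟨?_, ?_, ?_⟩ <;> nlinarith

end CylinderSetting

namespace CylinderSetting

variable {s Λ α β ρ' ρ : ℝ} {x₀ : Ed d} {J : Set ℝ} {Ω : Set (Ed d)}
  {A : ℝ → Ed d → Ed d → Ed d} {K : ℝ → Ed d → Ed d → ℝ} {v : ℝ → Ed d → ℝ}
  {Dv : ℝ → Ed d → Ed d} {η : Ed d → ℝ} {M r a b : ℝ}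

theorem integrableOn_formBound (h : CylinderSetting d s Λ α β ρ' ρ x₀ J Ω A K v Dv)
    (hη : IsCutoff (closedBall x₀ ρ') η) (M l : ℝ) :
    IntegrableOn (h.formBound η M l) (Ioo α β) :=
  ((h.integrable_truncForm hη l).integrableOn.const_mul _).add
    ((((h.integrableOn_truncMass l).const_mul _).add
      ((h.integrableOn_truncTail l).const_mul _)).const_mul _)

theorem truncEnergy_nonneg (h : CylinderSetting d s Λ α β ρ' ρ x₀ J Ω A K v Dv) (η : Ed d → ℝ)
    (l : ℝ) (p : ℝ × Ed d) : 0 ≤ h.truncEnergy η l p :=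
  indicator_nonneg (fun _ _ => by positivity) _

theorem ae_truncEnergy_bounds (h : CylinderSetting d s Λ α β ρ' ρ x₀ J Ω A K v Dv)
    (hη : IsCutoff (closedBall x₀ ρ') η) (l : ℝ) (h1 : ∀ x ∈ Metric.ball x₀ r, η x = 1) :
    ∀ᵐ t, t ∈ Ioo α β →
      (∫ x in Metric.ball x₀ r, (max (v t x - l) 0) ^ 2) ≤ 2 * ∫ x, h.truncEnergy η l (t, x) ∧
      ∫ x, h.truncEnergy η l (t, x) ≤ 2⁻¹ * h.truncMass l t := by
  have hI := h.integrable_truncEnergy hη l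
  rw [Measure.volume_eq_prod] at hI
  filter_upwards [hI.prod_right_ae, h.ae_integrable_sq_trunc l] with t hE hw ht
  have e (x : Ed d) : h.truncEnergy η l (t, x) = 2⁻¹ * (η x * max (v t x - l) 0) ^ 2 := by
    rw [truncEnergy, indicator_of_mem ht]
  constructor
  · rw [← integral_const_mul]
    refine le_trans (le_of_eq ?_) (setIntegral_le_integral (s := Metric.ball x₀ r)
      (hE.const_mul 2) (Eventually.of_forall fun x =>
        mul_nonneg zero_le_two (h.truncEnergy_nonneg _ _ _)))
    refine setIntegral_congr_fun measurableSet_ball fun x hx => ?_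
    simp only [e, h1 x hx]
    ring
  · rw [truncMass, ← integral_const_mul, ← integral_indicator measurableSet_ball]
    refine integral_mono hE ((integrable_indicator_iff measurableSet_ball).2
      ((hw ht).const_mul _)) fun x => ?_
    by_cases hx : x ∈ Metric.ball x₀ ρ
    · rw [indicator_of_mem hx, e, mul_pow]
      have := mul_le_mul_of_nonneg_right (hη.sq_le_one x) (sq_nonneg (max (v t x - l) 0))
      linarith
    · rw [indicator_of_notMem hx, e, hη.eq_zero fun h' =>
        hx (closedBall_subset_ball h.radius_lt h')]
      simp

/-- The quantity bounding all energies of `(v - l)₊`, for a cutoff in time between `a` and `b`. -/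
def energyBound (h : CylinderSetting d s Λ α β ρ' ρ x₀ J Ω A K v Dv) (M l a b : ℝ) : ℝ :=
  Λ * (b - a)⁻¹ * (∫ τ in Ioo a β, h.truncMass l τ) +
    formConst d s Λ * (M ^ 2 * (∫ τ in Ioo a β, h.truncMass l τ) +
      (ρ / (ρ - ρ')) ^ ((d : ℝ) + 2 * s) * (ρ ^ 2)⁻¹ * ∫ τ in Ioo a β, h.truncTail l τ)

theorem setIntegral_formBound_le (h : CylinderSetting d s Λ α β ρ' ρ x₀ J Ω A K v Dv)
    (hη : IsCutoff (closedBall x₀ ρ') η) (M l : ℝ) (ha : α ≤ a) {t₁ t₂ : ℝ} (h1 : a ≤ t₁)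
    (h2 : t₂ ≤ β) :
    ∫ τ in Ioo t₁ t₂, h.formBound η M l τ ≤ 2 * Λ * (∫ τ in Ioo t₁ t₂, h.truncForm η l τ) +
      formConst d s Λ * (M ^ 2 * (∫ τ in Ioo a β, h.truncMass l τ) +
      (ρ / (ρ - ρ')) ^ ((d : ℝ) + 2 * s) * (ρ ^ 2)⁻¹ * ∫ τ in Ioo a β, h.truncTail l τ) := by
  have hs1 : Ioo t₁ t₂ ⊆ Ioo a β := Ioo_subset_Ioo h1 h2
  have hs2 : Ioo a β ⊆ Ioo α β := Ioo_subset_Ioo_left ha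
  have iW := (h.integrableOn_truncMass l).mono_set hs2
  have iP := (h.integrableOn_truncTail l).mono_set hs2
  have jW := iW.mono_set hs1
  have jP := iP.mono_set hs1
  have hW := setIntegral_mono_set iW (Eventually.of_forall (h.truncMass_nonneg l))
    (LE.le.eventuallyLE hs1)
  have hP := setIntegral_mono_set iP (Eventually.of_forall (h.truncTail_nonneg l))
    (LE.le.eventuallyLE hs1)
  have hρ := h.radius_pos'
  have hκ : 0 ≤ ρ / (ρ - ρ') := div_nonneg hρ.le (sub_pos.2 h.radius_lt).le
  have hc := formConst_nonneg d s Λ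
  have e : ∫ τ in Ioo t₁ t₂, h.formBound η M l τ =
      2 * Λ * (∫ τ in Ioo t₁ t₂, h.truncForm η l τ) +
      formConst d s Λ * (M ^ 2 * (∫ τ in Ioo t₁ t₂, h.truncMass l τ) +
      (ρ / (ρ - ρ')) ^ ((d : ℝ) + 2 * s) * (ρ ^ 2)⁻¹ * ∫ τ in Ioo t₁ t₂, h.truncTail l τ) := by
    have e1 := integral_add (jW.const_mul (M ^ 2))
      (jP.const_mul ((ρ / (ρ - ρ')) ^ ((d : ℝ) + 2 * s) * (ρ ^ 2)⁻¹))
    rw [integral_const_mul, integral_const_mul] at e1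
    rw [← e1, ← integral_const_mul, ← integral_const_mul]
    exact integral_add ((h.integrable_truncForm hη l).integrableOn.const_mul _)
      (((jW.const_mul _).add (jP.const_mul _)).const_mul _)
  rw [e]
  gcongr

theorem exists_initial_time (h : CylinderSetting d s Λ α β ρ' ρ x₀ J Ω A K v Dv)
    (hsub : IsLocalWeakSubsolutionHom A K J Ω v Dv) (hη : IsCutoff (closedBall x₀ ρ') η) (l : ℝ)
    (M : ℝ) (ha : α ≤ a) (hab : a < b) (hb : b < β) :
    ∃ t₁ ∈ Ioo a b, (∫ τ in Ioo t₁ β, h.formBound η M l τ) ≤ h.energyBound M l a b ∧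
      ∀ᵐ t, t ∈ Ioo t₁ β → 2 * Λ * (∫ x, h.truncEnergy η l (t, x)) +
        (∫ τ in Ioo t₁ t, h.formBound η M l τ) ≤ h.energyBound M l a b := by
  have hΛ : 0 < Λ := one_pos.trans_le h.one_le
  obtain ⟨N, hN, hE⟩ := h.truncated_energy_inequality hsub hη l
  have hs2 : Ioo a β ⊆ Ioo α β := Ioo_subset_Ioo_left ha
  have iW := (h.integrableOn_truncMass l).mono_set hs2
  have hp : ∀ᵐ t, t ∈ N ∧ (t ∈ Ioo α β → ∫ x, h.truncEnergy η l (t, x) ≤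
      2⁻¹ * h.truncMass l t) := by
    filter_upwards [hN, h.ae_truncEnergy_bounds (r := 0) hη l (by simp)] with t h1 h2
    exact ⟨h1, fun ht => (h2 ht).2⟩
  obtain ⟨t₁, ht, ⟨htN, hg⟩, hav⟩ := exists_mem_le_setAverage hab
    (iW.mono_set (Ioo_subset_Ioo_right hb.le)) hp
  replace hg := hg ⟨ha.trans_lt ht.1, ht.2.trans hb⟩
  have hW := setIntegral_mono_set iW (Eventually.of_forall (h.truncMass_nonneg l))
    (LE.le.eventuallyLE (Ioo_subset_Ioo_right hb.le : Ioo a b ⊆ Ioo a β))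
  have hg2 : 2 * Λ * ∫ x, h.truncEnergy η l (t₁, x) ≤
      Λ * (b - a)⁻¹ * (∫ τ in Ioo a β, h.truncMass l τ) := by
    have h3 : h.truncMass l t₁ ≤ (b - a)⁻¹ * ∫ τ in Ioo a β, h.truncMass l τ :=
      hav.trans (mul_le_mul_of_nonneg_left hW (inv_nonneg.2 (sub_pos.2 hab).le))
    calc 2 * Λ * ∫ x, h.truncEnergy η l (t₁, x) ≤ 2 * Λ * (2⁻¹ * h.truncMass l t₁) := by gcongr
      _ = Λ * h.truncMass l t₁ := by ring
      _ ≤ Λ * ((b - a)⁻¹ * ∫ τ in Ioo a β, h.truncMass l τ) := by gcongr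
      _ = _ := by ring
  refine ⟨t₁, ht, ?_, ?_⟩
  · have h4 := setIntegral_Ioo_le_of_ae (h.integrable_truncForm hη l) (ht.2.trans hb) hN
      (c := ∫ x, h.truncEnergy η l (t₁, x)) fun t htN' h1 h2 => by
        have := hE t₁ htN t htN' (ha.trans_lt ht.1) h1 h2
        have h0 : 0 ≤ ∫ x, h.truncEnergy η l (t, x) :=
          integral_nonneg fun x => h.truncEnergy_nonneg _ _ _
        linarith
    have h5 := h.setIntegral_formBound_le hη M l ha ht.1.le le_rfl
    have h6 := mul_le_mul_of_nonneg_left h4 (by positivity : 0 ≤ 2 * Λ)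
    rw [energyBound]
    linarith
  · filter_upwards [hN] with t htN' ht'
    have h4 := hE t₁ htN t htN' (ha.trans_lt ht.1) ht'.1 ht'.2
    have h5 := h.setIntegral_formBound_le hη M l ha ht.1.le ht'.2.le
    have h6 := mul_le_mul_of_nonneg_left h4 (by positivity : 0 ≤ 2 * Λ)
    rw [energyBound]
    linarith

theorem setIntegral_le_energyBound (h : CylinderSetting d s Λ α β ρ' ρ x₀ J Ω A K v Dv)
    (hη : IsCutoff (closedBall x₀ ρ') η) {l : ℝ} (ha : α ≤ a) {t₁ : ℝ} (ht : t₁ ∈ Ioo a b)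
    {f : ℝ → ℝ} (hf0 : ∀ τ, 0 ≤ f τ) (hf : ∀ᵐ τ, τ ∈ Ioo α β → f τ ≤ h.formBound η M l τ)
    (hF : (∫ τ in Ioo t₁ β, h.formBound η M l τ) ≤ h.energyBound M l a b) :
    ∫ τ in Ioo b β, f τ ≤ h.energyBound M l a b := by
  have hs1 : Ioo t₁ β ⊆ Ioo α β := Ioo_subset_Ioo_left (ha.trans ht.1.le)
  have hs2 : Ioo b β ⊆ Ioo t₁ β := Ioo_subset_Ioo_left ht.2.le
  have iF := (h.integrableOn_formBound hη M l).mono_set hs1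
  have hf1 : ∀ᵐ τ ∂volume.restrict (Ioo t₁ β), f τ ≤ h.formBound η M l τ := by
    rw [ae_restrict_iff' measurableSet_Ioo]
    filter_upwards [hf] with τ h1 h2 using h1 (hs1 h2)
  refine (integral_mono_of_nonneg (Eventually.of_forall hf0) (iF.mono_set hs2)
    (ae_restrict_of_ae_restrict_of_subset hs2 hf1)).trans
    ((setIntegral_mono_set iF ?_ (LE.le.eventuallyLE hs2)).trans hF)
  filter_upwards [hf1] with τ h1 using (hf0 τ).trans h1

theorem energy_bounds (h : CylinderSetting d s Λ α β ρ' ρ x₀ J Ω A K v Dv)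
    (hsub : IsLocalWeakSubsolutionHom A K J Ω v Dv) (hη : IsCutoff (closedBall x₀ ρ') η) (l : ℝ)
    (hr0 : 0 ≤ r) (hr : r ≤ ρ) (h1 : ∀ x ∈ Metric.ball x₀ r, η x = 1)
    (hM : ∀ x, ‖gradient η x‖ ≤ M) (hM1 : 1 ≤ M) (ha : α ≤ a) (hab : a < b) (hb : b < β) :
    (∀ᵐ t, t ∈ Ioo b β →
      ∫ x in Metric.ball x₀ r, (max (v t x - l) 0) ^ 2 ≤ h.energyBound M l a b) ∧
    (∫ τ in Ioo b β, ∫ x in Metric.ball x₀ r, ‖truncGradPos v Dv l τ x‖ ^ 2) ≤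
      h.energyBound M l a b ∧
    (∫ τ in Ioo b β, ∫ x in Metric.ball x₀ r, ∫ y in Metric.ball x₀ r,
      (max (v τ x - l) 0 - max (v τ y - l) 0) ^ 2 / ‖x - y‖ ^ ((d : ℝ) + 2 * s)) ≤
      h.energyBound M l a b ∧
    (∫ τ in Ioo b β, ∫ x in Metric.ball x₀ r, ∫ y in Metric.ball x₀ r,
      max (v τ x - l) 0 * max (l - v τ y) 0 / (2 * r) ^ ((d : ℝ) + 2 * s)) ≤
      h.energyBound M l a b := by
  have hΛ := h.one_le
  obtain ⟨t₁, ht, hF, hE⟩ := h.exists_initial_time hsub hη l M ha hab hb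
  have hB := h.ae_le_formBound hη l hr h1 hM hM1
  refine ⟨?_, h.setIntegral_le_energyBound hη ha ht (fun τ => ?_) (hB.mono fun τ h2 h3 =>
    (h2 h3).1) hF, h.setIntegral_le_energyBound hη ha ht (fun τ => ?_) (hB.mono fun τ h2 h3 =>
    (h2 h3).2.1) hF, h.setIntegral_le_energyBound hη ha ht (fun τ => ?_) (hB.mono fun τ h2 h3 =>
    (h2 h3).2.2) hF⟩
  · filter_upwards [hE, h.ae_truncEnergy_bounds hη l h1] with t h2 h3 ht'
    have hF0 : 0 ≤ ∫ τ in Ioo t₁ t, h.formBound η M l τ := by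
      refine integral_nonneg_of_ae ?_
      refine (ae_restrict_iff' measurableSet_Ioo).2 (hB.mono fun τ h4 h5 => ?_)
      exact (integral_nonneg fun _ => sq_nonneg _).trans
        (h4 ⟨(ha.trans_lt ht.1).trans h5.1, h5.2.trans ht'.2⟩).1
    have h5 := (h3 ⟨(ha.trans_lt hab).trans ht'.1, ht'.2⟩).1
    have h6 := h2 ⟨ht.2.trans ht'.1, ht'.2⟩
    have hg0 : 0 ≤ ∫ x, h.truncEnergy η l (t, x) :=
      integral_nonneg fun x => h.truncEnergy_nonneg _ _ _
    nlinarith [mul_nonneg (sub_nonneg.2 hΛ) hg0]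
  · exact integral_nonneg fun _ => sq_nonneg _
  · exact integral_nonneg fun _ => integral_nonneg fun _ => by positivity
  · refine integral_nonneg fun x => integral_nonneg fun y => ?_
    have := le_max_right (v τ x - l) 0
    have := le_max_right (l - v τ y) 0
    positivity

end CylinderSetting

theorem exists_abs_deriv_smoothTransition_le :
    ∃ L : ℝ, 0 ≤ L ∧ (∀ z, |deriv Real.smoothTransition z| ≤ L) ∧
      ∀ z < 0, deriv Real.smoothTransition z = 0 := by
  have hc : Continuous (deriv Real.smoothTransition) :=
    (Real.smoothTransition.contDiff (n := 1)).continuous_deriv le_rfl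
  have h0 : ∀ z < 0, deriv Real.smoothTransition z = 0 := fun z hz => by
    have : Real.smoothTransition =ᶠ[𝓝 z] fun _ => 0 := by
      filter_upwards [gt_mem_nhds hz] with y hy using Real.smoothTransition.zero_of_nonpos hy.le
    rw [this.deriv_eq, deriv_const]
  have h1 : ∀ z, 1 < z → deriv Real.smoothTransition z = 0 := fun z hz => by
    have : Real.smoothTransition =ᶠ[𝓝 z] fun _ => 1 := by
      filter_upwards [lt_mem_nhds hz] with y hy using Real.smoothTransition.one_of_one_le hy.le
    rw [this.deriv_eq, deriv_const]
  obtain ⟨L, hL⟩ := isCompact_Icc.exists_bound_of_continuousOn (s := Icc (0 : ℝ) 1) hc.continuousOn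
  have hL0 : 0 ≤ L := (norm_nonneg _).trans (hL 0 (by simp))
  refine ⟨L, hL0, fun z => ?_, h0⟩
  rcases lt_or_ge z 0 with hz | hz
  · simpa [h0 z hz] using hL0
  rcases lt_or_ge 1 z with hz' | hz'
  · simpa [h1 z hz'] using hL0
  exact hL z ⟨hz, hz'⟩

theorem exists_isCutoff (d : ℕ) : ∃ c : ℝ, 1 ≤ c ∧ ∀ (x₀ : Ed d) (r ρ' : ℝ), 0 < r → r < ρ' →
    ∃ η : Ed d → ℝ, IsCutoff (closedBall x₀ ρ') η ∧ (∀ x ∈ Metric.ball x₀ r, η x = 1) ∧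
      ∀ x, ‖gradient η x‖ ≤ c / (ρ' - r) := by
  obtain ⟨L, hL0, hL, hneg⟩ := exists_abs_deriv_smoothTransition_le
  refine ⟨max 1 (2 * L), le_max_left _ _, fun x₀ r ρ' hr hρ => ?_⟩
  have hδ : 0 < ρ' ^ 2 - r ^ 2 := by nlinarith
  set q : Ed d → ℝ := fun x => (ρ' ^ 2 - ‖x - x₀‖ ^ 2) / (ρ' ^ 2 - r ^ 2) with hq
  have hqs : ContDiff ℝ (⊤ : ℕ∞) q := by
    exact (contDiff_const.sub ((contDiff_id.sub contDiff_const).norm_sq ℝ)).div_const _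
  refine ⟨fun x => Real.smoothTransition (q x), ⟨Real.smoothTransition.contDiff.comp hqs,
    fun x => Real.smoothTransition.nonneg _, fun x => Real.smoothTransition.le_one _, ?_⟩, ?_, ?_⟩
  · refine closure_minimal (fun x hx => ?_) isClosed_closedBall
    by_contra hx'
    rw [mem_closedBall, dist_eq_norm, not_le] at hx'
    refine hx (Real.smoothTransition.zero_of_nonpos (div_nonpos_of_nonpos_of_nonneg ?_ hδ.le))
    nlinarith
  · intro x hx
    rw [mem_ball, dist_eq_norm] at hx
    refine Real.smoothTransition.one_of_one_le ((one_le_div hδ).2 ?_)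
    nlinarith [norm_nonneg (x - x₀)]
  · intro x
    have hqd : HasFDerivAt q (-(2 / (ρ' ^ 2 - r ^ 2)) • innerSL ℝ (x - x₀)) x := by
      have h1 := ((hasFDerivAt_id x).sub_const x₀).norm_sq
      have h2 := (h1.const_sub (ρ' ^ 2)).mul_const (ρ' ^ 2 - r ^ 2)⁻¹
      refine (h2.congr_fderiv ?_)
      ext y
      simp
      ring
    have hd := ((Real.smoothTransition.contDiff (n := 1)).differentiable one_ne_zero
      (q x)).hasDerivAt.comp_hasFDerivAt x hqd
    rw [norm_gradient_eq, show fderiv ℝ (fun x => Real.smoothTransition (q x)) x = _ from hd.fderiv,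
      norm_smul, norm_smul, norm_neg, innerSL_apply_norm, Real.norm_eq_abs, Real.norm_of_nonneg
      (by positivity : 0 ≤ 2 / (ρ' ^ 2 - r ^ 2))]
    rcases le_or_gt ‖x - x₀‖ ρ' with hx | hx
    · have h3 : 2 / (ρ' ^ 2 - r ^ 2) * ‖x - x₀‖ ≤ 2 / (ρ' - r) := by
        rw [div_mul_eq_mul_div, div_le_div_iff₀ hδ (sub_pos.2 hρ)]
        nlinarith [mul_nonneg (norm_nonneg (x - x₀)) (sub_pos.2 hρ).le,
          mul_nonneg (sub_nonneg.2 hx) (sub_pos.2 hρ).le, mul_pos hr (sub_pos.2 hρ)]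
      calc _ ≤ L * (2 / (ρ' - r)) := mul_le_mul (hL _) h3 (by positivity) hL0
        _ = 2 * L / (ρ' - r) := by ring
        _ ≤ _ := div_le_div_of_nonneg_right (le_max_right _ _) (sub_pos.2 hρ).le
    · rw [hneg _ (div_neg_of_neg_of_pos (by nlinarith) hδ), abs_zero, zero_mul]
      exact div_nonneg (zero_le_one.trans (le_max_left _ _)) (sub_pos.2 hρ).le

/-- The constant in the Caccioppoli inequality for a cutoff with gradient constant `c`. -/
def caccConst (d : ℕ) (s Λ c : ℝ) : ℝ :=
  (3 + 2 ^ (d + 2)) * (Λ + formConst d s Λ * (4 * c ^ 2 + 2 ^ (d + 2)))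

theorem rpow_div_le {ρ ρ₂ p : ℝ} {d : ℕ} (hρ₂ : 0 < ρ₂) (hρ : ρ₂ ≤ ρ) (hp : p ≤ d + 2) :
    (ρ / (ρ₂ / 2)) ^ p * (ρ ^ 2)⁻¹ ≤ 2 ^ (d + 2) * ((ρ / ρ₂) ^ d / ρ₂ ^ 2) := by
  have hρ0 := hρ₂.trans_le hρ
  have h1 : 1 ≤ ρ / (ρ₂ / 2) := by rw [one_le_div (by positivity)]; linarith
  calc (ρ / (ρ₂ / 2)) ^ p * (ρ ^ 2)⁻¹
      ≤ (ρ / (ρ₂ / 2)) ^ ((d + 2 : ℕ) : ℝ) * (ρ ^ 2)⁻¹ := by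
        gcongr
        push_cast; exact hp
    _ = 2 ^ (d + 2) * ((ρ / ρ₂) ^ d / ρ₂ ^ 2) := by
        rw [Real.rpow_natCast, div_div_eq_mul_div, mul_div_right_comm, mul_pow, pow_add (ρ / ρ₂)]
        field_simp

theorem CylinderSetting.energyBound_le {s Λ α r ρ₁ ρ₂ t₀ c : ℝ} {x₀ : Ed d} {J : Set ℝ}
    {Ω : Set (Ed d)} {A : ℝ → Ed d → Ed d → Ed d} {K : ℝ → Ed d → Ed d → ℝ} {v : ℝ → Ed d → ℝ}
    {Dv : ℝ → Ed d → Ed d}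
    (h : CylinderSetting d s Λ α t₀ (r + ρ₂ / 2) (r + ρ₂) x₀ J Ω A K v Dv)
    (hr : 0 < r) (hρ₁ : 0 < ρ₁) (hρ₂ : 0 < ρ₂) (l : ℝ) :
    h.energyBound (c / (r + ρ₂ / 2 - r)) l (t₀ - (r + ρ₁) ^ 2) (t₀ - r ^ 2) ≤
      (Λ + formConst d s Λ * (4 * c ^ 2 + 2 ^ (d + 2))) * (max ((ρ₁ ^ 2)⁻¹) ((ρ₂ ^ 2)⁻¹) *
        (∫ τ in Iminus t₀ (r + ρ₁), ∫ x in Metric.ball x₀ (r + ρ₂), (max (v τ x - l) 0) ^ 2) +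
        caccTailTerm d s t₀ x₀ r ρ₁ ρ₂ (fun τ x => max (v τ x - l) 0)) := by
  have hΛ := h.one_le
  have hF := formConst_nonneg d s Λ
  set W := ∫ τ in Iminus t₀ (r + ρ₁), h.truncMass l τ with hWdef
  set P := ∫ τ in Iminus t₀ (r + ρ₁), h.truncTail l τ with hPdef
  have hW : 0 ≤ W := integral_nonneg fun τ => h.truncMass_nonneg l τ
  have hP : 0 ≤ P := integral_nonneg fun τ => h.truncTail_nonneg l τ
  change Λ * (t₀ - r ^ 2 - (t₀ - (r + ρ₁) ^ 2))⁻¹ * W + formConst d s Λ *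
    ((c / (r + ρ₂ / 2 - r)) ^ 2 * W + ((r + ρ₂) / (r + ρ₂ - (r + ρ₂ / 2))) ^ ((d : ℝ) + 2 * s) *
      ((r + ρ₂) ^ 2)⁻¹ * P) ≤ (Λ + formConst d s Λ * (4 * c ^ 2 + 2 ^ (d + 2))) *
        (max ((ρ₁ ^ 2)⁻¹) ((ρ₂ ^ 2)⁻¹) * W + ((r + ρ₂) / ρ₂) ^ d / ρ₂ ^ 2 * P)
  set m := max ((ρ₁ ^ 2)⁻¹) ((ρ₂ ^ 2)⁻¹) with hm
  have e1 : r + ρ₂ / 2 - r = ρ₂ / 2 := by ring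
  have e2 : r + ρ₂ - (r + ρ₂ / 2) = ρ₂ / 2 := by ring
  rw [e1, e2]
  have b1 : (t₀ - r ^ 2 - (t₀ - (r + ρ₁) ^ 2))⁻¹ ≤ m :=
    (inv_anti₀ (by positivity) (by nlinarith [mul_pos hr hρ₁])).trans (le_max_left _ _)
  have b2 : (c / (ρ₂ / 2)) ^ 2 ≤ 4 * c ^ 2 * m := by
    have : (c / (ρ₂ / 2)) ^ 2 = 4 * c ^ 2 * (ρ₂ ^ 2)⁻¹ := by field_simp; norm_num
    rw [this]
    exact mul_le_mul_of_nonneg_left (le_max_right _ _) (by positivity)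
  have b3 := rpow_div_le (p := (d : ℝ) + 2 * s) (d := d) hρ₂ (by linarith : ρ₂ ≤ r + ρ₂)
    (by linarith [h.order.2])
  set g := ((r + ρ₂) / ρ₂) ^ d / ρ₂ ^ 2
  have hg : 0 ≤ g := by positivity
  have hm0 : 0 ≤ m := le_max_of_le_left (by positivity)
  calc _ ≤ Λ * m * W + formConst d s Λ * (4 * c ^ 2 * m * W + 2 ^ (d + 2) * g * P) := by gcongr
    _ ≤ _ := by
      have p1 : 0 ≤ Λ * (g * P) := by positivity
      have p2 : 0 ≤ formConst d s Λ * (4 * c ^ 2) * (g * P) := by positivity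
      have p3 : 0 ≤ formConst d s Λ * 2 ^ (d + 2) * (m * W) := by positivity
      linarith

theorem CylinderSetting.of_closure_subset {s Λ T R r ρ₂ t₀ : ℝ} {x₀ : Ed d} {Ω : Set (Ed d)}
    {A : ℝ → Ed d → Ed d → Ed d} {K : ℝ → Ed d → Ed d → ℝ} {v : ℝ → Ed d → ℝ}
    {Dv : ℝ → Ed d → Ed d} (hd : 2 ≤ d) (hs : s ∈ Ioo (0 : ℝ) 1) (hΛ : 1 ≤ Λ)
    (hA : VectorFieldHyp d Λ A) (hK : KernelHyp d s Λ K)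
    (hv : LocalWeakReg d s (Ioo 0 T) Ω v Dv) (hR : 0 < R)
    (hc : closure ((Iminus t₀ (2 * R)) ×ˢ Metric.ball x₀ (2 * R)) ⊆ Ioo 0 T ×ˢ Ω)
    (hr : 0 < r) (hρ₂ : 0 < ρ₂) (hrR : r + ρ₂ ≤ R) :
    CylinderSetting d s Λ (t₀ - (2 * R) ^ 2) t₀ (r + ρ₂ / 2) (r + ρ₂) x₀ (Ioo 0 T) Ω A K v Dv := by
  rw [closure_prod_eq, Iminus, closure_Ioo (by nlinarith : t₀ - (2 * R) ^ 2 ≠ t₀),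
    closure_ball _ (by positivity)] at hc
  have h1 : t₀ ∈ Icc (t₀ - (2 * R) ^ 2) t₀ := ⟨by nlinarith, le_rfl⟩
  have h2 : x₀ ∈ closedBall x₀ (2 * R) := mem_closedBall_self (by positivity)
  refine ⟨hd, hs, hΛ, hA, hK, hv, fun t ht => (hc (mk_mem_prod ht h2)).1, fun x hx => ?_,
    by positivity, by linarith⟩
  exact (hc (mk_mem_prod h1 (closedBall_subset_closedBall (by linarith) hx))).2

theorem rpow_neg_mul_setIntegral (S : Set ℝ) (B : Set (Ed d)) {r p : ℝ} (hr : 0 < r)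
    (f g : ℝ → Ed d → ℝ) :
    r ^ (-p) * (∫ τ in S, ∫ x in B, ∫ y in B, f τ x * g τ y) =
      2 ^ p * ∫ τ in S, ∫ x in B, ∫ y in B, f τ x * g τ y / (2 * r) ^ p := by
  simp only [integral_div]
  rw [Real.mul_rpow zero_le_two hr.le, Real.rpow_neg hr.le]
  have : (0 : ℝ) < 2 ^ p := Real.rpow_pos_of_pos two_pos p
  field_simp

theorem caccioppoli_of_subsolution {s Λ c : ℝ} (hd : 2 ≤ d) (hs : s ∈ Ioo (0 : ℝ) 1)
    (hΛ : 1 ≤ Λ) (hc : 1 ≤ c)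
    (hcut : ∀ (x₀ : Ed d) (r ρ' : ℝ), 0 < r → r < ρ' →
      ∃ η : Ed d → ℝ, IsCutoff (closedBall x₀ ρ') η ∧ (∀ x ∈ Metric.ball x₀ r, η x = 1) ∧
        ∀ x, ‖gradient η x‖ ≤ c / (ρ' - r))
    {T : ℝ} {Ω : Set (Ed d)} {A : ℝ → Ed d → Ed d → Ed d} (hA : VectorFieldHyp d Λ A)
    {K : ℝ → Ed d → Ed d → ℝ} (hK : KernelHyp d s Λ K) {v : ℝ → Ed d → ℝ} {Dv : ℝ → Ed d → Ed d}
    (hv : LocalWeakReg d s (Ioo 0 T) Ω v Dv) (l : ℝ) {R : ℝ} (hR : R ∈ Ioc (0 : ℝ) 1)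
    {t₀ : ℝ} {x₀ : Ed d}
    (hcl : closure ((Iminus t₀ (2 * R)) ×ˢ Metric.ball x₀ (2 * R)) ⊆ Ioo 0 T ×ˢ Ω)
    {r ρ₁ ρ₂ : ℝ} (hρ₁ : 0 < ρ₁) (hr₁ : ρ₁ ≤ r) (hR₁ : r + ρ₁ ≤ R) (hρ₂ : 0 < ρ₂)
    (hR₂ : r + ρ₂ ≤ R) (hsub : IsLocalWeakSubsolutionHom A K (Ioo 0 T) Ω v Dv) :
    ∀ᵐ t ∂(volume.restrict (Iminus t₀ r)),
      (∫ x in Metric.ball x₀ r, (max (v t x - l) 0) ^ 2)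
        + caccLHS d s t₀ x₀ r r
            (fun τ x => max (v τ x - l) 0) (fun τ x => max (l - v τ x) 0)
            (truncGradPos v Dv l) ≤
      caccConst d s Λ c * max ((ρ₁ ^ 2)⁻¹) ((ρ₂ ^ 2)⁻¹) *
          (∫ τ in Iminus t₀ (r + ρ₁), ∫ x in Metric.ball x₀ (r + ρ₂),
            (max (v τ x - l) 0) ^ 2)
        + caccConst d s Λ c * caccTailTerm d s t₀ x₀ r ρ₁ ρ₂ (fun τ x => max (v τ x - l) 0) := by
  have hr : 0 < r := hρ₁.trans_le hr₁
  have h := CylinderSetting.of_closure_subset hd hs hΛ hA hK hv hR.1 hcl hr hρ₂ hR₂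
  obtain ⟨η, hη, h1, hM⟩ := hcut x₀ r (r + ρ₂ / 2) hr (by linarith)
  have hM1 : 1 ≤ c / (r + ρ₂ / 2 - r) := by
    rw [one_le_div (by linarith)]
    linarith [hR.2]
  obtain ⟨b0, b1, b2, b3⟩ := h.energy_bounds hsub hη l hr.le (by linarith) h1 hM hM1
    (a := t₀ - (r + ρ₁) ^ 2) (b := t₀ - r ^ 2)
    (by nlinarith [hR.1]) (by nlinarith) (by nlinarith [pow_pos hr 2])
  have hH := h.energyBound_le (c := c) hr hρ₁ hρ₂ l
  set H := h.energyBound (c / (r + ρ₂ / 2 - r)) l (t₀ - (r + ρ₁) ^ 2) (t₀ - r ^ 2)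
  have h2p : (2 : ℝ) ^ ((d : ℝ) + 2 * s) ≤ 2 ^ (d + 2) := by
    rw [← Real.rpow_natCast]
    refine Real.rpow_le_rpow_of_exponent_le one_le_two ?_
    push_cast
    linarith [hs.2]
  refine (ae_restrict_iff' measurableSet_Ioo).2 ?_
  filter_upwards [b0] with t h0 ht
  rw [caccLHS, rpow_neg_mul_setIntegral _ _ hr]
  have h3 : 0 ≤ H := (integral_nonneg fun _ => sq_nonneg _).trans (h0 ht)
  have h4 := (mul_le_mul_of_nonneg_left b3
    (Real.rpow_nonneg zero_le_two ((d : ℝ) + 2 * s))).trans (mul_le_mul_of_nonneg_right h2p h3)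
  calc _ ≤ H + (H + H + 2 ^ (d + 2) * H) := add_le_add (h0 ht) (add_le_add (add_le_add b1 b2) h4)
    _ = (3 + 2 ^ (d + 2)) * H := by ring
    _ ≤ _ := mul_le_mul_of_nonneg_left hH (by positivity)
    _ = _ := by rw [caccConst]; ring

theorem VectorFieldHyp.neg {Λ : ℝ} {A : ℝ → Ed d → Ed d → Ed d} (hA : VectorFieldHyp d Λ A) :
    VectorFieldHyp d Λ fun t x ξ => -A t x (-ξ) where
  meas ξ := (hA.meas (-ξ)).neg
  cont t x := ((hA.cont t x).comp continuous_neg).neg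
  growth t x ξ := by simpa using hA.growth t x (-ξ)
  monotone t x ξ η := by
    have := hA.monotone t x (-η) (-ξ)
    rwa [neg_sub_neg, ← neg_sub_neg (A t x (-η))] at this

theorem LocalWeakReg.neg {s : ℝ} {J : Set ℝ} {Ω : Set (Ed d)} {v : ℝ → Ed d → ℝ}
    {Dv : ℝ → Ed d → Ed d} (hv : LocalWeakReg d s J Ω v Dv) :
    LocalWeakReg d s J Ω (fun t x => -v t x) (fun t x => -Dv t x) where
  meas := hv.meas.neg
  measD := hv.measD.neg
  grad t ht φ h1 h2 h3 e := by
    simp only [neg_mul, inner_neg_left, mul_neg, integral_neg]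
    rw [hv.grad t ht φ h1 h2 h3 e]
  l2w12 := by simpa only [neg_sq, norm_neg] using hv.l2w12
  linfl2 := by simpa only [neg_sq] using hv.linfl2
  tail_ae := by simpa only [abs_neg] using hv.tail_ae
  tail_l2 := by simpa only [abs_neg] using hv.tail_l2

theorem IsTestFunction.neg {Ω : Set (Ed d)} {φ : ℝ → Ed d → ℝ} (h : IsTestFunction Ω φ) :
    IsTestFunction Ω fun t x => -φ t x := by
  obtain ⟨h1, k, hk, hk', h2⟩ := h
  refine ⟨h1.neg, k, hk, hk', fun t => ?_⟩
  change tsupport (-φ t) ⊆ k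
  rw [tsupport, Function.support_neg]
  exact h2 t

theorem mixedLHS_neg (A : ℝ → Ed d → Ed d → Ed d) (K : ℝ → Ed d → Ed d → ℝ) (Ω : Set (Ed d))
    (u : ℝ → Ed d → ℝ) (Du : ℝ → Ed d → Ed d) (φ : ℝ → Ed d → ℝ) (t₁ t₂ : ℝ) :
    mixedLHS (fun t x ξ => -A t x (-ξ)) K Ω (fun t x => -u t x) (fun t x => -Du t x) φ t₁ t₂ =
      mixedLHS A K Ω u Du (fun t x => -φ t x) t₁ t₂ := by
  have hg (t : ℝ) (x : Ed d) : gradient (fun y => -φ t y) x = -gradient (φ t) x := by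
    simp only [gradient, fderiv_fun_neg, map_neg]
  have hd (t : ℝ) (x : Ed d) : deriv (fun τ => -φ τ x) t = -deriv (fun τ => φ τ x) t :=
    deriv.fun_neg
  simp only [mixedLHS, hg, hd, neg_neg, inner_neg_left, inner_neg_right, neg_mul, mul_neg]
  congr 1
  refine integral_congr_ae (Eventually.of_forall fun t => ?_)
  refine integral_congr_ae (Eventually.of_forall fun x => ?_)
  refine integral_congr_ae (Eventually.of_forall fun y => ?_)
  simp only
  ring

theorem IsLocalWeakSupersolutionHom.neg {A : ℝ → Ed d → Ed d → Ed d} {K : ℝ → Ed d → Ed d → ℝ}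
    {J : Set ℝ} {Ω : Set (Ed d)} {v : ℝ → Ed d → ℝ} {Dv : ℝ → Ed d → Ed d}
    (h : IsLocalWeakSupersolutionHom A K J Ω v Dv) :
    IsLocalWeakSubsolutionHom (fun t x ξ => -A t x (-ξ)) K J Ω (fun t x => -v t x)
      (fun t x => -Dv t x) := by
  intro t₁ t₂ h12 hJ φ hφ h0
  rw [mixedLHS_neg]
  exact h t₁ t₂ h12 hJ _ hφ.neg fun t x => neg_nonpos.2 (h0 t x)

theorem norm_truncGradPos_neg (v : ℝ → Ed d → ℝ) (Dv : ℝ → Ed d → Ed d) (l t : ℝ) (x : Ed d) :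
    ‖truncGradPos (fun t x => -v t x) (fun t x => -Dv t x) (-l) t x‖ =
      ‖truncGradNeg v Dv l t x‖ := by
  simp only [truncGradPos, truncGradNeg, neg_lt_neg_iff]
  split_ifs <;> simp

theorem caccConst_pos (d : ℕ) (s c : ℝ) {Λ : ℝ} (hΛ : 1 ≤ Λ) : 0 < caccConst d s Λ c := by
  have := formConst_nonneg d s Λ
  rw [caccConst]
  positivity

/-- **Lemma 2.5, inequality (2.2): Caccioppoli inequality with time cutoff.** -/
theorem caccioppoli_with_time_cutoff
    (d : ℕ) (hd : 2 ≤ d) (s Λ : ℝ) (hs : s ∈ Set.Ioo (0 : ℝ) 1) (hΛ : 1 ≤ Λ) :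
    ∃ C : ℝ, 0 < C ∧
      ∀ (T : ℝ), 0 < T → ∀ (Ω : Set (Ed d)), IsOpen Ω → Bornology.IsBounded Ω →
      ∀ (A : ℝ → Ed d → Ed d → Ed d), VectorFieldHyp d Λ A →
      ∀ (K : ℝ → Ed d → Ed d → ℝ), KernelHyp d s Λ K →
      ∀ (v : ℝ → Ed d → ℝ) (Dv : ℝ → Ed d → Ed d),
        LocalWeakReg d s (Set.Ioo 0 T) Ω v Dv →
        ∀ (l : ℝ), ∀ R ∈ Set.Ioc (0 : ℝ) 1, ∀ (t₀ : ℝ) (x₀ : Ed d),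
          closure ((Iminus t₀ (2 * R)) ×ˢ Metric.ball x₀ (2 * R)) ⊆ (Set.Ioo 0 T) ×ˢ Ω →
          ∀ r ρ₁ ρ₂ : ℝ, 0 < ρ₁ → ρ₁ ≤ r → r + ρ₁ ≤ R → 0 < ρ₂ → ρ₂ ≤ r → r + ρ₂ ≤ R →
            (Iminus t₀ (r + ρ₁)) ×ˢ Metric.ball x₀ (r + ρ₂) ⊆ pCyl t₀ x₀ (2 * R) →
            -- subsolution case, with `w₊ = (v-l)₊`, `w₋ = (v-l)₋`
            ((IsLocalWeakSubsolutionHom A K (Set.Ioo 0 T) Ω v Dv →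
              ∀ᵐ t ∂(volume.restrict (Iminus t₀ r)),
                (∫ x in Metric.ball x₀ r, (max (v t x - l) 0) ^ 2)
                  + caccLHS d s t₀ x₀ r r
                      (fun τ x => max (v τ x - l) 0) (fun τ x => max (l - v τ x) 0)
                      (truncGradPos v Dv l) ≤
                C * max ((ρ₁ ^ 2)⁻¹) ((ρ₂ ^ 2)⁻¹) *
                    (∫ τ in Iminus t₀ (r + ρ₁), ∫ x in Metric.ball x₀ (r + ρ₂),
                      (max (v τ x - l) 0) ^ 2)
                  + C * caccTailTerm d s t₀ x₀ r ρ₁ ρ₂ (fun τ x => max (v τ x - l) 0)) ∧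
            -- supersolution case, with `w₊` and `w₋` interchanged
            (IsLocalWeakSupersolutionHom A K (Set.Ioo 0 T) Ω v Dv →
              ∀ᵐ t ∂(volume.restrict (Iminus t₀ r)),
                (∫ x in Metric.ball x₀ r, (max (l - v t x) 0) ^ 2)
                  + caccLHS d s t₀ x₀ r r
                      (fun τ x => max (l - v τ x) 0) (fun τ x => max (v τ x - l) 0)
                      (truncGradNeg v Dv l) ≤
                C * max ((ρ₁ ^ 2)⁻¹) ((ρ₂ ^ 2)⁻¹) *
                    (∫ τ in Iminus t₀ (r + ρ₁), ∫ x in Metric.ball x₀ (r + ρ₂),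
                      (max (l - v τ x) 0) ^ 2)
                  + C * caccTailTerm d s t₀ x₀ r ρ₁ ρ₂ (fun τ x => max (l - v τ x) 0))) := by
  obtain ⟨c, hc, hcut⟩ := exists_isCutoff d
  refine ⟨caccConst d s Λ c, caccConst_pos d s c hΛ, ?_⟩
  intro T _ Ω _ _ A hA K hK v Dv hv l R hR t₀ x₀ hcl r ρ₁ ρ₂ hρ₁ hr₁ hR₁ hρ₂ _ hR₂ _
  refine ⟨caccioppoli_of_subsolution hd hs hΛ hc hcut hA hK hv l hR hcl hρ₁ hr₁ hR₁ hρ₂ hR₂,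
    fun hsup => ?_⟩
  have h := caccioppoli_of_subsolution hd hs hΛ hc hcut hA.neg hK hv.neg (-l) hR hcl hρ₁ hr₁ hR₁
    hρ₂ hR₂ hsup.neg
  simpa only [caccLHS, norm_truncGradPos_neg, neg_sub_neg] using h
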